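/- Let r be a positive integer and ε > 0 be real. Let q be a cube-free positive integer, χ a primitive Dirichlet character mod q, and ℓ a positive integer with q^{1/(2r)} ≤ ℓ and 2ℓ ≤ q. Let I'_1 = (N_1, N_1 + L_1], …, I'_J = (N_J, N_J + L_J] be pairwise disjoint intervals of integers in [0, q) with ℓ ≤ L_j ≤ 2ℓ for each j and 0 ≤ N_1 < ⋯ < N_J < q. Then there is a constant C = C(ε, r) such that |∑_{j=1}^{J} S(N_j; L_j)| ≤ C · J^{1 − 1/(2r)} q^{1/(4r) + 1/(4r^2) + ε} ℓ^{1 − 1/r}. -/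

import Mathlib

namespace Burgess

open Polynomial

/-- Polynomials with pairwise distinct orders of vanishing at `0` are independent. -/
theorem sum_X_pow_mul_ne_zero {K κ : Type*} [Field K] [Fintype κ] (n : κ → ℕ)
    (hn : Function.Injective n) (g : κ → K[X]) (hg : ∀ k, (g k).eval 0 ≠ 0) (u : κ → K)
    (hu : u ≠ 0) : ∑ k, C (u k) * (X ^ n k * g k) ≠ 0 := by
  classical
  obtain ⟨k₀, hk₀⟩ := Function.ne_iff.mp hu
  obtain ⟨k, hk, hmin⟩ := (Finset.univ.filter fun k => u k ≠ 0).exists_min_image n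
    ⟨k₀, by simpa using hk₀⟩
  simp only [Finset.mem_filter, Finset.mem_univ, true_and] at hk hmin
  intro h
  have h1 := congrArg (fun P => coeff P (n k)) h
  simp only [finsetSum_coeff, coeff_zero, coeff_C_mul] at h1
  rw [Finset.sum_eq_single k] at h1
  · rw [coeff_X_pow_mul', if_pos le_rfl, Nat.sub_self, coeff_zero_eq_eval_zero] at h1
    exact mul_ne_zero hk (hg k) h1
  · intro b _ hb
    by_cases hub : u b = 0
    · simp [hub]
    · have := hmin b hub
      have h2 : n k < n b := lt_of_le_of_ne this fun h => hb (hn h).symm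
      rw [coeff_X_pow_mul', if_neg (by omega), mul_zero]
  · simp

/-- A homogeneous linear system given by polynomial combinations of low degree is solvable. -/
theorem exists_ne_zero_sum_eq_zero {K κ : Type*} [Field K] [Fintype κ] (P : κ → K[X]) (E : ℕ)
    (hP : ∀ k, (P k).degree < E) (hE : E < Fintype.card κ) :
    ∃ u : κ → K, u ≠ 0 ∧ ∑ k, C (u k) * P k = 0 := by
  let P' : κ → degreeLT K E := fun k => ⟨P k, mem_degreeLT.mpr (hP k)⟩
  have h : ¬ LinearIndependent K P' := by
    intro h
    have := h.fintype_card_le_finrank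
    rw [(degreeLTEquiv K E).finrank_eq] at this
    simp at this
    omega
  rw [Fintype.not_linearIndependent_iff] at h
  obtain ⟨u, hu, k, hk⟩ := h
  refine ⟨u, fun h0 => hk (by simp [h0]), ?_⟩
  have := congrArg Subtype.val hu
  simpa [P', smul_eq_C_mul] using this

/-- The arithmetic behind the choice of parameters in Stepanov's method. -/
theorem stepanov_parameters {d M M' g g' F : ℕ} (hd : 1 ≤ d) (hM : M = d * g + 1)
    (hM' : M' = d * g' + 1) (hMM' : M ≤ M') (hbig : 2 * (d ^ 2 + 2) ≤ M') :
    M * (g' + 1 - d) + d * M * F + (g + (4 + 2 * d * F)) <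
      d * (g + (4 + 2 * d * F)) * (g' + 1 - d) := by
  obtain ⟨w, hw⟩ : ∃ w, g' + 1 = d + w := by
    refine Nat.exists_eq_add_of_le ?_
    by_contra! h
    have : d * g' ≤ d * (d - 2) := Nat.mul_le_mul_left _ (by omega)
    have h3 : d * (d - 2) ≤ d ^ 2 := by rw [pow_two]; exact Nat.mul_le_mul_left _ (by omega)
    omega
  have hw' : g' + 1 - d = w := by omega
  rw [hw']
  zify at *
  have hg' : (g' : ℤ) = d + w - 1 := by linarith
  rw [hM] at hMM' ⊢
  rw [hg'] at hM'
  refine lt_of_mul_lt_mul_left ?_ (show (0 : ℤ) ≤ d by positivity)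
  have hdw : (d : ℤ) * w = M' - 1 - d ^ 2 + d := by rw [hM']; ring
  have e1 : (d : ℤ) * (d * (g + (4 + 2 * d * F)) * w) =
      (d * g + 4 * d + 2 * d ^ 2 * F) * (d * w) := by ring
  have e2 : (d : ℤ) * ((d * g + 1) * w + d * (d * g + 1) * F + (g + (4 + 2 * d * F))) =
      (d * g + 1) * (d * w) + d ^ 2 * (d * g + 1) * F + (d * g + 4 * d + 2 * d ^ 2 * F) := by ring
  rw [e1, e2, hdw]
  have hM0 : (0 : ℤ) ≤ d * g + 1 := by positivity
  generalize (d : ℤ) * g = y at *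
  have hd2 : (d : ℤ) ≤ d ^ 2 := by nlinarith
  have hF : (0 : ℤ) ≤ F := by positivity
  generalize hx : (d : ℤ) ^ 2 * F = x at *
  have hx0 : 0 ≤ x := by rw [← hx]; positivity
  have e3 : (y + 1) * (M' - 1 - d ^ 2 + d) + d ^ 2 * (y + 1) * F + (y + 4 * d + 2 * d ^ 2 * F)
      = (y + 1) * (M' - 1 - d ^ 2 + d) + x * (y + 1) + (y + 4 * d + 2 * x) := by rw [← hx]; ring
  have e4 : (y + 4 * d + 2 * d ^ 2 * F) * ((M' : ℤ) - 1 - d ^ 2 + d)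
     = (y + 4 * d + 2 * x) * ((M' : ℤ) - 1 - d ^ 2 + d) := by rw [← hx]; ring
  rw [e3, e4]
  set s : ℤ := M' - 1 - d ^ 2 + d with hs
  have hs2 : 2 * (s - 1) ≥ M' := by rw [hs]; linarith
  have h1 : 0 ≤ x * (2 * (s - 1) - (y + 1)) := mul_nonneg hx0 (by linarith)
  have h2 : 0 ≤ (4 * (d : ℤ) - 4) * (s - 1) := mul_nonneg (by linarith) (by linarith)
  linarith

theorem mixed_radix_injective {d J w e M : ℕ} (hw : w ≤ e) (he : (d - 1) * e + w ≤ M) :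
    Function.Injective fun k : Fin d × Fin J × Fin w =>
      (k.2.2 : ℕ) + k.1 * e + k.2.1 * M := by
  rintro ⟨i, j, l⟩ ⟨i', j', l'⟩ h
  have key : ∀ (i : Fin d) (j : Fin J) (l : Fin w), ((l : ℕ) + i * e + j * M) / M = j ∧
      ((l : ℕ) + i * e + j * M) % M / e = i ∧ ((l : ℕ) + i * e + j * M) % M % e = l := by
    intro i j l
    have hl := l.2
    have h0 : (i : ℕ) * e ≤ (d - 1) * e := Nat.mul_le_mul_right _ (by omega)
    have h1 : (l : ℕ) + i * e < M := by omega
    have h2 : (l : ℕ) < e := by omega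
    rw [Nat.add_mul_div_right _ _ (by omega), Nat.add_mul_mod_self_right, Nat.mod_eq_of_lt h1,
      Nat.div_eq_of_lt h1, Nat.add_mul_div_right _ _ (by omega), Nat.add_mul_mod_self_right,
      Nat.mod_eq_of_lt h2, Nat.div_eq_of_lt h2]
    simp
  simp only at h
  obtain ⟨a1, a2, a3⟩ := key i j l
  obtain ⟨b1, b2, b3⟩ := key i' j' l'
  rw [h] at a1 a2 a3
  ext <;> simp <;> omega

/-- The constant in Stepanov's bound. -/
def stepanovConst (d F : ℕ) : ℕ := 1 + d ^ 2 * F + d * (4 + 2 * d * F) + 2 * d * (d ^ 2 + 2)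

set_option maxHeartbeats 1000000 in
theorem stepanov_zero {K : Type*} [Field K] (p : ℕ) [Fact p.Prime] [CharP K p] [PerfectRing K p]
    (f g₀ : K[X]) (hf : f = X * g₀) (hg₀ : g₀.eval 0 ≠ 0) {m m' : ℕ} (hm' : m' ≠ 0) (hmm' : m ≤ m') (a : K)
    (Z : Finset K) (hZ : ∀ x ∈ Z, x ^ (p ^ m * p ^ m') = x ∧
      (f.eval x) ^ ((p ^ m * p ^ m' - 1) / (p - 1)) = a) :
    (p - 1) * Z.card ≤ p ^ m * p ^ m' + stepanovConst (p - 1) f.natDegree * p ^ m' := by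
  classical
  have hp := (Fact.out : p.Prime)
  set d := p - 1 with hd
  have hd1 : 1 ≤ d := by have := hp.two_le; omega
  set F := f.natDegree with hF
  set M := p ^ m with hM
  set M' := p ^ m' with hM'
  have hM1 : 1 ≤ M := Nat.one_le_pow _ _ hp.pos
  have hM'1 : 1 ≤ M' := Nat.one_le_pow _ _ hp.pos
  have hMM' : M ≤ M' := Nat.pow_le_pow_right hp.pos hmm'
  have hdvd : ∀ k, d ∣ p ^ k - 1 := fun k => by simpa using Nat.sub_dvd_pow_sub_pow p 1 k
  obtain ⟨g, hg⟩ := hdvd m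
  obtain ⟨g', hg'⟩ := hdvd m'
  have hg1 : M = d * g + 1 := by omega
  have hg'1 : M' = d * g' + 1 := by omega
  have hq : 1 < M * M' := by
    have : 1 < M' := Nat.one_lt_pow hm' hp.one_lt
    nlinarith
  by_cases hbig : 2 * (d ^ 2 + 2) ≤ M'
  swap
  · have hsub : Z.card ≤ M * M' := by
      have h1 : Z ⊆ (X ^ (M * M') - X : K[X]).roots.toFinset := by
        intro x hx
        simp only [Multiset.mem_toFinset]
        rw [mem_roots (FiniteField.X_pow_card_sub_X_ne_zero K hq)]
        simp [(hZ x hx).1]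
      refine (Finset.card_le_card h1).trans ((Multiset.toFinset_card_le _).trans ?_)
      refine (card_roots' _).trans ?_
      rw [FiniteField.X_pow_card_sub_X_natDegree_eq K hq]
    have : d * Z.card ≤ d * (M * M') := Nat.mul_le_mul_left _ hsub
    have h2 : d * (M * M') ≤ d * (2 * (d ^ 2 + 2) * M') := by
      gcongr; omega
    have h3 : d * (2 * (d ^ 2 + 2) * M') = 2 * d * (d ^ 2 + 2) * M' := by ring
    have h4 : 2 * d * (d ^ 2 + 2) * M' ≤ stepanovConst d F * M' := by
      gcongr; unfold stepanovConst; omega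
    omega
  set J := g + (4 + 2 * d * F) with hJ
  set w := g' + 1 - d with hw
  set e := g' + 1 with he
  have hpar : M * w + d * M * F + J < d * J * w := stepanov_parameters hd1 hg1 hg'1 hMM' hbig
  have hqd : (M * M' - 1) / d = M * g' + g := by
    have : M * M' - 1 = d * (M * g' + g) := by
      have : M * M' = d * (M * g' + g) + 1 := by rw [hg'1, Nat.mul_add, mul_one]; nlinarith [hg1]
      omega
    rw [this, Nat.mul_div_cancel_left _ hd1]
  have hgM : g ≤ M := by nlinarith
  have hw0 : w ≠ 0 := by rintro h0; rw [h0] at hpar; simp at hpar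
  let κ := Fin d × Fin J × Fin w
  obtain ⟨u, hu0, hu⟩ := exists_ne_zero_sum_eq_zero (κ := κ)
    (fun k => C (a ^ (k.1 : ℕ)) * (X ^ (M * k.2.2 + k.2.1) * f ^ ((M - g) * k.1 : ℕ)))
    (M * w + d * M * F + J) (by
      rintro ⟨i, j, l⟩
      refine (degree_le_natDegree).trans_lt ?_
      rw [Nat.cast_lt]
      refine (natDegree_C_mul_le _ _).trans_lt ?_
      refine (natDegree_mul_le).trans_lt ?_
      have h1 : (f ^ ((M - g) * i : ℕ)).natDegree ≤ d * M * F := by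
        refine natDegree_pow_le.trans ?_
        have : (M - g) * (i : ℕ) ≤ M * d := Nat.mul_le_mul (by omega) i.2.le
        rw [mul_comm d M]
        exact Nat.mul_le_mul_right _ this
      have h2 : M * (l : ℕ) ≤ M * w := Nat.mul_le_mul_left _ l.2.le
      have h3 := j.2
      rw [natDegree_X_pow]
      simp only
      omega) (by simp only [κ, Fintype.card_prod, Fintype.card_fin]; rw [← mul_assoc]; exact hpar)
  choose s hs using fun k : κ => (iterateFrobeniusEquiv K p m).surjective (u k)
  have hs' : ∀ k, s k ^ M = u k := fun k => by
    rw [← hs k, coe_iterateFrobeniusEquiv, iterateFrobenius_def]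
  let U : K[X] := ∑ k : κ, C (s k) * (X ^ ((k.2.2 : ℕ) + k.1 * e + k.2.1 * M') *
    g₀ ^ ((k.1 : ℕ) * e))
  have hU0 : U ≠ 0 := by
    refine sum_X_pow_mul_ne_zero _ (mixed_radix_injective (by omega) ?_) _ ?_ _ ?_
    · obtain ⟨d', hd'⟩ : ∃ d', d = d' + 1 := ⟨d - 1, by omega⟩
      have h1 : d * g' = d' * g' + g' := by rw [hd']; ring
      have h2 : (d - 1) * e = d' * g' + d' := by rw [hd', he]; simp; ring
      omega
    · intro k
      rw [eval_pow]
      exact pow_ne_zero _ hg₀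
    · intro h
      apply hu0
      ext k
      rw [← hs' k, h]
      simp [show M ≠ 0 by omega]
  have hUx : ∀ x ∈ Z, U.eval x = 0 := by
    intro x hx
    obtain ⟨hx1, hx2⟩ := hZ x hx
    rw [hqd] at hx2
    have h1 : U.eval x ^ M = 0 := by
      have h2 := congrArg (eval x) hu
      rw [eval_finsetSum, eval_zero] at h2
      simp only [U, eval_finsetSum]
      rw [hM, sum_pow_char_pow, ← h2]
      refine Finset.sum_congr rfl ?_
      rintro ⟨i, j, l⟩ _
      rw [← hM]
      simp only [eval_mul, eval_C, eval_pow, eval_X, mul_pow, hs']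
      congr 1
      have hfx : f.eval x = x * g₀.eval x := by rw [hf]; simp
      have e1 : (x ^ ((l : ℕ) + i * e + j * M')) ^ M * (eval x g₀ ^ ((i : ℕ) * e)) ^ M
          = x ^ (M * l) * (x ^ (M * M')) ^ (j : ℕ) * (f.eval x ^ (M * e)) ^ (i : ℕ) := by
        rw [hfx]; ring
      rw [e1, hx1, ← hx2, pow_add, show M * e = (M * g' + g) + (M - g) by
        rw [he, Nat.mul_add]; omega, pow_add (eval x f)]
      ring
    exact pow_eq_zero_iff (by omega) |>.mp h1
  have hdegU : U.natDegree ≤ w + d * e * F + J * M' := by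
    refine natDegree_sum_le_of_forall_le _ _ ?_
    rintro ⟨i, j, l⟩ _
    refine (natDegree_C_mul_le _ _).trans ?_
    have e1 : (X ^ ((l : ℕ) + i * e + j * M') * g₀ ^ ((i : ℕ) * e) : K[X])
        = X ^ ((l : ℕ) + j * M') * f ^ ((i : ℕ) * e) := by rw [hf]; ring
    rw [e1]
    refine natDegree_mul_le.trans ?_
    rw [natDegree_X_pow]
    have h1 : (f ^ ((i : ℕ) * e)).natDegree ≤ d * e * F := by
      refine natDegree_pow_le.trans ?_
      exact Nat.mul_le_mul_right _ (Nat.mul_le_mul_right _ i.2.le)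
    have h2 : (j : ℕ) * M' ≤ J * M' := Nat.mul_le_mul_right _ j.2.le
    have h3 := l.2
    omega
  have hcard : Z.card ≤ w + d * e * F + J * M' := by
    have h1 : Z ⊆ U.roots.toFinset := by
      intro x hx
      simp only [Multiset.mem_toFinset]
      rw [mem_roots hU0]
      exact hUx x hx
    exact (Finset.card_le_card h1).trans ((Multiset.toFinset_card_le _).trans
      ((card_roots' _).trans hdegU))
  have heM : e ≤ M' := by rw [he, hg'1]; nlinarith
  have hwM : d * w ≤ M' := by
    have : d * w ≤ d * g' := Nat.mul_le_mul_left _ (by omega)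
    omega
  calc d * Z.card ≤ d * (w + d * e * F + J * M') := Nat.mul_le_mul_left _ hcard
    _ = d * w + d ^ 2 * e * F + (d * g + d * (4 + 2 * d * F)) * M' := by rw [hJ]; ring
    _ ≤ M' + d ^ 2 * M' * F + (M + d * (4 + 2 * d * F)) * M' := by
        gcongr; omega
    _ = M * M' + (1 + d ^ 2 * F + d * (4 + 2 * d * F)) * M' := by ring
    _ ≤ M * M' + stepanovConst d F * M' := by
        gcongr; unfold stepanovConst; omega

theorem norm_mulChar_le_one {R : Type*} [CommRing R] [Finite Rˣ] (χ : MulChar R ℂ) (a : R) :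
    ‖χ a‖ ≤ 1 := by
  by_cases ha : IsUnit a
  · obtain ⟨u, rfl⟩ := ha
    have h := isOfFinOrder_of_finite u
    obtain ⟨n, hn, hu⟩ := h.exists_pow_eq_one
    have h1 : (χ (u : R)) ^ n = 1 := by
      rw [← map_pow, ← Units.val_pow_eq_pow_val, hu, Units.val_one, map_one]
    exact (Complex.norm_eq_one_of_pow_eq_one h1 hn.ne').le
  · simp [χ.map_nonunit ha]

theorem norm_sum_mulChar_norm_le {p : ℕ} [Fact p.Prime] {K : Type*} [Field K] [Fintype K]
    [Algebra (ZMod p) K] {m m' : ℕ} (hm' : m' ≠ 0) (hmm' : m ≤ m')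
    (hK : Fintype.card K = p ^ m * p ^ m') (χ : MulChar (ZMod p) ℂ) (hχ : χ ≠ 1)
    (f g₀ : K[X]) (hf : f = X * g₀) (hg₀ : g₀.eval 0 ≠ 0) :
    ‖∑ x : K, χ (Algebra.norm (ZMod p) (f.eval x))‖ ≤
      (stepanovConst (p - 1) f.natDegree + f.natDegree : ℕ) * (p : ℝ) ^ m' := by
  classical
  have hp := (Fact.out : p.Prime)
  have : CharP K p := charP_of_injective_algebraMap (algebraMap (ZMod p) K).injective p
  have hf0 : f ≠ 0 := by
    rw [hf]; refine mul_ne_zero X_ne_zero fun h => hg₀ (by simp [h])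
  let N : ZMod p → Finset K := fun a =>
    Finset.univ.filter fun x => Algebra.norm (ZMod p) (f.eval x) = a
  set S : ℕ := stepanovConst (p - 1) f.natDegree with hS
  have hN : ∀ a, (p - 1) * (N a).card ≤ p ^ m * p ^ m' + S * p ^ m' := by
    intro a
    refine stepanov_zero p f g₀ hf hg₀ hm' hmm' (algebraMap (ZMod p) K a) (N a) ?_
    intro x hx
    refine ⟨by rw [← hK]; exact FiniteField.pow_card x, ?_⟩
    have hx' : Algebra.norm (ZMod p) (f.eval x) = a := by simpa [N] using hx
    rw [← hx', FiniteField.algebraMap_norm_eq_pow, Nat.card_eq_fintype_card, hK, Nat.card_zmod]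
  have hN0 : (N 0).card ≤ f.natDegree := by
    have h1 : N 0 ⊆ f.roots.toFinset := by
      intro x hx
      simp only [Multiset.mem_toFinset]
      rw [mem_roots hf0]
      have hx' : Algebra.norm (ZMod p) (f.eval x) = 0 := by simpa [N] using hx
      exact Algebra.norm_eq_zero_iff.mp hx'
    exact (Finset.card_le_card h1).trans ((Multiset.toFinset_card_le _).trans (card_roots' _))
  have hsum : ∑ a, (N a).card = p ^ m * p ^ m' := by
    rw [← hK, ← Finset.card_univ, ← Finset.card_eq_sum_card_fiberwise (fun _ _ => Finset.mem_univ _)]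
  have hfib : ∑ x : K, χ (Algebra.norm (ZMod p) (f.eval x)) = ∑ a, χ a * ((N a).card : ℂ) := by
    rw [← Finset.sum_fiberwise_of_maps_to (g := fun x => Algebra.norm (ZMod p) (f.eval x))
      (t := Finset.univ) (fun _ _ => Finset.mem_univ _)]
    refine Finset.sum_congr rfl fun a _ => ?_
    rw [Finset.sum_congr rfl (g := fun _ => χ a) (fun x hx => by
      rw [(Finset.mem_filter.mp hx).2])]
    simp [N, mul_comm]
  set t : ℝ := (p ^ m * p ^ m' + S * p ^ m' : ℝ) / (p - 1 : ℝ) with ht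
  have hp1 : (0 : ℝ) < p - 1 := by
    have : (1 : ℝ) < p := by exact_mod_cast hp.one_lt
    linarith
  have hNt : ∀ a, ((N a).card : ℝ) ≤ t := by
    intro a
    rw [ht, le_div_iff₀ hp1]
    have := hN a
    have h2 : (((p - 1 : ℕ) : ℝ) * (N a).card) ≤ (p ^ m * p ^ m' + S * p ^ m' : ℝ) := by
      exact_mod_cast this
    rw [Nat.cast_sub hp.one_le, Nat.cast_one] at h2
    linarith
  have hzero : ∑ a, χ a * (t : ℂ) = 0 := by
    rw [← Finset.sum_mul, MulChar.sum_eq_zero_of_ne_one hχ, zero_mul]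
  have hsplit : ∑ a, χ a * ((N a).card : ℂ) = - ∑ a, χ a * ((t - (N a).card : ℝ) : ℂ) := by
    rw [← sub_eq_zero, sub_neg_eq_add, ← Finset.sum_add_distrib]
    simpa [mul_sub] using hzero
  rw [hfib, hsplit, norm_neg, ← Finset.add_sum_erase _ _ (Finset.mem_univ (0 : ZMod p))]
  rw [MulChar.map_zero, zero_mul, zero_add]
  refine (norm_sum_le _ _).trans ?_
  have h1 : ∀ a ∈ Finset.univ.erase (0 : ZMod p),
      ‖χ a * ((t - (N a).card : ℝ) : ℂ)‖ ≤ t - (N a).card := by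
    intro a _
    rw [norm_mul, Complex.norm_real, Real.norm_of_nonneg (by linarith [hNt a])]
    exact mul_le_of_le_one_left (by linarith [hNt a]) (norm_mulChar_le_one χ a)
  refine (Finset.sum_le_sum h1).trans ?_
  rw [Finset.sum_sub_distrib, Finset.sum_const, Finset.card_erase_of_mem (Finset.mem_univ _),
    Finset.card_univ, ZMod.card, nsmul_eq_mul, Nat.cast_sub hp.one_le, Nat.cast_one]
  have h2 : ((p : ℝ) - 1) * t = p ^ m * p ^ m' + S * p ^ m' := by
    rw [ht]; field_simp
  have h3 : ∑ a ∈ Finset.univ.erase (0 : ZMod p), ((N a).card : ℝ) =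
      p ^ m * p ^ m' - (N 0).card := by
    rw [eq_sub_iff_add_eq, Finset.sum_erase_add _ _ (Finset.mem_univ _)]
    exact_mod_cast hsum
  rw [h2, h3]
  have h4 : ((N 0).card : ℝ) ≤ f.natDegree := by exact_mod_cast hN0
  have h5 : (1 : ℝ) ≤ (p : ℝ) ^ m' := one_le_pow₀ (by exact_mod_cast hp.one_le)
  have h6 : (f.natDegree : ℝ) ≤ f.natDegree * (p : ℝ) ^ m' :=
    le_mul_of_one_le_right (by positivity) h5
  push_cast
  linarith

theorem stepanovConst_mono (d : ℕ) : Monotone (stepanovConst d) := by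
  intro F F' h
  unfold stepanovConst
  gcongr

section LFunction

variable {p : ℕ} [Fact p.Prime] {ι : Type*} [Fintype ι]

/-- The character sum over the degree `j` extension of `ZMod p` attached to a product of
linear factors. -/
noncomputable def extSum (χ : MulChar (ZMod p) ℂ) (c : ι → ZMod p) (e : ι → ℕ) (j : ℕ) : ℂ :=
  ∑ᶠ x : GaloisField p j, χ (Algebra.norm (ZMod p)
    (∏ i, (algebraMap (ZMod p) (GaloisField p j) (c i) - x) ^ e i))

theorem norm_extSum_le (χ : MulChar (ZMod p) ℂ) (hχ : χ ≠ 1) (c : ι → ZMod p) (e : ι → ℕ)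
    {i₀ : ι} (he : e i₀ = 1) (hc : ∀ i, i ≠ i₀ → c i ≠ c i₀) :
    ∃ C : ℝ, 0 ≤ C ∧ ∀ j, j ≠ 0 → ‖extSum χ c e j‖ ≤ C * √p ^ j := by
  classical
  have hp := (Fact.out : p.Prime)
  set E := ∑ i, e i with hE
  refine ⟨((stepanovConst (p - 1) E + E : ℕ) : ℝ) * √p, by positivity, fun j hj => ?_⟩
  let K := GaloisField p j
  let : Fintype K := Fintype.ofFinite K
  let φ := algebraMap (ZMod p) K
  let f : K[X] := ∏ i, (C (φ (c i - c i₀)) - X) ^ e i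
  let g : K[X] := -∏ i ∈ Finset.univ.erase i₀, (C (φ (c i - c i₀)) - X) ^ e i
  have hf : f = X * g := by
    simp only [f, g]
    rw [← Finset.mul_prod_erase _ _ (Finset.mem_univ i₀), he]
    simp
  have hg : g.eval 0 ≠ 0 := by
    simp only [g, eval_neg, eval_prod, neg_ne_zero]
    refine Finset.prod_ne_zero_iff.mpr fun i hi => ?_
    simp only [eval_pow, eval_sub, eval_C, eval_X, sub_zero]
    refine pow_ne_zero _ ?_
    rw [Ne, map_eq_zero, sub_eq_zero]
    exact hc i (Finset.ne_of_mem_erase hi)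
  have hdeg : f.natDegree ≤ E := by
    refine (natDegree_prod_le _ _).trans (Finset.sum_le_sum fun i _ => ?_)
    refine natDegree_pow_le.trans ?_
    refine (Nat.mul_le_mul_left _ ((natDegree_sub_le _ _).trans ?_)).trans_eq (mul_one _)
    simp
  have hcard : Fintype.card K = p ^ (j / 2) * p ^ (j - j / 2) := by
    rw [← Nat.card_eq_fintype_card, GaloisField.card p j hj, ← pow_add]
    congr 1; omega
  have key := norm_sum_mulChar_norm_le (m := j / 2) (m' := j - j / 2) (by omega) (by omega)
    hcard χ hχ f g hf hg
  have hS : extSum χ c e j = ∑ x : K, χ (Algebra.norm (ZMod p) (f.eval x)) := by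
    rw [extSum, finsum_eq_sum_of_fintype, ← Equiv.sum_comp (Equiv.addRight (φ (c i₀)))]
    refine Finset.sum_congr rfl fun x _ => ?_
    simp only [f, eval_prod, eval_pow, eval_sub, eval_C, eval_X, Equiv.coe_addRight, map_sub, φ]
    congr 2
    refine Finset.prod_congr rfl fun i _ => ?_
    congr 1
    ring
  rw [hS]
  refine key.trans ?_
  have hp1 : (1 : ℝ) ≤ √p := Real.one_le_sqrt.mpr (by exact_mod_cast hp.one_le)
  have h1 : (p : ℝ) ^ (j - j / 2) ≤ √p * √p ^ j := by
    rw [← pow_succ']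
    calc (p : ℝ) ^ (j - j / 2) = √p ^ (2 * (j - j / 2)) := by
          rw [pow_mul, Real.sq_sqrt (by positivity)]
      _ ≤ √p ^ (j + 1) := pow_le_pow_right₀ hp1 (by omega)
  rw [mul_assoc]
  have h2 : stepanovConst (p - 1) f.natDegree + f.natDegree ≤ stepanovConst (p - 1) E + E :=
    add_le_add (stepanovConst_mono _ hdeg) hdeg
  gcongr

end LFunction

section MinpolyFibres

variable {F K : Type*} [Field F] [Field K] [Algebra F K]

theorem norm_algebraMap_sub_eq_minpoly_eval_pow [FiniteDimensional F K] (x : K) (c : F) :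
    Algebra.norm F (algebraMap F K c - x) =
      ((minpoly F x).eval c) ^ (Module.finrank F K / (minpoly F x).natDegree) := by
  have hx : IsIntegral F x := Algebra.IsIntegral.isIntegral x
  have hd : 0 < (minpoly F x).natDegree := minpoly.natDegree_pos hx
  set y : K := algebraMap F K c - x with hy
  have hyi : IsIntegral F y := Algebra.IsIntegral.isIntegral y
  have hyx : y = -(x - algebraMap F K c) := by rw [hy]; ring
  have hmin : minpoly F y = (-1) ^ (minpoly F x).natDegree *
      ((minpoly F x).comp (X + C c)).comp (-X) := by
    rw [hyx, minpoly.neg, minpoly.sub_algebraMap, natDegree_comp]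
    simp
  have hdeg : (minpoly F y).natDegree = (minpoly F x).natDegree := by
    rw [hyx, minpoly.neg, minpoly.sub_algebraMap]
    rw [show ((-1 : F[X]) ^ ((minpoly F x).comp (X + C c)).natDegree) =
      C ((-1) ^ ((minpoly F x).comp (X + C c)).natDegree) by simp]
    rw [natDegree_C_mul (by simp), natDegree_comp, natDegree_comp]
    simp
  have hcoeff : (minpoly F y).coeff 0 = (-1) ^ (minpoly F x).natDegree * (minpoly F x).eval c := by
    rw [hmin, coeff_zero_eq_eval_zero]
    simp
  have hgen : Algebra.norm F (IntermediateField.AdjoinSimple.gen F y) = (minpoly F x).eval c := by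
    rw [← IntermediateField.adjoin.powerBasis_gen hyi,
      Algebra.PowerBasis.norm_gen_eq_coeff_zero_minpoly, ← PowerBasis.natDegree_minpoly,
      IntermediateField.adjoin.powerBasis_gen hyi, IntermediateField.minpoly_gen, hdeg, hcoeff,
      ← mul_assoc, ← mul_pow]
    simp
  rw [Algebra.norm_eq_norm_adjoin F y, hgen,
    ← Module.finrank_mul_finrank F (IntermediateField.adjoin F {y}) K,
    IntermediateField.adjoin.finrank hyi, hdeg, Nat.mul_div_cancel_left _ hd]

theorem card_filter_minpoly_eq [Fintype F] [Fintype K] [DecidableEq F[X]] {P : F[X]}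
    (hP : Irreducible P) (hm : P.Monic)
    (hd : P.natDegree ∣ Module.finrank F K) :
    (Finset.univ.filter fun x : K => minpoly F x = P).card = P.natDegree := by
  classical
  have hdvd : P ∣ X ^ (Fintype.card K) - X := by
    rw [Module.card_eq_pow_finrank (K := F), ← Nat.card_eq_fintype_card]
    exact hP.natDegree_dvd_iff_dvd_X_pow_card_pow_sub_X.mp hd
  have hsplit : (P.map (algebraMap F K)).Splits := by
    have h1 : (X ^ (Fintype.card K) - X : K[X]).Splits := by
      rw [splits_iff_card_roots, FiniteField.roots_X_pow_card_sub_X]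
      rw [FiniteField.X_pow_card_sub_X_natDegree_eq K Fintype.one_lt_card]
      rfl
    refine h1.of_dvd (FiniteField.X_pow_card_sub_X_ne_zero K Fintype.one_lt_card) ?_
    simpa using map_dvd (mapRingHom (algebraMap F K)) hdvd
  have hsep : P.Separable := PerfectField.separable_of_irreducible hP
  have hroots : (Finset.univ.filter fun x : K => minpoly F x = P) =
      (P.map (algebraMap F K)).roots.toFinset := by
    ext x
    rw [Finset.mem_filter, Multiset.mem_toFinset, mem_roots (map_ne_zero hP.ne_zero), IsRoot,
      eval_map_algebraMap]
    constructor
    · rintro ⟨-, rfl⟩; exact minpoly.aeval F x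
    · intro h
      exact ⟨Finset.mem_univ _, (minpoly.eq_of_irreducible_of_monic hP h hm).symm⟩
  rw [hroots, Multiset.toFinset_card_of_nodup (nodup_roots hsep.map)]
  rw [splits_iff_card_roots] at hsplit
  rw [hsplit, natDegree_map]

end MinpolyFibres

section MonicSums

variable (F : Type*) [Field F] [Fintype F]

open scoped Classical in
/-- The monic polynomials of degree `n` over a finite field. -/
noncomputable def monics (n : ℕ) : Finset F[X] :=
  Finset.univ.image fun a : Fin n → F => X ^ n + ∑ i, C (a i) * X ^ (i : ℕ)

open scoped Classical in
/-- The monic irreducible polynomials of degree `n` over a finite field. -/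
noncomputable def monicIrreds (n : ℕ) : Finset F[X] :=
  (monics F n).filter Irreducible

variable {F}

theorem mem_monics {n : ℕ} {g : F[X]} : g ∈ monics F n ↔ g.Monic ∧ g.natDegree = n := by
  classical
  rw [monics, Finset.mem_image]
  constructor
  · rintro ⟨a, -, rfl⟩
    have hlt : (∑ i : Fin n, C (a i) * X ^ (i : ℕ)).degree < (n : WithBot ℕ) := by
      refine (degree_sum_le _ _).trans_lt ?_
      exact (Finset.sup_lt_iff (WithBot.bot_lt_coe n)).mpr fun i _ => (degree_C_mul_X_pow_le _ _).trans_lt (WithBot.coe_lt_coe.mpr i.2)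
    exact ⟨monic_X_pow_add hlt, natDegree_eq_of_degree_eq_some
      ((degree_add_eq_left_of_degree_lt (by rwa [degree_X_pow])).trans (degree_X_pow n))⟩
  · rintro ⟨hm, rfl⟩
    refine ⟨fun i => g.coeff i, Finset.mem_univ _, ?_⟩
    conv_rhs => rw [hm.as_sum]
    rw [Finset.sum_range]

theorem mem_monicIrreds {n : ℕ} {g : F[X]} :
    g ∈ monicIrreds F n ↔ (g.Monic ∧ g.natDegree = n) ∧ Irreducible g := by
  classical
  rw [monicIrreds, Finset.mem_filter, mem_monics]

theorem monics_zero : monics F 0 = {1} := by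
  ext g
  rw [mem_monics, Finset.mem_singleton]
  constructor
  · rintro ⟨h1, h2⟩; exact h1.natDegree_eq_zero.mp h2
  · rintro rfl; simp

theorem sum_monics_dvd (Ψ : F[X] →* ℂ) {P : F[X]} (hP : P.Monic) (n : ℕ) [DecidablePred (P ∣ ·)] :
    (∑ g ∈ monics F n, if P ∣ g then Ψ g else 0) =
      if P.natDegree ≤ n then Ψ P * ∑ g ∈ monics F (n - P.natDegree), Ψ g else 0 := by
  classical
  split_ifs with h
  · rw [← Finset.sum_filter, Finset.mul_sum]
    symm
    refine Finset.sum_bij (fun g _ => P * g) ?_ ?_ ?_ ?_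
    · intro g hg
      rw [mem_monics] at hg
      rw [Finset.mem_filter, mem_monics, hP.natDegree_mul hg.1, hg.2]
      exact ⟨⟨hP.mul hg.1, by omega⟩, dvd_mul_right _ _⟩
    · intro a _ b _ hab
      exact mul_left_cancel₀ hP.ne_zero hab
    · intro g hg
      rw [Finset.mem_filter, mem_monics] at hg
      obtain ⟨⟨h1, h2⟩, k, rfl⟩ := hg
      have hk : k.Monic := hP.of_mul_monic_left h1
      refine ⟨k, ?_, rfl⟩
      rw [mem_monics]
      rw [hP.natDegree_mul hk] at h2
      exact ⟨hk, by omega⟩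
    · intro g _; rw [map_mul]
  · refine Finset.sum_eq_zero fun g hg => ?_
    rw [mem_monics] at hg
    rw [if_neg]
    intro hd
    have := natDegree_le_of_dvd hd hg.1.ne_zero
    omega

theorem natDegree_eq_sum_prime_powers {g : F[X]} (hg : g.Monic) [DecidableRel (α := F[X]) (· ∣ ·)] :
    g.natDegree = ∑ d ∈ Finset.Icc 1 g.natDegree, ∑ P ∈ monicIrreds F d,
      ∑ k ∈ Finset.Icc 1 g.natDegree, if P ^ k ∣ g then d else 0 := by
  classical
  have hcount : ∀ d, ∀ P ∈ monicIrreds F d,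
      (∑ k ∈ Finset.Icc 1 g.natDegree, if P ^ k ∣ g then d else 0) =
        (UniqueFactorizationMonoid.normalizedFactors g).count P * P.natDegree := by
    intro d P hP
    rw [mem_monicIrreds] at hP
    rw [← Finset.sum_filter, Finset.sum_const, smul_eq_mul, hP.1.2]
    congr 1
    have hnorm : normalize P = P := hP.1.1.normalize_eq_self
    have hiff : ∀ k, P ^ k ∣ g ↔ k ≤ (UniqueFactorizationMonoid.normalizedFactors g).count P := by
      intro k
      have := UniqueFactorizationMonoid.emultiplicity_eq_count_normalizedFactors hP.2 hg.ne_zero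
      rw [hnorm] at this
      rw [pow_dvd_iff_le_emultiplicity, this]
      exact Nat.cast_le
    have hle : (UniqueFactorizationMonoid.normalizedFactors g).count P ≤ g.natDegree := by
      have h1 := natDegree_le_of_dvd ((hiff _).mpr le_rfl) hg.ne_zero
      rw [hP.1.1.natDegree_pow] at h1
      have := hP.2.natDegree_pos
      nlinarith
    have : (Finset.Icc 1 g.natDegree).filter (fun k => P ^ k ∣ g) =
        Finset.Icc 1 ((UniqueFactorizationMonoid.normalizedFactors g).count P) := by
      ext k
      rw [Finset.mem_filter, Finset.mem_Icc, Finset.mem_Icc, hiff]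
      omega
    rw [this, Nat.card_Icc]; omega
  rw [Finset.sum_congr rfl fun d _ => Finset.sum_congr rfl (hcount d)]
  have hdisj : Set.PairwiseDisjoint (↑(Finset.Icc 1 g.natDegree)) (monicIrreds F) := by
    intro a _ b _ hab
    rw [Function.onFun, Finset.disjoint_left]
    intro P h1 h2
    rw [mem_monicIrreds] at h1 h2
    exact hab (h1.1.2.symm.trans h2.1.2)
  rw [← Finset.sum_biUnion hdisj]
  conv_lhs => rw [← hg.normalize_eq_self, ← UniqueFactorizationMonoid.prod_normalizedFactors_eq hg.ne_zero]
  rw [natDegree_multiset_prod _ (UniqueFactorizationMonoid.zero_notMem_normalizedFactors _),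
    Finset.sum_multiset_map_count]
  simp only [smul_eq_mul]
  refine Finset.sum_subset ?_ ?_
  · intro P hP
    rw [Multiset.mem_toFinset, Polynomial.mem_normalizedFactors_iff hg.ne_zero] at hP
    rw [Finset.mem_biUnion]
    exact ⟨P.natDegree, Finset.mem_Icc.mpr ⟨hP.1.natDegree_pos,
      natDegree_le_of_dvd hP.2.2 hg.ne_zero⟩, mem_monicIrreds.mpr ⟨⟨hP.2.1, rfl⟩, hP.1⟩⟩
  · intro P _ hP
    rw [Multiset.mem_toFinset] at hP
    rw [Multiset.count_eq_zero_of_notMem hP, zero_mul]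

/-- The von Mangoldt weighted sum of a multiplicative function over prime powers of degree `j`. -/
noncomputable def primePowerSum (Ψ : F[X] →* ℂ) (j : ℕ) : ℂ :=
  ∑ d ∈ j.divisors, ∑ P ∈ monicIrreds F d, (d : ℂ) * Ψ P ^ (j / d)

theorem sum_monics_recurrence (Ψ : F[X] →* ℂ) (n : ℕ) :
    (n : ℂ) * ∑ g ∈ monics F n, Ψ g =
      ∑ j ∈ Finset.Icc 1 n, primePowerSum Ψ j * ∑ g ∈ monics F (n - j), Ψ g := by
  classical
  have h1 : (n : ℂ) * ∑ g ∈ monics F n, Ψ g = ∑ d ∈ Finset.Icc 1 n, ∑ P ∈ monicIrreds F d,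
      ∑ k ∈ Finset.Icc 1 n, (d : ℂ) * ∑ g ∈ monics F n, if P ^ k ∣ g then Ψ g else 0 := by
    rw [Finset.mul_sum]
    have : ∀ g ∈ monics F n, (n : ℂ) * Ψ g = ∑ d ∈ Finset.Icc 1 n, ∑ P ∈ monicIrreds F d,
        ∑ k ∈ Finset.Icc 1 n, (d : ℂ) * if P ^ k ∣ g then Ψ g else 0 := by
      intro g hg
      rw [mem_monics] at hg
      have := natDegree_eq_sum_prime_powers hg.1
      rw [hg.2] at this
      have h2 : (n : ℂ) = ((∑ d ∈ Finset.Icc 1 n, ∑ P ∈ monicIrreds F d,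
        ∑ k ∈ Finset.Icc 1 n, if P ^ k ∣ g then d else 0 : ℕ) : ℂ) := by rw [← this]
      rw [h2]
      push_cast
      simp only [Finset.sum_mul]
      refine Finset.sum_congr rfl fun d _ => Finset.sum_congr rfl fun P _ =>
        Finset.sum_congr rfl fun k _ => ?_
      split_ifs <;> simp
    rw [Finset.sum_congr rfl this, Finset.sum_comm]
    refine Finset.sum_congr rfl fun d _ => ?_
    rw [Finset.sum_comm]
    refine Finset.sum_congr rfl fun P _ => ?_
    rw [Finset.sum_comm]
    simp only [Finset.mul_sum]
  have h2 : ∀ j ∈ Finset.Icc 1 n, primePowerSum Ψ j * ∑ g ∈ monics F (n - j), Ψ g =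
      ∑ d ∈ Finset.Icc 1 n, ∑ P ∈ monicIrreds F d,
        if d ∣ j then (d : ℂ) * Ψ P ^ (j / d) * ∑ g ∈ monics F (n - j), Ψ g else 0 := by
    intro j hj
    rw [Finset.mem_Icc] at hj
    rw [primePowerSum, Finset.sum_mul]
    have : j.divisors = (Finset.Icc 1 n).filter (· ∣ j) := by
      ext d
      rw [Nat.mem_divisors, Finset.mem_filter, Finset.mem_Icc]
      refine ⟨fun h => ⟨⟨Nat.pos_of_dvd_of_pos h.1 (by omega),
        (Nat.le_of_dvd (by omega) h.1).trans hj.2⟩, h.1⟩, fun h => ⟨h.2, by omega⟩⟩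
    rw [this, Finset.sum_filter]
    refine Finset.sum_congr rfl fun d _ => ?_
    split_ifs
    · rw [Finset.sum_mul]
    · simp
  rw [h1, Finset.sum_congr rfl h2, Finset.sum_comm]
  refine Finset.sum_congr rfl fun d hd => ?_
  rw [Finset.mem_Icc] at hd
  rw [Finset.sum_comm (s := Finset.Icc 1 n)]
  refine Finset.sum_congr rfl fun P hP => ?_
  rw [mem_monicIrreds] at hP
  have h3 : ∀ k ∈ Finset.Icc 1 n, ((d : ℂ) * ∑ g ∈ monics F n, if P ^ k ∣ g then Ψ g else 0) =
      if k * d ≤ n then (d : ℂ) * Ψ P ^ k * ∑ g ∈ monics F (n - k * d), Ψ g else 0 := by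
    intro k _
    rw [sum_monics_dvd Ψ (hP.1.1.pow k), hP.1.1.natDegree_pow, hP.1.2]
    split_ifs
    · rw [map_pow, mul_assoc]
    · simp
  rw [Finset.sum_congr rfl h3, ← Finset.sum_filter, ← Finset.sum_filter]
  refine Finset.sum_bij (fun k _ => k * d) ?_ ?_ ?_ ?_
  · intro k hk
    rw [Finset.mem_filter, Finset.mem_Icc] at hk ⊢
    exact ⟨⟨Nat.mul_pos (by omega) (by omega), hk.2⟩, dvd_mul_left _ _⟩
  · intro a _ b _ hab
    exact Nat.eq_of_mul_eq_mul_right (by omega) hab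
  · intro j hj
    rw [Finset.mem_filter, Finset.mem_Icc] at hj
    obtain ⟨⟨ha, hb⟩, k, rfl⟩ := hj
    refine ⟨k, ?_, mul_comm _ _⟩
    rw [Finset.mem_filter, Finset.mem_Icc]
    refine ⟨⟨?_, ?_⟩, by rwa [mul_comm]⟩
    · exact Nat.pos_of_ne_zero (by rintro rfl; simp at ha)
    · nlinarith
  · intro k _
    rw [Nat.mul_div_cancel _ (by omega)]

end MonicSums

section LCoefficients

variable {p : ℕ} [Fact p.Prime] {ι : Type*} [Fintype ι]

/-- The multiplicative function on polynomials whose `L`-function encodes `extSum`. -/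
noncomputable def evalChar (χ : MulChar (ZMod p) ℂ) (c : ι → ZMod p) (e : ι → ℕ) :
    (ZMod p)[X] →* ℂ where
  toFun g := χ (∏ i, g.eval (c i) ^ e i)
  map_one' := by simp
  map_mul' g h := by simp [mul_pow, Finset.prod_mul_distrib]

theorem evalChar_apply (χ : MulChar (ZMod p) ℂ) (c : ι → ZMod p) (e : ι → ℕ) (g : (ZMod p)[X]) :
    evalChar χ c e g = χ (∏ i, g.eval (c i) ^ e i) := rfl

theorem extSum_eq_primePowerSum (χ : MulChar (ZMod p) ℂ) (c : ι → ZMod p) (e : ι → ℕ) {j : ℕ}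
    (hj : j ≠ 0) : extSum χ c e j = primePowerSum (evalChar χ c e) j := by
  classical
  have : Fintype (GaloisField p j) := Fintype.ofFinite _
  have hfr : Module.finrank (ZMod p) (GaloisField p j) = j := GaloisField.finrank p hj
  have hint : ∀ x : GaloisField p j, IsIntegral (ZMod p) x := fun x =>
    Algebra.IsIntegral.isIntegral x
  have hdvd : ∀ x : GaloisField p j, (minpoly (ZMod p) x).natDegree ∣ j := fun x => by
    exact (minpoly.degree_dvd (hint x)).trans (dvd_of_eq hfr)
  rw [extSum, finsum_eq_sum_of_fintype, primePowerSum]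
  have h1 : ∀ x : GaloisField p j, χ (Algebra.norm (ZMod p)
      (∏ i, (algebraMap (ZMod p) (GaloisField p j) (c i) - x) ^ e i)) =
      evalChar χ c e (minpoly (ZMod p) x) ^ (j / (minpoly (ZMod p) x).natDegree) := by
    intro x
    rw [evalChar_apply, ← map_pow, map_prod, ← Finset.prod_pow]
    congr 1
    refine Finset.prod_congr rfl fun i _ => ?_
    rw [map_pow, norm_algebraMap_sub_eq_minpoly_eval_pow, hfr, ← pow_mul, ← pow_mul, mul_comm]
  have hmem : ∀ x : GaloisField p j, minpoly (ZMod p) x ∈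
      j.divisors.biUnion (monicIrreds (ZMod p)) := fun x => by
    rw [Finset.mem_biUnion]
    exact ⟨_, Nat.mem_divisors.mpr ⟨hdvd x, hj⟩, mem_monicIrreds.mpr
      ⟨⟨minpoly.monic (hint x), rfl⟩, minpoly.irreducible (hint x)⟩⟩
  rw [Finset.sum_congr rfl fun x _ => h1 x, ← Finset.sum_fiberwise_of_maps_to (fun x _ => hmem x),
    Finset.sum_biUnion]
  · refine Finset.sum_congr rfl fun d hd => Finset.sum_congr rfl fun P hP => ?_
    rw [mem_monicIrreds] at hP
    rw [Finset.sum_congr rfl (g := fun _ => evalChar χ c e P ^ (j / d)), Finset.sum_const,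
      card_filter_minpoly_eq hP.2 hP.1.1, hP.1.2, nsmul_eq_mul]
    · rw [hfr, hP.1.2]; exact Nat.dvd_of_mem_divisors hd
    · intro x hx
      rw [(Finset.mem_filter.mp hx).2, hP.1.2]
  · intro a _ b _ hab
    rw [Function.onFun, Finset.disjoint_left]
    intro P h1 h2
    rw [mem_monicIrreds] at h1 h2
    exact hab (h1.1.2.symm.trans h2.1.2)

theorem sum_monics_evalChar_eq_zero (χ : MulChar (ZMod p) ℂ) (hχ : χ ≠ 1) (c : ι → ZMod p)
    (e : ι → ℕ) {i₀ : ι} (he : e i₀ = 1) (hc : ∀ i, i ≠ i₀ → c i ≠ c i₀) {n : ℕ}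
    (hn : Fintype.card ι ≤ n) : ∑ g ∈ monics (ZMod p) n, evalChar χ c e g = 0 := by
  classical
  have hp := (Fact.out : p.Prime)
  set h : (ZMod p)[X] := ∏ i ∈ Finset.univ.erase i₀, (X - C (c i)) with hh
  have hdeg : h.natDegree < n := by
    rw [hh, natDegree_prod_of_monic _ _ fun i _ => monic_X_sub_C _]
    simp only [natDegree_X_sub_C, Finset.sum_const, smul_eq_mul, mul_one]
    rw [Finset.card_erase_of_mem (Finset.mem_univ _), Finset.card_univ]
    have : 0 < Fintype.card ι := Fintype.card_pos_iff.mpr ⟨i₀⟩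
    omega
  have h0 : h.eval (c i₀) ≠ 0 := by
    rw [hh, eval_prod]
    refine Finset.prod_ne_zero_iff.mpr fun i hi => ?_
    rw [eval_sub, eval_X, eval_C, sub_ne_zero]
    exact (hc i (Finset.ne_of_mem_erase hi)).symm
  have hz : ∀ i, i ≠ i₀ → h.eval (c i) = 0 := by
    intro i hi
    rw [hh, eval_prod]
    exact Finset.prod_eq_zero (Finset.mem_erase.mpr ⟨hi, Finset.mem_univ _⟩) (by simp)
  have hmon : ∀ (t : ZMod p) (g : (ZMod p)[X]), g ∈ monics (ZMod p) n →
      g + C t * h ∈ monics (ZMod p) n := by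
    intro t g hg
    rw [mem_monics] at hg ⊢
    have hlt : (C t * h).degree < g.degree := by
      rw [degree_eq_natDegree hg.1.ne_zero, hg.2]
      refine (degree_le_natDegree).trans_lt ?_
      exact WithBot.coe_lt_coe.mpr ((natDegree_C_mul_le _ _).trans_lt hdeg)
    exact ⟨hg.1.add_of_left hlt, by rw [natDegree_add_eq_left_of_degree_lt hlt, hg.2]⟩
  have hshift : ∀ t : ZMod p, ∑ g ∈ monics (ZMod p) n, evalChar χ c e (g + C t * h) =
      ∑ g ∈ monics (ZMod p) n, evalChar χ c e g := by
    intro t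
    refine Finset.sum_nbij' (fun g => g + C t * h) (fun g => g + C (-t) * h)
      (fun g hg => hmon t g hg) (fun g hg => hmon (-t) g hg) ?_ ?_ fun _ _ => rfl
    · intro g _; simp
    · intro g _; simp
  have hsum : ∑ t : ZMod p, ∑ g ∈ monics (ZMod p) n, evalChar χ c e (g + C t * h) = 0 := by
    rw [Finset.sum_comm]
    refine Finset.sum_eq_zero fun g _ => ?_
    have : ∀ t : ZMod p, evalChar χ c e (g + C t * h) =
        χ (∏ i ∈ Finset.univ.erase i₀, g.eval (c i) ^ e i) *
          χ (g.eval (c i₀) + t * h.eval (c i₀)) := by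
      intro t
      rw [evalChar_apply, ← Finset.mul_prod_erase _ _ (Finset.mem_univ i₀), he, pow_one, map_mul,
        mul_comm]
      congr 2
      · refine Finset.prod_congr rfl fun i hi => ?_
        simp [hz i (Finset.ne_of_mem_erase hi)]
      · simp
    rw [Finset.sum_congr rfl fun t _ => this t, ← Finset.mul_sum]
    have h2 : ∑ t : ZMod p, χ (g.eval (c i₀) + t * h.eval (c i₀)) = ∑ t : ZMod p, χ t := by
      refine Fintype.sum_bijective (fun t => g.eval (c i₀) + t * h.eval (c i₀)) ?_ _ _
        fun _ => rfl
      refine Finite.injective_iff_bijective.mp fun a b hab => ?_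
      simpa [h0] using hab
    rw [h2, MulChar.sum_eq_zero_of_ne_one hχ, mul_zero]
  rw [Finset.sum_congr rfl fun t _ => hshift t, Finset.sum_const, Finset.card_univ, ZMod.card,
    nsmul_eq_mul] at hsum
  exact (mul_eq_zero.mp hsum).resolve_left (by exact_mod_cast hp.ne_zero)

theorem sum_monics_one_evalChar (χ : MulChar (ZMod p) ℂ) (c : ι → ZMod p) (e : ι → ℕ) :
    ∑ g ∈ monics (ZMod p) 1, evalChar χ c e g = ∑ x, χ (∏ i, (c i - x) ^ e i) := by
  classical
  symm
  refine Finset.sum_bij (fun x _ => X - C x) ?_ ?_ ?_ ?_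
  · intro x _
    rw [mem_monics]
    exact ⟨monic_X_sub_C x, natDegree_X_sub_C x⟩
  · intro a _ b _ hab
    simpa using hab
  · intro g hg
    rw [mem_monics] at hg
    refine ⟨-g.coeff 0, Finset.mem_univ _, ?_⟩
    conv_rhs => rw [hg.1.eq_X_add_C hg.2]
    simp
  · intro x _
    simp [evalChar_apply]

end LCoefficients

section RiemannHypothesis

/-- A polynomial that is divisible by `X - t` in the ring of power series of radius of convergence
exceeding `‖t‖` vanishes at `t`. -/
theorem eval_eq_zero_of_eq_mul_powerSeries {Q M : ℂ[X]} {G : PowerSeries ℂ} {t : ℂ} {C R : ℝ}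
    (hR : 0 < R) (hC : 0 ≤ C) (hG : ∀ j, ‖PowerSeries.coeff j G‖ ≤ C * R ^ j) (ht : ‖t‖ * R < 1)
    (h : (Q : PowerSeries ℂ) = ((X - Polynomial.C t : ℂ[X]) : PowerSeries ℂ) * (M * G)) :
    Q.eval t = 0 := by
  set H : PowerSeries ℂ := (M : PowerSeries ℂ) * G with hH
  have hcoeff0 : Q.coeff 0 = -t * PowerSeries.coeff 0 H := by
    rw [← Polynomial.coeff_coe, h, PowerSeries.coeff_zero_eq_constantCoeff_apply,
      PowerSeries.coeff_zero_eq_constantCoeff_apply, map_mul]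
    simp
  have hcoeff : ∀ n, Q.coeff (n + 1) = PowerSeries.coeff n H - t * PowerSeries.coeff (n + 1) H := by
    intro n
    rw [← Polynomial.coeff_coe, h, Polynomial.coe_sub, sub_mul, map_sub, Polynomial.coe_X,
      Polynomial.coe_C, PowerSeries.coeff_succ_X_mul, PowerSeries.coeff_C_mul]
  have hpart : ∀ N, ∑ n ∈ Finset.range (N + 1), Q.coeff n * t ^ n =
      -t ^ (N + 1) * PowerSeries.coeff N H := by
    intro N
    induction N with
    | zero => simp [hcoeff0]
    | succ N ih => rw [Finset.sum_range_succ, ih, hcoeff]; ring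
  set B : ℝ := ∑ i ∈ Finset.range (M.natDegree + 1), ‖M.coeff i‖ * (R⁻¹) ^ i with hB
  have hHb : ∀ N, ‖PowerSeries.coeff N H‖ ≤ B * C * R ^ N := by
    intro N
    rw [hH, PowerSeries.coeff_mul]
    refine (norm_sum_le _ _).trans ?_
    have h1 : ∀ x ∈ Finset.HasAntidiagonal.antidiagonal N,
        ‖PowerSeries.coeff x.1 (M : PowerSeries ℂ) * PowerSeries.coeff x.2 G‖ ≤
          ‖M.coeff x.1‖ * (R⁻¹) ^ x.1 * (C * R ^ N) := by
      intro x hx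
      rw [Finset.HasAntidiagonal.mem_antidiagonal] at hx
      rw [norm_mul, Polynomial.coeff_coe, mul_assoc]
      refine mul_le_mul_of_nonneg_left ((hG _).trans_eq ?_) (norm_nonneg _)
      rw [← hx, pow_add, inv_pow]
      field_simp
    refine (Finset.sum_le_sum h1).trans ?_
    rw [← Finset.sum_mul, mul_assoc]
    refine mul_le_mul_of_nonneg_right ?_ (by positivity)
    rw [Finset.Nat.sum_antidiagonal_eq_sum_range_succ_mk]
    rcases le_total N M.natDegree with hN | hN
    · exact Finset.sum_le_sum_of_subset_of_nonneg (Finset.range_mono (by omega))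
        fun _ _ _ => by positivity
    · refine (Finset.sum_subset (Finset.range_mono (by omega)) fun i _ hi => ?_).symm.le
      rw [Finset.mem_range, not_lt] at hi
      rw [coeff_eq_zero_of_natDegree_lt (by omega)]
      simp
  have hlim : Filter.Tendsto (fun N => ‖t‖ * (B * C) * (‖t‖ * R) ^ N) Filter.atTop (nhds 0) := by
    have := (tendsto_pow_atTop_nhds_zero_of_lt_one (by positivity) ht).const_mul (‖t‖ * (B * C))
    simpa using this
  have hle : ∀ᶠ N in Filter.atTop, ‖Q.eval t‖ ≤ ‖t‖ * (B * C) * (‖t‖ * R) ^ N := by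
    filter_upwards [Filter.eventually_ge_atTop Q.natDegree] with N hN
    rw [eval_eq_sum_range' (Nat.lt_succ_of_le hN), hpart, norm_mul, norm_neg, norm_pow]
    calc ‖t‖ ^ (N + 1) * ‖PowerSeries.coeff N H‖ ≤ ‖t‖ ^ (N + 1) * (B * C * R ^ N) := by
          gcongr; exact hHb N
      _ = _ := by rw [mul_pow]; ring
  have := ge_of_tendsto hlim hle
  exact norm_le_zero_iff.mp this

/-- If the logarithmic derivative of a polynomial `L` with `L(0) = 1` has radius of convergence at
least `1 / R`, then the linear coefficient of `L` is at most `R` times its degree. -/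
theorem norm_coeff_one_le_of_log_deriv {c S : ℕ → ℂ} {m : ℕ} {C R : ℝ} (hR : 0 < R) (hC : 0 ≤ C)
    (hc0 : c 0 = 1) (hcm : ∀ n, m ≤ n → c n = 0)
    (hrec : ∀ n : ℕ, (n : ℂ) * c n = ∑ j ∈ Finset.Icc 1 n, S j * c (n - j))
    (hS : ∀ j, j ≠ 0 → ‖S j‖ ≤ C * R ^ j) : ‖c 1‖ ≤ m * R := by
  classical
  set L : ℂ[X] := ∑ n ∈ Finset.range m, Polynomial.C (c n) * X ^ n with hL
  have hLc : ∀ n, L.coeff n = c n := by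
    intro n
    rw [hL, finsetSum_coeff]
    simp only [coeff_C_mul_X_pow, Finset.sum_ite_eq, Finset.mem_range]
    split_ifs with h
    · rfl
    · exact (hcm n (not_lt.mp h)).symm
  set G : PowerSeries ℂ := PowerSeries.mk fun j => if j = 0 then 0 else S j with hG
  have hGb : ∀ j, ‖PowerSeries.coeff j G‖ ≤ C * R ^ j := by
    intro j
    rw [hG, PowerSeries.coeff_mk]
    split_ifs with h
    · rw [norm_zero]; positivity
    · exact hS j h
  have hL0 : L ≠ 0 := by
    intro h
    have := hLc 0
    rw [h, hc0, coeff_zero] at this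
    exact zero_ne_one this
  have hLG : ((X * derivative L : ℂ[X]) : PowerSeries ℂ) = L * G := by
    ext n
    rw [Polynomial.coeff_coe]
    have h1 : (X * derivative L).coeff n = (n : ℂ) * c n := by
      cases n with
      | zero => simp
      | succ n => rw [coeff_X_mul, coeff_derivative, hLc]; push_cast; ring
    rw [h1, hrec, mul_comm (L : PowerSeries ℂ), PowerSeries.coeff_mul,
      Finset.Nat.sum_antidiagonal_eq_sum_range_succ_mk]
    symm
    rw [← Finset.sum_subset (s₁ := Finset.Icc 1 n)]
    · refine Finset.sum_congr rfl fun j hj => ?_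
      rw [Finset.mem_Icc] at hj
      rw [hG, PowerSeries.coeff_mk, if_neg (by omega), Polynomial.coeff_coe, hLc]
    · intro j hj
      rw [Finset.mem_Icc] at hj
      rw [Finset.mem_range]; omega
    · intro j hj hj'
      rw [Finset.mem_range] at hj
      rw [Finset.mem_Icc] at hj'
      rw [hG, PowerSeries.coeff_mk, if_pos (by omega), zero_mul]
  have heval0 : L.eval 0 = 1 := by rw [← coeff_zero_eq_eval_zero, hLc, hc0]
  have hroot : ∀ t, L.eval t = 0 → 1 ≤ ‖t‖ * R := by
    intro t ht
    by_contra! hlt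
    obtain ⟨M, hM, hnd⟩ := exists_eq_pow_rootMultiplicity_mul_and_not_dvd L hL0 t
    set k := L.rootMultiplicity t with hk
    have hkpos : 0 < k := (rootMultiplicity_pos hL0).mpr ht
    obtain ⟨k', hk'⟩ : ∃ k', k = k' + 1 := ⟨k - 1, by omega⟩
    rw [hk'] at hM
    set D : ℂ[X] := X - Polynomial.C t with hD
    have hD0 : D ≠ 0 := X_sub_C_ne_zero t
    set Q : ℂ[X] := X * (Polynomial.C ((k' : ℂ) + 1) * M + D * derivative M) with hQ
    have hder : X * derivative L = D ^ k' * Q := by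
      rw [hM, derivative_mul, derivative_pow_succ, hD, derivative_sub, derivative_X, derivative_C,
        hQ]
      ring
    have hDk : ((D ^ k' : ℂ[X]) : PowerSeries ℂ) ≠ 0 := by
      rw [Ne, Polynomial.coe_eq_zero_iff]
      exact pow_ne_zero _ hD0
    have hmain : (Q : PowerSeries ℂ) = (D : PowerSeries ℂ) * (M * G) := by
      refine mul_left_cancel₀ hDk ?_
      rw [← Polynomial.coe_mul, ← hder, hLG, hM, pow_succ, Polynomial.coe_mul, Polynomial.coe_mul]
      ring
    have hQt := eval_eq_zero_of_eq_mul_powerSeries hR hC hGb hlt hmain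
    have hMt : M.eval t ≠ 0 := fun h => hnd (dvd_iff_isRoot.mpr h)
    have ht0 : t ≠ 0 := by
      rintro rfl
      rw [heval0] at ht
      exact one_ne_zero ht
    rw [hQ] at hQt
    simp only [eval_mul, eval_X, eval_add, eval_C, hD, eval_sub, sub_self, zero_mul, add_zero] at hQt
    have hk1 : (k' : ℂ) + 1 ≠ 0 := by exact_mod_cast Nat.succ_ne_zero k'
    exact mul_ne_zero ht0 (mul_ne_zero hk1 hMt) hQt
  have hsum := (IsAlgClosed.splits L).eval_derivative_div_eval_of_ne_zero (x := 0)
    (by rw [heval0]; exact one_ne_zero)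
  rw [heval0, div_one, ← coeff_zero_eq_eval_zero, coeff_derivative, hLc] at hsum
  have hc1 : c 1 = (L.roots.map fun z => 1 / (0 - z)).sum := by
    rw [← hsum]; simp
  rw [hc1]
  have hcard : (Multiset.card L.roots : ℝ) ≤ m := by
    have h1 := L.card_roots'
    have h2 : L.natDegree ≤ m := by
      rw [natDegree_le_iff_coeff_eq_zero]
      intro n hn
      rw [hLc, hcm n hn.le]
    exact_mod_cast h1.trans h2
  refine (norm_multiset_sum_le _).trans ?_
  refine le_trans ?_ (mul_le_mul_of_nonneg_right hcard hR.le)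
  rw [Multiset.map_map]
  have := Multiset.sum_le_card_nsmul (Multiset.map (norm ∘ fun z => 1 / (0 - z)) L.roots) R ?_
  · simpa using this
  · intro x hx
    rw [Multiset.mem_map] at hx
    obtain ⟨z, hz, rfl⟩ := hx
    have hz' := hroot z (isRoot_of_mem_roots hz)
    have hzpos : 0 < ‖z‖ := by
      by_contra! h
      have : ‖z‖ = 0 := le_antisymm h (norm_nonneg _)
      rw [this] at hz'; linarith
    simp only [Function.comp, zero_sub, norm_div, norm_one, norm_neg]
    rw [div_le_iff₀ hzpos, mul_comm]
    exact hz'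

/-- The Weil bound for complete character sums over products of linear factors. -/
theorem norm_sum_mulChar_prod_le {p : ℕ} [Fact p.Prime] {ι : Type*} [Fintype ι]
    (χ : MulChar (ZMod p) ℂ) (hχ : χ ≠ 1) (c : ι → ZMod p) (e : ι → ℕ) {i₀ : ι} (he : e i₀ = 1)
    (hc : ∀ i, i ≠ i₀ → c i ≠ c i₀) :
    ‖∑ x, χ (∏ i, (c i - x) ^ e i)‖ ≤ Fintype.card ι * √p := by
  obtain ⟨C, hC, hS⟩ := norm_extSum_le χ hχ c e he hc
  have hp : (0 : ℝ) < √p := Real.sqrt_pos.mpr (by exact_mod_cast (Fact.out : p.Prime).pos)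
  rw [← sum_monics_one_evalChar]
  refine norm_coeff_one_le_of_log_deriv (c := fun n => ∑ g ∈ monics (ZMod p) n, evalChar χ c e g)
    (S := primePowerSum (evalChar χ c e)) hp hC ?_ ?_ ?_ ?_
  · simp [monics_zero]
  · exact fun n hn => sum_monics_evalChar_eq_zero χ hχ c e he hc hn
  · exact fun n => sum_monics_recurrence _ n
  · intro j hj
    rw [← extSum_eq_primePowerSum χ c e hj]
    exact hS j hj

end RiemannHypothesis

section CompleteSums

variable {q : ℕ} {ι : Type*} [Fintype ι]

/-- The value of a character or of its conjugate. -/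
noncomputable def signedChar (χ : DirichletCharacter ℂ q) (s : Bool) (a : ZMod q) : ℂ :=
  if s then χ a else (starRingEnd ℂ) (χ a)

theorem norm_signedChar_le [NeZero q] (χ : DirichletCharacter ℂ q) (s : Bool) (a : ZMod q) :
    ‖signedChar χ s a‖ ≤ 1 := by
  unfold signedChar
  split_ifs
  · exact norm_mulChar_le_one χ a
  · rw [RCLike.norm_conj]; exact norm_mulChar_le_one χ a

theorem signedChar_mul (χ : DirichletCharacter ℂ q) (s : Bool) (a b : ZMod q) :
    signedChar χ s (a * b) = signedChar χ s a * signedChar χ s b := by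
  unfold signedChar
  split_ifs <;> simp

theorem conj_signedChar (χ : DirichletCharacter ℂ q) (s : Bool) (a : ZMod q) :
    (starRingEnd ℂ) (signedChar χ s a) = signedChar χ (!s) a := by
  cases s <;> simp [signedChar]

theorem signedChar_eq_zero (χ : DirichletCharacter ℂ q) (s : Bool) {a : ZMod q} (ha : ¬IsUnit a) :
    signedChar χ s a = 0 := by
  unfold signedChar
  rw [χ.map_nonunit ha]
  simp

/-- The complete sum of a product of shifted characters. -/
noncomputable def completeSum [NeZero q] (χ : DirichletCharacter ℂ q) (s : ι → Bool) (b : ι → ℤ) :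
    ℂ :=
  ∑ x : ZMod q, ∏ i, signedChar χ (s i) (x + b i)

theorem norm_completeSum_not [NeZero q] (χ : DirichletCharacter ℂ q) (s : ι → Bool) (b : ι → ℤ) :
    ‖completeSum χ (fun i => !(s i)) b‖ = ‖completeSum χ s b‖ := by
  rw [← RCLike.norm_conj (completeSum χ s b), completeSum, completeSum, map_sum]
  simp only [map_prod, conj_signedChar]

theorem norm_completeSum_le [NeZero q] (χ : DirichletCharacter ℂ q) (s : ι → Bool) (b : ι → ℤ) :
    ‖completeSum χ s b‖ ≤ q := by
  refine (norm_sum_le _ _).trans ?_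
  refine (Finset.sum_le_sum (g := fun _ => (1 : ℝ)) fun x _ => ?_).trans_eq (by simp [ZMod.card])
  rw [norm_prod]
  exact Finset.prod_le_one (fun _ _ => norm_nonneg _) fun i _ => norm_signedChar_le χ _ _

/-- A local form of primitivity: the character is nontrivial on every kernel of reduction to a
maximal proper divisor of the modulus. -/
def LocallyPrimitive (χ : DirichletCharacter ℂ q) : Prop :=
  ∀ p : ℕ, p.Prime → p ∣ q → ∃ u : ZMod q, IsUnit u ∧ ((q / p : ℕ) : ZMod q) ∣ u - 1 ∧ χ u ≠ 1

theorem norm_completeSum_prime_le {p : ℕ} [Fact p.Prime] (χ : DirichletCharacter ℂ p) (hχ : χ ≠ 1)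
    (s : ι → Bool) (b : ι → ℤ) {i₀ : ι} (hb : ∀ i, i ≠ i₀ → ¬ (p : ℤ) ∣ b i - b i₀) :
    ‖completeSum χ s b‖ ≤ Fintype.card ι * √p := by
  classical
  have hp := (Fact.out : p.Prime)
  have hp2 : p ≠ 2 := by
    rintro rfl
    apply hχ
    refine MulChar.ext fun u => ?_
    have : u = 1 := Subsingleton.elim (α := (ZMod 2)ˣ) _ _
    rw [this]; simp
  have hp3 : 3 ≤ p := by have := hp.two_le; omega
  wlog hs : s i₀ = true generalizing s with H
  · rw [← norm_completeSum_not]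
    exact H _ (by simpa using hs)
  have hconj : ∀ a : ZMod p, (starRingEnd ℂ) (χ a) = χ (a ^ (p - 2)) := by
    intro a
    rcases eq_or_ne a 0 with rfl | ha
    · rw [zero_pow (by omega), χ.map_zero, map_zero]
    · have h1 : a ^ (p - 2) * a = 1 := by
        rw [← pow_succ, show p - 2 + 1 = p - 1 by omega, ZMod.pow_card_sub_one_eq_one ha]
      have h2 : χ (a ^ (p - 2)) * χ a = 1 := by rw [← map_mul, h1, map_one]
      have h3 : ‖χ a‖ = 1 := DirichletCharacter.unit_norm_eq_one χ (Units.mk0 a ha)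
      have h4 : (starRingEnd ℂ) (χ a) * χ a = 1 := by
        rw [mul_comm, Complex.mul_conj, Complex.normSq_eq_norm_sq, h3]; simp
      have h5 : χ a ≠ 0 := by intro h; rw [h, norm_zero] at h3; exact zero_ne_one h3
      exact mul_right_cancel₀ h5 (h4.trans h2.symm)
  have key := norm_sum_mulChar_prod_le χ hχ (fun i => (b i : ZMod p))
    (fun i => if s i then 1 else p - 2) (i₀ := i₀) (by simp [hs]) (fun i hi h => hb i hi (by
      rw [← ZMod.intCast_zmod_eq_zero_iff_dvd]; push_cast; rw [sub_eq_zero]; exact h))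
  convert key using 2
  rw [completeSum, ← Equiv.sum_comp (Equiv.neg (ZMod p))]
  refine Finset.sum_congr rfl fun x _ => ?_
  rw [map_prod]
  refine Finset.prod_congr rfl fun i _ => ?_
  rw [signedChar, Equiv.neg_apply, neg_add_eq_sub]
  split_ifs
  · rw [pow_one]
  · rw [hconj]

end CompleteSums

theorem addChar_map_sum {A M κ : Type*} [AddCommMonoid A] [CommMonoid M] (ψ : AddChar A M)
    (t : Finset κ) (f : κ → A) : ψ (∑ i ∈ t, f i) = ∏ i ∈ t, ψ (f i) := by
  classical
  induction t using Finset.induction_on with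
  | empty => simp
  | insert a t ha ih => rw [Finset.sum_insert ha, Finset.prod_insert ha, AddChar.map_add_eq_mul, ih]

section SquareModulus

variable {p q : ℕ} {ι : Type*} [Fintype ι]

theorem natCast_mul_self_eq_zero_of_sq (hq : q = p ^ 2) : (p : ZMod q) * p = 0 := by
  rw [← Nat.cast_mul, ← sq, ← hq, ZMod.natCast_self]

/-- A character modulo `p ^ 2` restricts to an additive character on residues `1 + p t`. -/
noncomputable def principalAddChar (hq : q = p ^ 2) (χ : DirichletCharacter ℂ q) : AddChar (ZMod q) ℂ where
  toFun t := χ (1 + p * t)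
  map_zero_eq_one' := by simp
  map_add_eq_mul' s t := by
    rw [← map_mul]
    congr 1
    linear_combination (-s * t) * natCast_mul_self_eq_zero_of_sq hq

theorem principalAddChar_apply (hq : q = p ^ 2) (χ : DirichletCharacter ℂ q) (t : ZMod q) :
    principalAddChar hq χ t = χ (1 + p * t) := rfl

variable [Fact p.Prime]

theorem isUnit_iff_not_dvd_of_sq (hq : q = p ^ 2) {a : ZMod q} : IsUnit a ↔ ¬ (p : ZMod q) ∣ a := by
  have hp := (Fact.out : p.Prime)
  constructor
  · intro ha hd
    have h1 : IsUnit (p : ZMod q) := isUnit_of_dvd_unit hd ha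
    have h2 := natCast_mul_self_eq_zero_of_sq hq
    rw [h1.mul_right_eq_zero] at h2
    rw [h2] at h1
    have : Nontrivial (ZMod q) := ZMod.nontrivial_iff.mpr (by
      have := hp.two_le; rw [hq]; nlinarith)
    exact not_isUnit_zero h1
  · intro h
    have ha : a = ((a.val : ℕ) : ZMod q) := by
      have : NeZero q := ⟨hq ▸ pow_ne_zero _ hp.ne_zero⟩
      simp
    rw [ha, ZMod.isUnit_iff_coprime]
    suffices h' : ∀ n : ℕ, n = p ^ 2 → a.val.Coprime n from h' q hq
    rintro _ rfl
    refine Nat.Coprime.pow_right _ (Nat.Coprime.symm ((Nat.Prime.coprime_iff_not_dvd hp).mpr ?_))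
    intro hd
    apply h
    rw [ha]
    exact_mod_cast Nat.cast_dvd_cast (α := ZMod q) hd

theorem signedChar_one_add (hq : q = p ^ 2) (χ : DirichletCharacter ℂ q) (s : Bool) (t : ZMod q) :
    signedChar χ s (1 + p * t) = principalAddChar hq χ (if s then t else -t) := by
  have hp := (Fact.out : p.Prime)
  cases s
  · simp only [signedChar, Bool.false_eq_true, if_false]
    rw [← principalAddChar_apply hq]
    have : NeZero q := ⟨hq ▸ pow_ne_zero _ hp.ne_zero⟩
    rw [AddChar.map_neg_eq_conj]
  · simp [signedChar, principalAddChar_apply]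

theorem norm_completeSum_prime_sq_le (hq : q = p ^ 2) (χ : DirichletCharacter ℂ q) (hχ : LocallyPrimitive χ)
    [NeZero q]
    (s : ι → Bool) (b : ι → ℤ) {i₀ : ι} (hb : ∀ i, i ≠ i₀ → ¬ (p : ℤ) ∣ b i - b i₀) :
    ‖completeSum χ s b‖ ≤ Fintype.card ι * p := by
  classical
  have hp := (Fact.out : p.Prime)
  have hpq : p ∣ q := hq ▸ dvd_pow_self p two_ne_zero
  set θ := principalAddChar hq χ with hθ
  obtain ⟨t₀, ht₀⟩ : ∃ t, θ t ≠ 1 := by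
    obtain ⟨u, _, ⟨t, ht⟩, hu⟩ := hχ p hp hpq
    refine ⟨t, ?_⟩
    have hdiv : q / p = p := by rw [hq, sq, Nat.mul_div_cancel _ hp.pos]
    rw [hdiv, sub_eq_iff_eq_add'] at ht
    rwa [hθ, principalAddChar_apply, ← ht]
  set w : ZMod q → ZMod q := fun x =>
    ∑ i, if s i then (x + b i)⁻¹ else -(x + b i)⁻¹ with hw
  set f : ZMod q → ℂ := fun x => ∏ i, signedChar χ (s i) (x + b i) with hf
  have hunit_shift : ∀ a v : ZMod q, IsUnit (a + p * v) ↔ IsUnit a := by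
    intro a v
    rw [isUnit_iff_not_dvd_of_sq hq, isUnit_iff_not_dvd_of_sq hq,
      dvd_add_left (dvd_mul_right _ _)]
  have hshift : ∀ x v : ZMod q, (∀ i, IsUnit (x + b i)) → f (x + p * v) = f x * θ (w x * v) := by
    intro x v hx
    simp only [hf, hw]
    rw [Finset.sum_mul, addChar_map_sum, ← Finset.prod_mul_distrib]
    refine Finset.prod_congr rfl fun i _ => ?_
    have h1 : x + p * v + b i = (x + b i) * (1 + p * ((x + b i)⁻¹ * v)) := by
      have := ZMod.mul_inv_of_unit _ (hx i)
      linear_combination (- (p : ZMod q) * v) * this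
    rw [h1, signedChar_mul, signedChar_one_add hq]
    congr 2
    split_ifs <;> ring
  have hzero : ∀ x v : ZMod q, ¬(∀ i, IsUnit (x + b i)) → f (x + p * v) = 0 := by
    intro x v hx
    push Not at hx
    obtain ⟨i, hi⟩ := hx
    refine Finset.prod_eq_zero (Finset.mem_univ i) (signedChar_eq_zero χ _ ?_)
    rwa [add_right_comm, hunit_shift]
  set Bad : Finset (ZMod q) := Finset.univ.filter fun x =>
    (∀ i, IsUnit (x + b i)) ∧ ¬IsUnit (w x) with hBad
  have hinner : ∀ x, ‖∑ v, f (x + p * v)‖ ≤ if x ∈ Bad then (q : ℝ) else 0 := by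
    intro x
    have hf1 : ∀ y, ‖f y‖ ≤ 1 := fun y => by
      simp only [hf]
      rw [norm_prod]
      exact Finset.prod_le_one (fun _ _ => norm_nonneg _) fun i _ => norm_signedChar_le χ _ _
    by_cases hx : ∀ i, IsUnit (x + b i)
    · by_cases hwx : IsUnit (w x)
      · rw [if_neg (by rw [hBad, Finset.mem_filter]; tauto)]
        rw [Finset.sum_congr rfl fun v _ => hshift x v hx, ← Finset.mul_sum]
        have : ∑ v, θ (w x * v) = ∑ v, θ v :=
          Fintype.sum_bijective (fun v => w x * v) (hwx.unit.mulLeft_bijective) _ _ fun _ => rfl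
        rw [this, AddChar.sum_eq_zero_of_ne_one (by rintro h; exact ht₀ (by rw [h]; rfl))]
        simp
      · rw [if_pos (by rw [hBad, Finset.mem_filter]; exact ⟨Finset.mem_univ _, hx, hwx⟩)]
        refine (norm_sum_le _ _).trans ?_
        refine (Finset.sum_le_sum fun v _ => hf1 _).trans_eq ?_
        simp [ZMod.card]
    · rw [Finset.sum_eq_zero fun v _ => hzero x v hx, norm_zero]
      split_ifs <;> positivity
  have hcard : Bad.card ≤ Fintype.card ι * p := by
    let φ : ZMod q →+* ZMod p := ZMod.castHom hpq (ZMod p)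
    let P : (ZMod p)[X] := ∑ i, C (if s i then (1 : ZMod p) else -1) *
      ∏ j ∈ Finset.univ.erase i, (X + C (b j : ZMod p))
    have hP : P.eval (-(b i₀ : ZMod p)) ≠ 0 := by
      simp only [P]
      rw [eval_finsetSum, Finset.sum_eq_single i₀]
      · rw [eval_mul, eval_C, eval_prod]
        refine mul_ne_zero (by split_ifs <;> simp) (Finset.prod_ne_zero_iff.mpr fun j hj => ?_)
        have := hb j (Finset.ne_of_mem_erase hj)
        rw [← ZMod.intCast_zmod_eq_zero_iff_dvd] at this
        push_cast at this
        simpa [neg_add_eq_sub] using this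
      · intro i _ hi
        rw [eval_mul, eval_prod, Finset.prod_eq_zero (Finset.mem_erase.mpr ⟨hi.symm,
          Finset.mem_univ _⟩) (by simp), mul_zero]
      · simp
    have hP0 : P ≠ 0 := by rintro h; rw [h, eval_zero] at hP; exact hP rfl
    have hPdeg : P.natDegree ≤ Fintype.card ι := by
      refine natDegree_sum_le_of_forall_le _ _ fun i _ => ?_
      refine (natDegree_C_mul_le _ _).trans ?_
      rw [natDegree_prod_of_monic _ _ fun j _ => monic_X_add_C _]
      simp only [natDegree_X_add_C, Finset.sum_const, smul_eq_mul, mul_one]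
      exact Finset.card_le_univ _
    have hmaps : ∀ x ∈ Bad, φ x ∈ P.roots.toFinset := by
      intro x hx
      rw [hBad, Finset.mem_filter] at hx
      rw [Multiset.mem_toFinset, mem_roots hP0, IsRoot]
      have hwx : φ (w x) = 0 := by
        have h1 := hx.2.2
        rw [isUnit_iff_not_dvd_of_sq hq, not_not] at h1
        obtain ⟨k, hk⟩ := h1
        rw [hk, map_mul, map_natCast, ZMod.natCast_self, zero_mul]
      have hne : ∀ i, (φ x + b i) ≠ 0 := fun i => by
        have := (hx.2.1 i).map φ
        rw [map_add, map_intCast] at this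
        exact this.ne_zero
      have hinv : ∀ i, φ ((x + b i)⁻¹) = (φ x + b i)⁻¹ := fun i => by
        have h1 := congrArg φ (ZMod.mul_inv_of_unit _ (hx.2.1 i))
        rw [map_mul, map_one, map_add, map_intCast] at h1
        exact (inv_eq_of_mul_eq_one_right h1).symm
      have : P.eval (φ x) = (∏ i, (φ x + b i)) * φ (w x) := by
        simp only [P, hw]
        rw [eval_finsetSum, map_sum, Finset.mul_sum]
        refine Finset.sum_congr rfl fun i _ => ?_
        rw [← Finset.mul_prod_erase _ _ (Finset.mem_univ i), eval_mul, eval_C, eval_prod]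
        simp only [eval_add, eval_X, eval_C]
        split_ifs
        · rw [hinv]; field_simp [hne i]
        · rw [map_neg, hinv]; field_simp [hne i]
      rw [this, hwx, mul_zero]
    have hfib : ∀ u ∈ P.roots.toFinset, (Bad.filter fun x => φ x = u).card ≤ p := by
      intro u _
      have hall : (Finset.univ.filter fun x : ZMod q => φ x = u).card ≤ p := by
        have hinj := Finset.card_le_card_of_injOn (s := Finset.univ.filter fun x : ZMod q => φ x = u)
          (t := Finset.range p) (fun x => x.val / p) ?_ ?_
        · simpa using hinj
        · intro x _
          simp only [Finset.coe_range, Set.mem_Iio]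
          rw [Nat.div_lt_iff_lt_mul hp.pos, ← sq, ← hq]
          exact ZMod.val_lt x
        · intro x hx y hy hxy
          simp only [Finset.coe_filter, Finset.mem_univ, true_and, Set.mem_ofPred_eq] at hx hy
          have h1 : ((x.val : ℕ) : ZMod p) = ((y.val : ℕ) : ZMod p) := by
            rw [ZMod.natCast_val, ZMod.natCast_val]; exact hx.trans hy.symm
          rw [ZMod.natCast_eq_natCast_iff'] at h1
          apply ZMod.val_injective
          rw [← Nat.div_add_mod x.val p, ← Nat.div_add_mod y.val p, h1]
          simp only at hxy
          rw [hxy]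
      exact (Finset.card_le_card (Finset.filter_subset_filter _ (Finset.subset_univ _))).trans hall
    refine (Finset.card_le_mul_card_image_of_maps_to hmaps p hfib).trans ?_
    rw [mul_comm]
    refine Nat.mul_le_mul_right _ ?_
    exact (Multiset.toFinset_card_le _).trans ((P.card_roots').trans hPdeg)
  have hsum : (q : ℂ) * completeSum χ s b = ∑ x, ∑ v, f (x + p * v) := by
    rw [Finset.sum_comm]
    have : ∀ v : ZMod q, ∑ x, f (x + p * v) = completeSum χ s b := fun v =>
      Equiv.sum_comp (Equiv.addRight ((p : ZMod q) * v)) f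
    rw [Finset.sum_congr rfl fun v _ => this v]
    simp [ZMod.card]
  have hppos : (0 : ℝ) < (q : ℝ) := by rw [hq]; exact_mod_cast pow_pos hp.pos 2
  have hnorm : (q : ℝ) * ‖completeSum χ s b‖ ≤ (q : ℝ) * Bad.card := by
    have h1 : (q : ℝ) * ‖completeSum χ s b‖ = ‖(q : ℂ) * completeSum χ s b‖ := by
      rw [norm_mul, Complex.norm_natCast]
    rw [h1, hsum]
    refine (norm_sum_le _ _).trans ((Finset.sum_le_sum fun x _ => hinner x).trans_eq ?_)
    rw [← Finset.sum_filter, Finset.sum_const, nsmul_eq_mul, mul_comm]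
    congr 2
    simp
  refine (le_of_mul_le_mul_left hnorm hppos).trans ?_
  exact_mod_cast hcard

end SquareModulus

section CoprimeFactorization

variable {m n : ℕ}

/-- The first component of a character modulo a product of coprime integers. -/
noncomputable def leftComponent (h : m.Coprime n) (χ : DirichletCharacter ℂ (m * n)) :
    DirichletCharacter ℂ m where
  toFun a := χ ((ZMod.chineseRemainder h).symm (a, 1))
  map_one' := by
    rw [show ((1 : ZMod m), (1 : ZMod n)) = 1 from rfl, map_one, map_one]
  map_mul' a b := by
    rw [← map_mul, ← map_mul, Prod.mk_mul_mk, mul_one]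
  map_nonunit' a ha := by
    refine χ.map_nonunit fun hu => ha ?_
    have := (hu.map (ZMod.chineseRemainder h))
    rw [RingEquiv.apply_symm_apply] at this
    exact (Prod.isUnit_iff.mp this).1

/-- The second component of a character modulo a product of coprime integers. -/
noncomputable def rightComponent (h : m.Coprime n) (χ : DirichletCharacter ℂ (m * n)) :
    DirichletCharacter ℂ n where
  toFun a := χ ((ZMod.chineseRemainder h).symm (1, a))
  map_one' := by
    rw [show ((1 : ZMod m), (1 : ZMod n)) = 1 from rfl, map_one, map_one]
  map_mul' a b := by
    rw [← map_mul, ← map_mul, Prod.mk_mul_mk, mul_one]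
  map_nonunit' a ha := by
    refine χ.map_nonunit fun hu => ha ?_
    have := (hu.map (ZMod.chineseRemainder h))
    rw [RingEquiv.apply_symm_apply] at this
    exact (Prod.isUnit_iff.mp this).2

theorem leftComponent_apply (h : m.Coprime n) (χ : DirichletCharacter ℂ (m * n)) (a : ZMod m) :
    leftComponent h χ a = χ ((ZMod.chineseRemainder h).symm (a, 1)) := rfl

theorem rightComponent_apply (h : m.Coprime n) (χ : DirichletCharacter ℂ (m * n)) (a : ZMod n) :
    rightComponent h χ a = χ ((ZMod.chineseRemainder h).symm (1, a)) := rfl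

theorem chineseRemainder_symm_apply_eq_mul (h : m.Coprime n) (χ : DirichletCharacter ℂ (m * n))
    (a : ZMod m) (b : ZMod n) : χ ((ZMod.chineseRemainder h).symm (a, b)) =
      leftComponent h χ a * rightComponent h χ b := by
  rw [leftComponent_apply, rightComponent_apply, ← map_mul, ← map_mul, Prod.mk_mul_mk, mul_one,
    one_mul]

theorem signedChar_chineseRemainder_symm (h : m.Coprime n) (χ : DirichletCharacter ℂ (m * n))
    (s : Bool) (a : ZMod m) (b : ZMod n) :
    signedChar χ s ((ZMod.chineseRemainder h).symm (a, b)) =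
      signedChar (leftComponent h χ) s a * signedChar (rightComponent h χ) s b := by
  unfold signedChar
  rw [chineseRemainder_symm_apply_eq_mul]
  split_ifs <;> simp

theorem completeSum_mul {ι : Type*} [Fintype ι] [NeZero m] [NeZero n] [NeZero (m * n)]
    (h : m.Coprime n)
    (χ : DirichletCharacter ℂ (m * n)) (s : ι → Bool) (b : ι → ℤ) :
    completeSum χ s b =
      completeSum (leftComponent h χ) s b * completeSum (rightComponent h χ) s b := by
  rw [completeSum, completeSum, completeSum, Finset.sum_mul_sum,
    ← Equiv.sum_comp (ZMod.chineseRemainder h).symm.toEquiv, Fintype.sum_prod_type]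
  refine Finset.sum_congr rfl fun x _ => Finset.sum_congr rfl fun y _ => ?_
  rw [← Finset.prod_mul_distrib]
  refine Finset.prod_congr rfl fun i _ => ?_
  rw [← signedChar_chineseRemainder_symm]
  congr 1
  have : ((x + (b i : ZMod m), y + (b i : ZMod n)) : ZMod m × ZMod n) = (x, y) + (b i : ZMod m × ZMod n) := by
    ext <;> simp
  rw [this, map_add, map_intCast]
  rfl

theorem LocallyPrimitive.left (h : m.Coprime n) {χ : DirichletCharacter ℂ (m * n)}
    (hχ : LocallyPrimitive χ) : LocallyPrimitive (leftComponent h χ) := by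
  intro p hp hpm
  obtain ⟨u, hu, hd, hu1⟩ := hχ p hp (hpm.mul_right n)
  set e := ZMod.chineseRemainder h with he
  have hde : ((m * n / p : ℕ) : ZMod m × ZMod n) ∣ e u - 1 := by
    simpa using map_dvd e hd
  obtain ⟨k, hk⟩ := hde
  have hmn : m * n / p = m / p * n := by
    rw [mul_comm, Nat.mul_div_assoc _ hpm, mul_comm]
  rw [hmn] at hk
  have h2 : (e u).2 = 1 := by
    have := congrArg Prod.snd hk
    simp only [Prod.snd_sub, Prod.snd_one, Prod.snd_mul, Prod.snd_natCast] at this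
    push_cast at this
    rw [ZMod.natCast_self, mul_zero, zero_mul, sub_eq_zero] at this
    exact this
  refine ⟨(e u).1, (Prod.isUnit_iff.mp (hu.map e)).1, ?_, ?_⟩
  · have := congrArg Prod.fst hk
    simp only [Prod.fst_sub, Prod.fst_one, Prod.fst_mul, Prod.fst_natCast] at this
    rw [this]
    push_cast
    rw [mul_assoc]
    exact dvd_mul_right _ _
  · rw [leftComponent_apply, ← h2]
    simpa [he] using hu1

theorem LocallyPrimitive.right (h : m.Coprime n) {χ : DirichletCharacter ℂ (m * n)}
    (hχ : LocallyPrimitive χ) : LocallyPrimitive (rightComponent h χ) := by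
  intro p hp hpn
  obtain ⟨u, hu, hd, hu1⟩ := hχ p hp (hpn.mul_left m)
  set e := ZMod.chineseRemainder h with he
  have hde : ((m * n / p : ℕ) : ZMod m × ZMod n) ∣ e u - 1 := by
    simpa using map_dvd e hd
  obtain ⟨k, hk⟩ := hde
  have hmn : m * n / p = m * (n / p) := Nat.mul_div_assoc _ hpn
  rw [hmn] at hk
  have h2 : (e u).1 = 1 := by
    have := congrArg Prod.fst hk
    simp only [Prod.fst_sub, Prod.fst_one, Prod.fst_mul, Prod.fst_natCast] at this
    push_cast at this
    rw [ZMod.natCast_self, zero_mul, zero_mul, sub_eq_zero] at this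
    exact this
  refine ⟨(e u).2, (Prod.isUnit_iff.mp (hu.map e)).2, ?_, ?_⟩
  · have := congrArg Prod.snd hk
    simp only [Prod.snd_sub, Prod.snd_one, Prod.snd_mul, Prod.snd_natCast] at this
    rw [this]
    push_cast
    rw [mul_comm (m : ZMod n), mul_assoc]
    exact dvd_mul_right _ _
  · rw [rightComponent_apply, ← h2]
    simpa [he] using hu1

end CoprimeFactorization

theorem LocallyPrimitive.of_isPrimitive {q : ℕ} [NeZero q] {χ : DirichletCharacter ℂ q}
    (hχ : χ.IsPrimitive) : LocallyPrimitive χ := by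
  intro p hp hpq
  by_contra! hcon
  have hd : q / p ∣ q := Nat.div_dvd_of_dvd hpq
  have hft : χ.FactorsThrough (q / p) := by
    rw [DirichletCharacter.factorsThrough_iff_ker_unitsMap hd]
    intro u hu
    rw [MonoidHom.mem_ker] at hu ⊢
    have h1 : ZMod.castHom hd (ZMod (q / p)) ((u : ZMod q) - 1) = 0 := by
      have := congrArg Units.val hu
      rw [ZMod.unitsMap_val] at this
      rw [map_sub, map_one, sub_eq_zero]
      simpa using this
    have h2 : ((q / p : ℕ) : ZMod q) ∣ (u : ZMod q) - 1 := by
      set a := (u : ZMod q) - 1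
      have ha : a = ((a.val : ℕ) : ZMod q) := by simp
      rw [ha, map_natCast, ZMod.natCast_eq_zero_iff] at h1
      rw [ha]
      exact_mod_cast Nat.cast_dvd_cast (α := ZMod q) h1
    ext
    rw [MulChar.coe_toUnitHom]
    exact hcon u u.isUnit h2
  have h3 : χ.conductor ∣ q / p := χ.conductor_dvd_of_mem_conductorSet hft
  rw [DirichletCharacter.isPrimitive_def] at hχ
  rw [hχ] at h3
  have hq := NeZero.pos q
  have h4 := Nat.le_of_dvd (Nat.div_pos (Nat.le_of_dvd hq hpq) hp.pos) h3
  have h5 := Nat.div_lt_self hq hp.one_lt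
  omega

section CubeFree

variable {ι : Type*} [Fintype ι]

theorem norm_completeSum_le_of_eq_prime {p q : ℕ} [Fact p.Prime] (h : q = p) [NeZero q]
    {χ : DirichletCharacter ℂ q} (hχ : χ ≠ 1) (s : ι → Bool) (b : ι → ℤ) {i₀ : ι}
    (hb : ∀ i, i ≠ i₀ → ¬ (p : ℤ) ∣ b i - b i₀) :
    ‖completeSum χ s b‖ ≤ Fintype.card ι * √q := by
  subst h
  exact norm_completeSum_prime_le χ hχ s b hb

theorem norm_completeSum_le_of_cubefree [DecidableEq ι] {q : ℕ} [inst : NeZero q]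
    (hq : ∀ p : ℕ, p.Prime → ¬ p ^ 3 ∣ q) {χ : DirichletCharacter ℂ q} (hχ : LocallyPrimitive χ)
    (s : ι → Bool) (b : ι → ℤ) (i₀ : ι) :
    ‖completeSum χ s b‖ ≤ (Fintype.card ι : ℝ) ^ q.primeFactors.card * √q *
      (q.gcd (∏ i ∈ Finset.univ.erase i₀, (b i - b i₀)).natAbs : ℝ) := by
  set Δ := (∏ i ∈ Finset.univ.erase i₀, (b i - b i₀)).natAbs with hΔ
  have hι : (1 : ℝ) ≤ Fintype.card ι := by
    exact_mod_cast Fintype.card_pos_iff.mpr ⟨i₀⟩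
  revert χ inst
  induction q using Nat.recOnPosPrimePosCoprime with
  | prime_pow p k hp hk =>
    intro _ χ hχ
    have := Fact.mk hp
    have hk2 : k ≤ 2 := by
      by_contra! h
      exact hq p hp (pow_dvd_pow p h)
    rw [Nat.primeFactors_prime_pow hk.ne' hp, Finset.card_singleton, pow_one]
    have hg1 : (1 : ℝ) ≤ ((p ^ k).gcd Δ : ℕ) := by
      exact_mod_cast Nat.gcd_pos_of_pos_left _ (NeZero.pos (p ^ k))
    by_cases hgood : ∀ i, i ≠ i₀ → ¬ (p : ℤ) ∣ b i - b i₀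
    · refine le_trans ?_ (le_mul_of_one_le_right (by positivity) hg1)
      obtain rfl | rfl : k = 1 ∨ k = 2 := by omega
      · have hχ1 : χ ≠ 1 := by
          rintro rfl
          obtain ⟨u, hu, -, h1⟩ := hχ p hp (dvd_pow_self p one_ne_zero)
          exact h1 (MulChar.one_apply hu)
        exact norm_completeSum_le_of_eq_prime (pow_one p) hχ1 s b hgood
      · have := norm_completeSum_prime_sq_le rfl χ hχ s b hgood
        rwa [Nat.cast_pow, Real.sqrt_sq (by positivity)]
    · push Not at hgood
      obtain ⟨i, hi, hpi⟩ := hgood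
      have hpg : p ∣ (p ^ k).gcd Δ := by
        refine Nat.dvd_gcd (dvd_pow_self p hk.ne') ?_
        rw [hΔ, ← Int.natCast_dvd]
        exact hpi.trans (Finset.dvd_prod_of_mem _ (Finset.mem_erase.mpr ⟨hi, Finset.mem_univ _⟩))
      have hpg' : (p : ℝ) ≤ ((p ^ k).gcd Δ : ℕ) := by
        exact_mod_cast Nat.le_of_dvd (Nat.gcd_pos_of_pos_left _ (NeZero.pos (p ^ k))) hpg
      refine (norm_completeSum_le χ s b).trans ?_
      have h1 : √((p ^ k : ℕ) : ℝ) ≤ p := by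
        rw [Real.sqrt_le_left (by positivity)]
        exact_mod_cast Nat.pow_le_pow_right hp.pos hk2
      calc ((p ^ k : ℕ) : ℝ) = √((p ^ k : ℕ) : ℝ) * √((p ^ k : ℕ) : ℝ) :=
            (Real.mul_self_sqrt (by positivity)).symm
        _ ≤ √((p ^ k : ℕ) : ℝ) * ((p ^ k).gcd Δ : ℕ) := by gcongr; exact h1.trans hpg'
        _ = 1 * √((p ^ k : ℕ) : ℝ) * ((p ^ k).gcd Δ : ℕ) := by ring
        _ ≤ _ := by gcongr
  | zero => exact absurd rfl (NeZero.ne (0 : ℕ))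
  | one =>
    intro _ χ _
    refine (norm_completeSum_le χ s b).trans ?_
    simp
  | coprime m n hm hn hmn ihm ihn =>
    intro _ χ hχ
    have hm0 : m ≠ 0 := by omega
    have hn0 : n ≠ 0 := by omega
    have := NeZero.mk hm0
    have := NeZero.mk hn0
    have h1 := ihm (fun p hp h => hq p hp (h.mul_right n)) (hχ.left hmn)
    have h2 := ihn (fun p hp h => hq p hp (h.mul_left m)) (hχ.right hmn)
    rw [completeSum_mul hmn, norm_mul]
    refine (mul_le_mul h1 h2 (norm_nonneg _) (by positivity)).trans_eq ?_
    rw [hmn.primeFactors_mul, Finset.card_union_of_disjoint hmn.disjoint_primeFactors, pow_add,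
      Nat.gcd_comm (m * n), hmn.gcd_mul, Nat.gcd_comm m, Nat.gcd_comm n, Nat.cast_mul m n, Real.sqrt_mul (by positivity)]
    push_cast
    ring

end CubeFree

/-- `K ^ ω(q) ≪ q ^ ε`. -/
theorem exists_pow_card_primeFactors_le {K ε : ℝ} (hK : 1 ≤ K) (hε : 0 < ε) :
    ∃ C : ℝ, 0 < C ∧ ∀ q : ℕ, 0 < q → K ^ q.primeFactors.card ≤ C * (q : ℝ) ^ ε := by
  set M := ⌈K ^ (1 / ε)⌉₊ with hM
  refine ⟨K ^ M, by positivity, fun q hq => ?_⟩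
  have h1 : ∀ p ∈ q.primeFactors, K ≤ (if p < M then K else 1) * (p : ℝ) ^ ε := by
    intro p hp
    have hp1 : (1 : ℝ) ≤ p := by exact_mod_cast (Nat.prime_of_mem_primeFactors hp).one_le
    split_ifs with h
    · exact le_mul_of_one_le_right (by positivity) (Real.one_le_rpow hp1 hε.le)
    · rw [one_mul]
      have h2 : K ^ (1 / ε) ≤ p := (Nat.le_ceil _).trans (by exact_mod_cast not_lt.mp h)
      calc K = (K ^ (1 / ε)) ^ ε := by
            rw [← Real.rpow_mul (by positivity), one_div_mul_cancel hε.ne', Real.rpow_one]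
        _ ≤ _ := by gcongr
  calc K ^ q.primeFactors.card = ∏ p ∈ q.primeFactors, K := by rw [Finset.prod_const]
    _ ≤ ∏ p ∈ q.primeFactors, (if p < M then K else 1) * (p : ℝ) ^ ε :=
        Finset.prod_le_prod (fun _ _ => by positivity) h1
    _ = K ^ (q.primeFactors.filter (· < M)).card * ((∏ p ∈ q.primeFactors, p : ℕ) : ℝ) ^ ε := by
        rw [Finset.prod_mul_distrib, Nat.cast_prod, Real.finsetProd_rpow _ _ (by simp),
          Finset.prod_ite, Finset.prod_const, Finset.prod_const_one, mul_one]
    _ ≤ _ := by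
        gcongr
        · calc _ ≤ (Finset.range M).card := Finset.card_le_card fun p hp => by
                simpa using (Finset.mem_filter.mp hp).2
            _ = M := Finset.card_range M
        · exact Nat.le_of_dvd hq (Nat.prod_primeFactors_dvd q)

theorem card_divisors_le_of_cubefree {q : ℕ} (hq0 : q ≠ 0)
    (hq : ∀ p : ℕ, p.Prime → ¬ p ^ 3 ∣ q) : q.divisors.card ≤ 3 ^ q.primeFactors.card := by
  rw [Nat.card_divisors hq0, ← Finset.prod_const]
  refine Finset.prod_le_prod (fun _ _ => by positivity) fun p hp => ?_
  by_contra! h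
  exact hq p (Nat.prime_of_mem_primeFactors hp)
    (((Nat.prime_of_mem_primeFactors hp).pow_dvd_iff_le_factorization hq0).mpr (by omega))

theorem sum_gcd_le {q : ℕ} (hq : q ≠ 0) (B : ℕ) :
    ∑ t ∈ Finset.Icc 1 B, q.gcd t ≤ B * q.divisors.card := by
  calc ∑ t ∈ Finset.Icc 1 B, q.gcd t
      ≤ ∑ t ∈ Finset.Icc 1 B, ∑ d ∈ q.divisors, if d ∣ t then d else 0 := by
        refine Finset.sum_le_sum fun t _ => ?_
        have := Finset.single_le_sum (f := fun d => if d ∣ t then d else 0)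
          (fun _ _ => Nat.zero_le _) (Nat.mem_divisors.mpr ⟨Nat.gcd_dvd_left q t, hq⟩)
        simpa [Nat.gcd_dvd_right] using this
    _ = ∑ d ∈ q.divisors, B / d * d := by
        rw [Finset.sum_comm]
        refine Finset.sum_congr rfl fun d _ => ?_
        rw [← Finset.sum_filter, Finset.sum_const, smul_eq_mul]
        congr 1
        exact Nat.Ioc_filter_dvd_card_eq_div B d
    _ ≤ ∑ d ∈ q.divisors, B := Finset.sum_le_sum fun d _ => Nat.div_mul_le_self B d
    _ = _ := by rw [Finset.sum_const, smul_eq_mul, mul_comm]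

theorem sum_gcd_sub_le {q : ℕ} (hq : q ≠ 0) (B : ℕ) {c : ℤ} (hc : c ∈ Finset.Icc (1 : ℤ) B) :
    ∑ x ∈ Finset.Icc (1 : ℤ) B, (if x = c then 0 else q.gcd (x - c).natAbs) ≤
      2 * (B * q.divisors.card) := by
  rw [Finset.mem_Icc] at hc
  have h1 := sum_gcd_le hq B
  have h2 : ∑ x ∈ Finset.Icc (1 : ℤ) B, (if x = c then 0 else q.gcd (x - c).natAbs) ≤
      ∑ x ∈ (Finset.Icc (1 : ℤ) B).filter (· < c), q.gcd (x - c).natAbs +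
      ∑ x ∈ (Finset.Icc (1 : ℤ) B).filter (c < ·), q.gcd (x - c).natAbs := by
    rw [Finset.sum_filter, Finset.sum_filter, ← Finset.sum_add_distrib]
    refine Finset.sum_le_sum fun x _ => ?_
    split_ifs <;> omega
  have h3 : ∀ s : Finset ℤ, Set.InjOn (fun x : ℤ => (x - c).natAbs) s →
      (∀ x ∈ s, (x - c).natAbs ∈ Finset.Icc 1 B) →
      ∑ x ∈ s, q.gcd (x - c).natAbs ≤ B * q.divisors.card := by
    intro s hs hm
    rw [← Finset.sum_image (f := fun t => q.gcd t) hs]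
    exact (Finset.sum_le_sum_of_subset (Finset.image_subset_iff.mpr hm)).trans h1
  refine h2.trans ?_
  rw [two_mul]
  refine add_le_add (h3 _ ?_ ?_) (h3 _ ?_ ?_)
  · intro x hx y hy hxy
    simp at hx hy hxy
    omega
  · intro x hx
    simp at hx ⊢
    omega
  · intro x hx y hy hxy
    simp at hx hy hxy
    omega
  · intro x hx
    simp at hx ⊢
    omega

theorem gcd_prod_natAbs_le {ι : Type*} {q : ℕ} (hq : q ≠ 0) (s : Finset ι) (f : ι → ℤ) :
    q.gcd (∏ i ∈ s, f i).natAbs ≤ ∏ i ∈ s, q.gcd (f i).natAbs := by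
  classical
  induction s using Finset.induction_on with
  | empty => simp
  | insert a s ha ih =>
    rw [Finset.prod_insert ha, Finset.prod_insert ha, Int.natAbs_mul]
    have h1 := Nat.gcd_mul_right_dvd_mul_gcd q (f a).natAbs (∏ i ∈ s, f i).natAbs
    refine (Nat.le_of_dvd ?_ h1).trans (Nat.mul_le_mul_left _ ih)
    exact Nat.mul_pos (Nat.gcd_pos_of_pos_left _ (Nat.pos_of_ne_zero hq))
      (Nat.gcd_pos_of_pos_left _ (Nat.pos_of_ne_zero hq))

section Tuples

variable {ι : Type*} [Fintype ι] [DecidableEq ι]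

theorem sum_tuples_gcd_le {q : ℕ} (hq : q ≠ 0) (B : ℕ) (i₀ : ι) :
    ∑ b ∈ Fintype.piFinset fun _ : ι => Finset.Icc (1 : ℤ) B,
      (if ∀ i, i ≠ i₀ → b i ≠ b i₀ then
        q.gcd (∏ i ∈ Finset.univ.erase i₀, (b i - b i₀)).natAbs else 0) ≤
      B * (2 * (B * q.divisors.card)) ^ (Fintype.card ι - 1) := by
  set g : ℤ → ι → ℤ → ℕ := fun c i x =>
    if i = i₀ then (if x = c then 1 else 0) else (if x = c then 0 else q.gcd (x - c).natAbs) with hg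
  calc _ ≤ ∑ b ∈ Fintype.piFinset fun _ : ι => Finset.Icc (1 : ℤ) B,
        ∑ c ∈ Finset.Icc (1 : ℤ) B, ∏ i, g c i (b i) := by
        refine Finset.sum_le_sum fun b hb => ?_
        split_ifs with h
        · refine le_trans ?_ (Finset.single_le_sum (f := fun c => ∏ i, g c i (b i))
            (fun _ _ => Nat.zero_le _) (Fintype.mem_piFinset.mp hb i₀))
          refine (gcd_prod_natAbs_le hq _ _).trans ?_
          rw [← Finset.mul_prod_erase _ _ (Finset.mem_univ i₀)]
          simp only [hg, if_true, one_mul]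
          refine Finset.prod_le_prod (fun _ _ => Nat.zero_le _) fun i hi => ?_
          rw [if_neg (Finset.ne_of_mem_erase hi), if_neg (h i (Finset.ne_of_mem_erase hi))]
        · exact Nat.zero_le _
    _ = ∑ c ∈ Finset.Icc (1 : ℤ) B, ∏ i, ∑ x ∈ Finset.Icc (1 : ℤ) B, g c i x := by
        rw [Finset.sum_comm]
        refine Finset.sum_congr rfl fun c _ => ?_
        rw [Finset.prod_univ_sum]
    _ ≤ ∑ c ∈ Finset.Icc (1 : ℤ) B, (2 * (B * q.divisors.card)) ^ (Fintype.card ι - 1) := by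
        refine Finset.sum_le_sum fun c hc => ?_
        rw [← Finset.mul_prod_erase _ _ (Finset.mem_univ i₀)]
        have h1 : ∑ x ∈ Finset.Icc (1 : ℤ) B, g c i₀ x = 1 := by
          simp only [hg, if_true]
          rw [Finset.sum_ite_eq', if_pos hc]
        rw [h1, one_mul, ← Finset.card_univ, ← Finset.card_erase_of_mem (Finset.mem_univ i₀)]
        refine Finset.prod_le_pow_card _ _ _ fun i hi => ?_
        simp only [hg, if_neg (Finset.ne_of_mem_erase hi)]
        exact sum_gcd_sub_le hq B hc
    _ = _ := by simp

theorem card_bad_tuples_le {r : ℕ} (hr : 0 < r) (hι : Fintype.card ι = 2 * r) {α : Type*}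
    [DecidableEq α] (S : Finset α) :
    ((Fintype.piFinset fun _ : ι => S).filter
      fun b => ∀ i₀, ∃ i, i ≠ i₀ ∧ b i = b i₀).card ≤ r ^ (2 * r) * S.card ^ r := by
  have key : (Fintype.piFinset fun _ : ι => S).filter
      (fun b => ∀ i₀, ∃ i, i ≠ i₀ ∧ b i = b i₀) ⊆
      ((Finset.univ : Finset (ι → Fin r)) ×ˢ (Fintype.piFinset fun _ : Fin r => S)).image
        fun p => p.2 ∘ p.1 := by
    intro b hb
    rw [Finset.mem_filter, Fintype.mem_piFinset] at hb
    obtain ⟨hbS, hb⟩ := hb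
    set T := Finset.univ.image b with hT
    have hTcard : T.card ≤ r := by
      have h1 : T.card * 2 ≤ (Finset.univ : Finset ι).card := by
        rw [Finset.card_eq_sum_card_image b, ← hT, ← smul_eq_mul, ← Finset.sum_const]
        refine Finset.sum_le_sum fun v hv => ?_
        obtain ⟨i₀, -, rfl⟩ := Finset.mem_image.mp hv
        obtain ⟨i, hi, hbi⟩ := hb i₀
        refine Finset.one_lt_card.mpr ⟨i, by simp [hbi], i₀, by simp, hi⟩
      rw [Finset.card_univ, hι] at h1
      omega
    have hne : Nonempty ι := Fintype.card_pos_iff.mp (by omega)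
    have i₁ : ι := Classical.choice hne
    have hemb : Nonempty (T ↪ Fin r) := by
      refine Function.Embedding.nonempty_of_card_le ?_
      simpa using hTcard
    obtain ⟨e⟩ := hemb
    rw [Finset.mem_image]
    refine ⟨(fun i => e ⟨b i, Finset.mem_image_of_mem b (Finset.mem_univ i)⟩,
      fun k => if h : ∃ t, e t = k then (h.choose : α) else b i₁), ?_, ?_⟩
    · rw [Finset.mem_product]
      refine ⟨Finset.mem_univ _, Fintype.mem_piFinset.mpr fun k => ?_⟩
      dsimp only
      split_ifs with h
      · obtain ⟨i, -, hi⟩ := Finset.mem_image.mp h.choose.2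
        rw [← hi]
        exact hbS i
      · exact hbS i₁
    · ext i
      have h : ∃ t, e t = e ⟨b i, Finset.mem_image_of_mem b (Finset.mem_univ i)⟩ := ⟨_, rfl⟩
      simp only [Function.comp_apply, dif_pos h]
      rw [e.injective h.choose_spec]
  refine (Finset.card_le_card key).trans (Finset.card_image_le.trans ?_)
  simp [hι]

end Tuples

/-- The `2r`-th moment of short character sums. -/
theorem exists_moment_le {r : ℕ} (hr : 0 < r) {ε : ℝ} (hε : 0 < ε) :
    ∃ C : ℝ, 0 < C ∧ ∀ (q : ℕ) [NeZero q], (∀ p : ℕ, p.Prime → ¬ p ^ 3 ∣ q) →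
      ∀ χ : DirichletCharacter ℂ q, LocallyPrimitive χ → ∀ B : ℕ,
        ∑ x : ZMod q, ‖∑ b ∈ Finset.Icc (1 : ℤ) B, χ (x + b)‖ ^ (2 * r) ≤
          C * (q : ℝ) ^ ε * (q * (B : ℝ) ^ r + √q * (B : ℝ) ^ (2 * r)) := by
  set K : ℝ := (2 * r) * 3 ^ (2 * r - 1) with hK
  have hr1 : (1 : ℝ) ≤ r := by exact_mod_cast hr
  have hK1 : 1 ≤ K := by
    rw [hK]
    have : (1 : ℝ) ≤ 3 ^ (2 * r - 1) := one_le_pow₀ (by norm_num)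
    nlinarith
  obtain ⟨C₀, hC₀, hC⟩ := exists_pow_card_primeFactors_le hK1 hε
  refine ⟨(r : ℝ) ^ (2 * r) + (2 * r) * 2 ^ (2 * r - 1) * C₀, by positivity, ?_⟩
  intro q _ hq χ hχ B
  have hq0 := NeZero.ne q
  have hq1 : (1 : ℝ) ≤ (q : ℝ) ^ ε :=
    Real.one_le_rpow (by exact_mod_cast NeZero.pos q) hε.le
  set ι := Fin r × Bool with hι
  have hcard : Fintype.card ι = 2 * r := by simp [hι, mul_comm]
  set S := Finset.Icc (1 : ℤ) B with hS
  have hScard : S.card = B := by simp [hS]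
  set s : ι → Bool := fun i => i.2 with hs
  set P := Fintype.piFinset fun _ : ι => S with hP
  have hexpand : ∀ x : ZMod q, ((‖∑ b ∈ S, χ (x + b)‖ ^ (2 * r) : ℝ) : ℂ) =
      ∑ b ∈ P, ∏ i, signedChar χ (s i) (x + b i) := by
    intro x
    rw [hP, ← Finset.prod_univ_sum (fun _ => S) (fun i (c : ℤ) => signedChar χ (s i) (x + c))]
    change _ = ∏ i : Fin r × Bool, _
    rw [Fintype.prod_prod_type]
    simp only [Fintype.prod_bool, hs, signedChar, if_true, Bool.false_eq_true, if_false,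
      Finset.prod_const, Finset.card_univ, Fintype.card_fin]
    rw [← map_sum (starRingEnd ℂ), Complex.mul_conj, Complex.normSq_eq_norm_sq, pow_mul]
    push_cast
    rfl
  have hmain : ∑ x : ZMod q, ‖∑ b ∈ S, χ (x + b)‖ ^ (2 * r) ≤ ∑ b ∈ P, ‖completeSum χ s b‖ := by
    have h1 : ((∑ x : ZMod q, ‖∑ b ∈ S, χ (x + b)‖ ^ (2 * r) : ℝ) : ℂ) =
        ∑ b ∈ P, completeSum χ s b := by
      rw [Complex.ofReal_sum, Finset.sum_congr rfl fun x _ => hexpand x, Finset.sum_comm]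
      rfl
    calc _ = ‖((∑ x : ZMod q, ‖∑ b ∈ S, χ (x + b)‖ ^ (2 * r) : ℝ) : ℂ)‖ := by
          rw [Complex.norm_real, Real.norm_of_nonneg (by positivity)]
      _ ≤ _ := by rw [h1]; exact norm_sum_le _ _
  set ω := q.primeFactors.card with hω
  have hterm : ∀ b ∈ P, ‖completeSum χ s b‖ ≤
      (if ∀ i₀, ∃ i, i ≠ i₀ ∧ b i = b i₀ then (q : ℝ) else 0) +
      ∑ i₀, (2 * r : ℝ) ^ ω * √q * ((if ∀ i, i ≠ i₀ → b i ≠ b i₀ then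
        q.gcd (∏ i ∈ Finset.univ.erase i₀, (b i - b i₀)).natAbs else 0 : ℕ) : ℝ) := by
    intro b _
    by_cases h : ∀ i₀, ∃ i, i ≠ i₀ ∧ b i = b i₀
    · rw [if_pos h]
      exact (norm_completeSum_le χ s b).trans (le_add_of_nonneg_right (by positivity))
    · rw [if_neg h, zero_add]
      push Not at h
      obtain ⟨i₀, hi₀⟩ := h
      refine (norm_completeSum_le_of_cubefree hq hχ s b i₀).trans ?_
      refine le_trans ?_ (Finset.single_le_sum (fun _ _ => by positivity) (Finset.mem_univ i₀))
      rw [if_pos hi₀, hcard]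
      push_cast
      rfl
  refine hmain.trans ((Finset.sum_le_sum hterm).trans ?_)
  rw [Finset.sum_add_distrib, ← Finset.sum_filter, Finset.sum_const, nsmul_eq_mul,
    Finset.sum_comm]
  have hbad : (((P.filter fun b => ∀ i₀, ∃ i, i ≠ i₀ ∧ b i = b i₀).card : ℕ) : ℝ) ≤
      r ^ (2 * r) * B ^ r := by
    have := card_bad_tuples_le hr hcard S
    rw [hScard] at this
    exact_mod_cast this
  have hgood : ∀ i₀, ∑ b ∈ P, (2 * r : ℝ) ^ ω * √q * ((if ∀ i, i ≠ i₀ → b i ≠ b i₀ then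
        q.gcd (∏ i ∈ Finset.univ.erase i₀, (b i - b i₀)).natAbs else 0 : ℕ) : ℝ) ≤
      2 ^ (2 * r - 1) * C₀ * (q : ℝ) ^ ε * (√q * (B : ℝ) ^ (2 * r)) := by
    intro i₀
    rw [← Finset.mul_sum, ← Nat.cast_sum]
    have h1 := sum_tuples_gcd_le hq0 B i₀
    have h2 := card_divisors_le_of_cubefree hq0 hq
    have h3 : ((∑ b ∈ P, (if ∀ i, i ≠ i₀ → b i ≠ b i₀ then
        q.gcd (∏ i ∈ Finset.univ.erase i₀, (b i - b i₀)).natAbs else 0) : ℕ) : ℝ) ≤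
        B * (2 * (B * 3 ^ ω)) ^ (2 * r - 1) := by
      rw [hcard] at h1
      exact_mod_cast h1.trans (by gcongr)
    calc _ ≤ (2 * r : ℝ) ^ ω * √q * (B * (2 * (B * 3 ^ ω)) ^ (2 * r - 1)) := by gcongr
      _ = 2 ^ (2 * r - 1) * √q * B ^ (2 * r - 1 + 1) * K ^ ω := by
          have h4 : ((3 : ℝ) ^ ω) ^ (2 * r - 1) = (3 ^ (2 * r - 1)) ^ ω := pow_right_comm _ _ _
          rw [hK, mul_pow 2 (_ : ℝ) (2 * r - 1), mul_pow _ (3 ^ ω) (2 * r - 1), h4,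
            mul_pow _ (3 ^ (2 * r - 1) : ℝ) ω]
          ring
      _ ≤ 2 ^ (2 * r - 1) * √q * B ^ (2 * r - 1 + 1) * (C₀ * (q : ℝ) ^ ε) := by
          gcongr
          exact hC q (NeZero.pos q)
      _ = _ := by
          rw [show 2 * r - 1 + 1 = 2 * r by omega]
          ring
  calc _ ≤ r ^ (2 * r) * B ^ r * (q : ℝ) + ∑ i₀ : ι,
        2 ^ (2 * r - 1) * C₀ * (q : ℝ) ^ ε * (√q * (B : ℝ) ^ (2 * r)) := by
        gcongr with i₀
        exact hgood i₀
    _ = r ^ (2 * r) * 1 * (q * B ^ r) +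
        (2 * r) * 2 ^ (2 * r - 1) * C₀ * (q : ℝ) ^ ε * (√q * (B : ℝ) ^ (2 * r)) := by
        rw [Finset.sum_const, Finset.card_univ, hcard, nsmul_eq_mul]
        push_cast
        ring
    _ ≤ r ^ (2 * r) * (q : ℝ) ^ ε * (q * B ^ r + √q * (B : ℝ) ^ (2 * r)) +
        (2 * r) * 2 ^ (2 * r - 1) * C₀ * (q : ℝ) ^ ε * (q * B ^ r + √q * (B : ℝ) ^ (2 * r)) := by
        gcongr
        · exact le_add_of_nonneg_right (by positivity)
        · exact le_add_of_nonneg_left (by positivity)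
    _ = _ := by ring

section Parseval

variable {q : ℕ} [NeZero q]

theorem sum_norm_sq_sum_stdAddChar (c : ZMod q → ℂ) :
    ∑ x : ZMod q, ‖∑ k, c k * ZMod.stdAddChar (x * k)‖ ^ 2 = q * ∑ k, ‖c k‖ ^ 2 := by
  have h1 : ∀ x : ZMod q, ((‖∑ k, c k * ZMod.stdAddChar (x * k)‖ ^ 2 : ℝ) : ℂ) =
      ∑ k, ∑ l, c k * (starRingEnd ℂ) (c l) * ZMod.stdAddChar (x * (k - l)) := by
    intro x
    rw [← Complex.normSq_eq_norm_sq, ← Complex.mul_conj, map_sum, Finset.sum_mul_sum]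
    refine Finset.sum_congr rfl fun k _ => Finset.sum_congr rfl fun l _ => ?_
    rw [map_mul (starRingEnd ℂ), ← AddChar.map_neg_eq_conj, mul_sub, sub_eq_add_neg, AddChar.map_add_eq_mul]
    ring
  have h2 : ((∑ x : ZMod q, ‖∑ k, c k * ZMod.stdAddChar (x * k)‖ ^ 2 : ℝ) : ℂ) =
      ((q * ∑ k, ‖c k‖ ^ 2 : ℝ) : ℂ) := by
    rw [Complex.ofReal_sum, Finset.sum_congr rfl fun x _ => h1 x, Finset.sum_comm]
    push_cast
    rw [Finset.mul_sum]
    refine Finset.sum_congr rfl fun k _ => ?_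
    rw [Finset.sum_comm]
    have h3 : ∀ l, ∑ x : ZMod q, c k * (starRingEnd ℂ) (c l) * ZMod.stdAddChar (x * (k - l)) =
        if l = k then c k * (starRingEnd ℂ) (c k) * q else 0 := by
      intro l
      rw [← Finset.mul_sum, AddChar.sum_mulShift _ (ZMod.isPrimitive_stdAddChar q)]
      by_cases h : k = l
      · subst h
        simp [ZMod.card]
      · rw [if_neg (sub_ne_zero.mpr h), if_neg (Ne.symm h)]
        simp
    rw [Finset.sum_congr rfl fun l _ => h3 l, Finset.sum_ite_eq' Finset.univ k,
      if_pos (Finset.mem_univ _), Complex.mul_conj, Complex.normSq_eq_norm_sq]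
    push_cast
    ring
  exact_mod_cast h2

theorem sum_norm_sq_finset_stdAddChar (S : Finset (ZMod q)) :
    ∑ x : ZMod q, ‖∑ k ∈ S, ZMod.stdAddChar (x * k)‖ ^ 2 = q * S.card := by
  have := sum_norm_sq_sum_stdAddChar (fun k => if k ∈ S then 1 else 0)
  simp only [ite_mul, one_mul, zero_mul, Finset.sum_ite_mem, Finset.univ_inter] at this
  rw [this]
  congr 1
  have : ∀ k, ‖if k ∈ S then (1 : ℂ) else 0‖ ^ 2 = if k ∈ S then 1 else 0 := by
    intro k
    split_ifs <;> simp
  rw [Finset.sum_congr rfl fun k _ => this k]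
  simp

theorem norm_gaussSum_sq_mul_sum {χ : DirichletCharacter ℂ q} (hχ : χ.IsPrimitive)
    (S : Finset ℤ) :
    ‖gaussSum χ ZMod.stdAddChar‖ ^ 2 * ∑ x : ZMod q, ‖∑ b ∈ S, χ (x + (b : ZMod q))‖ ^ 2 =
      q * ∑ x : ZMod q, ‖χ x‖ ^ 2 * ‖∑ b ∈ S, ZMod.stdAddChar (x * (b : ZMod q))‖ ^ 2 := by
  have h1 : ∀ a : ZMod q, (starRingEnd ℂ) (∑ b ∈ S, χ (a + (b : ZMod q))) * gaussSum χ ZMod.stdAddChar =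
      ∑ k, (χ k * ∑ b ∈ S, ZMod.stdAddChar (k * (b : ZMod q))) * ZMod.stdAddChar (a * k) := by
    intro a
    rw [map_sum, Finset.sum_mul]
    have h2 : ∀ b ∈ S, (starRingEnd ℂ) (χ (a + (b : ZMod q))) * gaussSum χ ZMod.stdAddChar =
        ∑ k, χ k * ZMod.stdAddChar ((a + (b : ZMod q)) * k) := by
      intro b _
      rw [starRingEnd_apply, MulChar.star_apply', ← gaussSum_mulShift_of_isPrimitive _ hχ]
      rfl
    rw [Finset.sum_congr rfl h2, Finset.sum_comm]
    refine Finset.sum_congr rfl fun k _ => ?_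
    rw [Finset.mul_sum, Finset.sum_mul]
    refine Finset.sum_congr rfl fun b _ => ?_
    rw [add_mul, AddChar.map_add_eq_mul, mul_comm (b : ZMod q)]
    ring
  have h3 := sum_norm_sq_sum_stdAddChar
    (fun k : ZMod q => χ k * ∑ b ∈ S, ZMod.stdAddChar (k * (b : ZMod q)))
  simp only [← h1, norm_mul, RCLike.norm_conj, mul_pow] at h3
  rw [← h3, Finset.mul_sum]
  exact Finset.sum_congr rfl fun x _ => mul_comm _ _

theorem norm_gaussSum_sq {χ : DirichletCharacter ℂ q} (hχ : χ.IsPrimitive) :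
    ‖gaussSum χ ZMod.stdAddChar‖ ^ 2 = q := by
  have h := norm_gaussSum_sq_mul_sum hχ {0}
  simp only [Finset.sum_singleton, Int.cast_zero, add_zero, mul_zero, AddChar.map_zero_eq_one,
    norm_one, one_pow, mul_one] at h
  refine mul_right_cancel₀ (ne_of_gt ?_) h
  refine Finset.sum_pos' (fun _ _ => by positivity) ⟨1, Finset.mem_univ _, ?_⟩
  simp

/-- The second moment of short sums of a primitive character. -/
theorem sum_norm_sq_short_sum_le {χ : DirichletCharacter ℂ q} (hχ : χ.IsPrimitive) {B : ℕ}
    (hB : B ≤ q) : ∑ x : ZMod q, ‖∑ b ∈ Finset.Icc (1 : ℤ) B, χ (x + b)‖ ^ 2 ≤ q * B := by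
  have hq : (0 : ℝ) < q := by exact_mod_cast NeZero.pos q
  have h := norm_gaussSum_sq_mul_sum hχ (Finset.Icc (1 : ℤ) B)
  rw [norm_gaussSum_sq hχ] at h
  rw [mul_left_cancel₀ hq.ne' h]
  have hinj : Set.InjOn (fun b : ℤ => (b : ZMod q)) (Finset.Icc (1 : ℤ) B) := by
    intro a ha b hb hab
    rw [Finset.mem_coe, Finset.mem_Icc] at ha hb
    have h1 := (ZMod.intCast_eq_intCast_iff_dvd_sub a b q).mp hab
    have h2 := Int.eq_zero_of_abs_lt_dvd h1 (by rw [abs_lt]; omega)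
    omega
  have h2 := sum_norm_sq_finset_stdAddChar ((Finset.Icc (1 : ℤ) B).image fun b : ℤ => (b : ZMod q))
  rw [Finset.card_image_of_injOn hinj] at h2
  simp only [Finset.sum_image hinj] at h2
  calc _ ≤ ∑ x : ZMod q, ‖∑ b ∈ Finset.Icc (1 : ℤ) B, ZMod.stdAddChar (x * (b : ZMod q))‖ ^ 2 := by
        refine Finset.sum_le_sum fun x _ => mul_le_of_le_one_left (by positivity) ?_
        exact pow_le_one₀ (norm_nonneg _) (norm_mulChar_le_one χ x)
    _ = _ := by
        rw [h2]
        simp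

end Parseval

theorem half_le_norm_sum_stdAddChar {q : ℕ} [NeZero q] {T : ℕ} {w : ℤ}
    (h : 6 * (T * |w|) ≤ q) :
    (T : ℝ) / 2 ≤ ‖∑ t ∈ Finset.Ioc 0 T, ZMod.stdAddChar (((t : ℤ) * w : ℤ) : ZMod q)‖ := by
  have hq : (0 : ℝ) < q := by exact_mod_cast NeZero.pos q
  refine le_trans ?_ (Complex.re_le_norm _)
  rw [Complex.re_sum]
  have h1 : ∀ t ∈ Finset.Ioc 0 T,
      (1 / 2 : ℝ) ≤ (ZMod.stdAddChar (((t : ℤ) * w : ℤ) : ZMod q) : ℂ).re := by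
    intro t ht
    rw [Finset.mem_Ioc] at ht
    rw [ZMod.stdAddChar_coe]
    have h2 : 2 * Real.pi * Complex.I * ((t : ℤ) * w : ℤ) / q =
        ((2 * Real.pi * ((t : ℤ) * w : ℤ) / q : ℝ) : ℂ) * Complex.I := by
      push_cast
      ring
    rw [h2, Complex.exp_ofReal_mul_I_re, ← Real.cos_abs, ← Real.cos_pi_div_three]
    refine Real.cos_le_cos_of_nonneg_of_le_pi (abs_nonneg _) (by linarith [Real.pi_pos]) ?_
    rw [abs_div, abs_mul, abs_of_pos Real.two_pi_pos, abs_of_pos hq, div_le_iff₀ hq]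
    have h3 : 6 * |(((t : ℤ) * w : ℤ) : ℝ)| ≤ q := by
      have : 6 * |(t : ℤ) * w| ≤ q := by
        rw [abs_mul, Nat.abs_cast]
        refine le_trans ?_ h
        gcongr
        exact ht.2
      exact_mod_cast this
    nlinarith [Real.pi_pos]
  calc (T : ℝ) / 2 = ∑ t ∈ Finset.Ioc 0 T, (1 / 2 : ℝ) := by simp; ring
    _ ≤ _ := Finset.sum_le_sum h1

/-- A finite family of disjoint intervals `(N i, N i + L i]` of comparable lengths. -/
structure IntervalFamily (q h : ℕ) {ι : Type*} (N L : ι → ℕ) : Prop where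
  le_length : ∀ i, h ≤ L i
  length_le : ∀ i, L i ≤ 2 * h
  disjoint : ∀ i j, i ≠ j → N i + L i ≤ N j ∨ N j + L j ≤ N i
  bound : ∀ i, N i + 4 * h ≤ 3 * q

theorem IntervalFamily.const {ι : Type*} {q h : ℕ} {N L : ι → ℕ} (hF : IntervalFamily q h N L) :
    IntervalFamily q h N (fun _ => h) where
  le_length _ := le_rfl
  length_le _ := by omega
  disjoint i j hij := by
    have h1 := hF.le_length i
    have h2 := hF.le_length j
    have := hF.disjoint i j hij
    omega
  bound := hF.bound

section Family

variable {ι : Type*} [Fintype ι] {q h : ℕ} {N L : ι → ℕ}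

/-- The points of the intervals of a family. -/
def points (N L : ι → ℕ) : Finset (Σ _ : ι, ℕ) :=
  Finset.univ.sigma fun i => Finset.Ioc (N i) (N i + L i)

theorem mem_points {p : Σ _ : ι, ℕ} : p ∈ points N L ↔ N p.1 < p.2 ∧ p.2 ≤ N p.1 + L p.1 := by
  simp [points]

theorem sum_points {M : Type*} [AddCommMonoid M] (f : ι → ℕ → M) :
    ∑ p ∈ points N L, f p.1 p.2 = ∑ i, ∑ n ∈ Finset.Ioc (N i) (N i + L i), f i n := by
  rw [points, Finset.sum_sigma]

theorem IntervalFamily.card_points_le (hF : IntervalFamily q h N L) :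
    (points N L).card ≤ 2 * (Fintype.card ι * h) := by
  rw [points, Finset.card_sigma]
  calc _ ≤ ∑ _i : ι, 2 * h := Finset.sum_le_sum fun i _ => by simpa using hF.length_le i
    _ = _ := by simp; ring

theorem IntervalFamily.snd_injOn (hF : IntervalFamily q h N L) :
    Set.InjOn (fun p : Σ _ : ι, ℕ => p.2) (points N L) := by
  rintro ⟨i, n⟩ hp ⟨j, m⟩ hp' (rfl : n = m)
  rw [Finset.mem_coe, mem_points] at hp hp'
  by_cases hij : i = j
  · rw [hij]
  · have := hF.disjoint i j hij
    dsimp only at hp hp'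
    omega

theorem IntervalFamily.card_fiber_le [NeZero q] (hF : IntervalFamily q h N L) (x : ZMod q) :
    ((points N L).filter fun p => (p.2 : ZMod q) = x).card ≤ 3 := by
  have hq := NeZero.pos q
  rw [← Finset.card_image_of_injOn (hF.snd_injOn.mono
    (Finset.coe_subset.mpr (Finset.filter_subset _ _)))]
  have h1 := Nat.Ioc_filter_modEq_card 0 (3 * q) hq x.val
  have h2 : ((((3 * q : ℕ) : ℚ) - (x.val : ℕ)) / q) = (((0 : ℕ) : ℚ) - (x.val : ℕ)) / q + (3 : ℤ) := by
    have : (q : ℚ) ≠ 0 := by exact_mod_cast hq.ne'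
    field_simp
    push_cast
    ring
  rw [h2, Int.floor_add_intCast] at h1
  have h3 : ((Finset.Ioc 0 (3 * q)).filter fun n => n ≡ x.val [MOD q]).card = 3 := by
    have : max (⌊(((0 : ℕ) : ℚ) - (x.val : ℕ)) / q⌋ + 3 - ⌊(((0 : ℕ) : ℚ) - (x.val : ℕ)) / q⌋) 0
      = (3 : ℤ) := by simp
    rw [this] at h1
    exact_mod_cast h1
  rw [← h3]
  refine Finset.card_le_card fun n hn => ?_
  obtain ⟨p, hp, rfl⟩ := Finset.mem_image.mp hn
  rw [Finset.mem_filter, mem_points] at hp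
  have h4 := hF.length_le p.1
  have h5 := hF.bound p.1
  rw [Finset.mem_filter, Finset.mem_Ioc]
  refine ⟨by omega, ?_⟩
  rw [← ZMod.natCast_eq_natCast_iff, hp.2]
  simp

theorem IntervalFamily.sum_norm_sq_le [NeZero q] (hF : IntervalFamily q h N L)
    (hh : 0 < h) (S : Finset ℤ) (hS : ∀ m ∈ S, 6 * (h * |m|) ≤ q) :
    ∑ m ∈ S, ‖∑ i, ZMod.stdAddChar ((m * (N i : ℤ) : ℤ) : ZMod q)‖ ^ 2 ≤
      12 * (q * Fintype.card ι / h : ℝ) := by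
  have hh' : (0 : ℝ) < h := by exact_mod_cast hh
  set P := points N (fun _ => h) with hP
  set f : ZMod q → ℝ := fun x => ((P.filter fun p => (p.2 : ZMod q) = x).card : ℝ) with hf
  have hfib : ∀ x : ZMod q, ∑ k, (f k : ℂ) * ZMod.stdAddChar (x * k) =
      ∑ p ∈ P, ZMod.stdAddChar (x * (p.2 : ZMod q)) := by
    intro x
    rw [← Finset.sum_fiberwise_of_maps_to (s := P) (t := Finset.univ)
      (g := fun p => (p.2 : ZMod q)) fun _ _ => Finset.mem_univ _]
    refine Finset.sum_congr rfl fun k _ => ?_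
    rw [Finset.sum_congr rfl (g := fun _ => ZMod.stdAddChar (x * k)) fun p hp => by
      rw [(Finset.mem_filter.mp hp).2]]
    simp [hf]
  have hpars := sum_norm_sq_sum_stdAddChar (fun x => (f x : ℂ))
  have hsumf : ∑ k, f k = Fintype.card ι * h := by
    have : ∑ k, f k = (P.card : ℝ) := by
      rw [hf, ← Nat.cast_sum, ← Finset.card_eq_sum_card_fiberwise]
      exact fun _ _ => Finset.mem_univ _
    rw [this, hP, points, Finset.card_sigma]
    simp
  have hsq : ∑ k, ‖(f k : ℂ)‖ ^ 2 ≤ 3 * (Fintype.card ι * h) := by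
    rw [← hsumf, Finset.mul_sum]
    refine Finset.sum_le_sum fun k _ => ?_
    have h1 : f k ≤ 3 := by
      simp only [hf]
      exact_mod_cast hF.const.card_fiber_le k
    have h2 : 0 ≤ f k := by positivity
    rw [Complex.norm_real, Real.norm_of_nonneg h2]
    nlinarith
  have hinj : Set.InjOn (fun m : ℤ => (m : ZMod q)) S := by
    intro a ha b hb hab
    have h1 := (ZMod.intCast_eq_intCast_iff_dvd_sub a b q).mp hab
    have hq : (0 : ℤ) < q := by exact_mod_cast NeZero.pos q
    have h4 : ∀ m ∈ S, 6 * |m| ≤ q := fun m hm => by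
      refine le_trans ?_ (hS m hm)
      have : (1 : ℤ) ≤ h := by exact_mod_cast hh
      nlinarith [abs_nonneg m]
    have h2 := h4 a ha
    have h3 := h4 b hb
    have h5 := Int.eq_zero_of_abs_lt_dvd h1 (by have := abs_sub b a; omega)
    omega
  have hfac : ∀ m : ℤ, ∑ p ∈ P, ZMod.stdAddChar ((m : ZMod q) * (p.2 : ZMod q)) =
      (∑ i, ZMod.stdAddChar ((m * (N i : ℤ) : ℤ) : ZMod q)) *
        ∑ t ∈ Finset.Ioc 0 h, ZMod.stdAddChar (((t : ℤ) * m : ℤ) : ZMod q) := by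
    intro m
    rw [hP, sum_points (fun _ n => (ZMod.stdAddChar ((m : ZMod q) * (n : ZMod q)) : ℂ)), Finset.sum_mul]
    refine Finset.sum_congr rfl fun i _ => ?_
    rw [Finset.mul_sum]
    have : Finset.Ioc (N i) (N i + h) = (Finset.Ioc 0 h).map (addLeftEmbedding (N i)) := by
      simp
    rw [this, Finset.sum_map]
    refine Finset.sum_congr rfl fun t _ => ?_
    rw [← AddChar.map_add_eq_mul]
    congr 1
    simp only [addLeftEmbedding_apply]
    push_cast
    ring
  have hmain : (h / 2 : ℝ) ^ 2 * ∑ m ∈ S, ‖∑ i, ZMod.stdAddChar ((m * (N i : ℤ) : ℤ) : ZMod q)‖ ^ 2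
      ≤ q * (3 * (Fintype.card ι * h)) := by
    rw [Finset.mul_sum]
    calc _ ≤ ∑ m ∈ S, ‖∑ k, (f k : ℂ) * ZMod.stdAddChar ((m : ZMod q) * k)‖ ^ 2 := by
          refine Finset.sum_le_sum fun m hm => ?_
          rw [hfib, hfac, norm_mul, mul_pow, mul_comm]
          gcongr
          exact half_le_norm_sum_stdAddChar (hS m hm)
      _ = ∑ x ∈ S.image (fun m : ℤ => (m : ZMod q)), ‖∑ k, (f k : ℂ) * ZMod.stdAddChar (x * k)‖ ^ 2 := by
          rw [Finset.sum_image hinj]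
      _ ≤ ∑ x, ‖∑ k, (f k : ℂ) * ZMod.stdAddChar (x * k)‖ ^ 2 :=
          Finset.sum_le_univ_sum_of_nonneg fun _ => by positivity
      _ ≤ _ := by
          rw [hpars]
          gcongr
  rw [← sub_nonneg] at hmain ⊢
  have : 12 * (q * Fintype.card ι / h : ℝ) -
      ∑ m ∈ S, ‖∑ i, ZMod.stdAddChar ((m * (N i : ℤ) : ℤ) : ZMod q)‖ ^ 2 =
      (q * (3 * (Fintype.card ι * h)) - (h / 2 : ℝ) ^ 2 *
        ∑ m ∈ S, ‖∑ i, ZMod.stdAddChar ((m * (N i : ℤ) : ℤ) : ZMod q)‖ ^ 2) * (4 / h ^ 2) := by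
    field_simp
    ring
  rw [this]
  positivity

end Family

/-- The number of solutions of `a' n = a n'` modulo `q` with `a, a' ∈ A` and `n, n'` points of the
family of intervals. -/
def energy (q : ℕ) {ι : Type*} [Fintype ι] (N L : ι → ℕ) (A : Finset ℕ) : ℕ :=
  ∑ a ∈ A, ∑ a' ∈ A, ∑ i, ∑ j, ((Finset.Ioc (N i) (N i + L i) ×ˢ Finset.Ioc (N j) (N j + L j)).filter
    fun x => ((a' * x.1 : ℕ) : ZMod q) = ((a * x.2 : ℕ) : ZMod q)).card

theorem card_primeFactors_le_log {m n : ℕ} (hm : m ≠ 0) (hmn : m ≤ n) :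
    m.primeFactors.card ≤ Nat.log 2 n := by
  refine Nat.le_log_of_pow_le one_lt_two (le_trans ?_ hmn)
  calc 2 ^ m.primeFactors.card = ∏ _p ∈ m.primeFactors, 2 := by simp
    _ ≤ ∏ p ∈ m.primeFactors, p :=
        Finset.prod_le_prod (fun _ _ => by simp) fun p hp => (Nat.prime_of_mem_primeFactors hp).two_le
    _ ≤ m := Nat.le_of_dvd (Nat.pos_of_ne_zero hm) (Nat.prod_primeFactors_dvd m)

/-- The large sieve duality for finite exponential sums. -/
theorem sum_norm_sq_addChar_symm {R α β : Type*} [CommRing R] [Finite R] (ψ : AddChar R ℂ)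
    (S : Finset α) (y : α → R) (T : Finset β) (t : β → R) :
    ∑ k ∈ S, ∑ l ∈ S, ‖∑ u ∈ T, ψ (t u * (y k - y l))‖ ^ 2 =
      ∑ u ∈ T, ∑ v ∈ T, ‖∑ k ∈ S, ψ ((t u - t v) * y k)‖ ^ 2 := by
  have h1 : ((∑ k ∈ S, ∑ l ∈ S, ‖∑ u ∈ T, ψ (t u * (y k - y l))‖ ^ 2 : ℝ) : ℂ) =
      ∑ k ∈ S, ∑ l ∈ S, ∑ u ∈ T, ∑ v ∈ T, ψ ((t u - t v) * (y k - y l)) := by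
    push_cast
    refine Finset.sum_congr rfl fun k _ => Finset.sum_congr rfl fun l _ => ?_
    rw [← Complex.ofReal_pow, ← Complex.normSq_eq_norm_sq, ← Complex.mul_conj, map_sum,
      Finset.sum_mul_sum]
    refine Finset.sum_congr rfl fun u _ => Finset.sum_congr rfl fun v _ => ?_
    rw [← AddChar.map_neg_eq_conj, ← AddChar.map_add_eq_mul]
    congr 1
    ring
  have h2 : ((∑ u ∈ T, ∑ v ∈ T, ‖∑ k ∈ S, ψ ((t u - t v) * y k)‖ ^ 2 : ℝ) : ℂ) =
      ∑ u ∈ T, ∑ v ∈ T, ∑ k ∈ S, ∑ l ∈ S, ψ ((t u - t v) * (y k - y l)) := by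
    push_cast
    refine Finset.sum_congr rfl fun u _ => Finset.sum_congr rfl fun v _ => ?_
    rw [← Complex.ofReal_pow, ← Complex.normSq_eq_norm_sq, ← Complex.mul_conj, map_sum,
      Finset.sum_mul_sum]
    refine Finset.sum_congr rfl fun k _ => Finset.sum_congr rfl fun l _ => ?_
    rw [← AddChar.map_neg_eq_conj, ← AddChar.map_add_eq_mul]
    congr 1
    ring
  have h3 : ∑ k ∈ S, ∑ l ∈ S, ∑ u ∈ T, ∑ v ∈ T, ψ ((t u - t v) * (y k - y l)) =
      ∑ u ∈ T, ∑ v ∈ T, ∑ k ∈ S, ∑ l ∈ S, ψ ((t u - t v) * (y k - y l)) := by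
    calc _ = ∑ x ∈ S ×ˢ S, ∑ z ∈ T ×ˢ T, ψ ((t z.1 - t z.2) * (y x.1 - y x.2)) := by
          simp only [Finset.sum_product]
      _ = ∑ z ∈ T ×ˢ T, ∑ x ∈ S ×ˢ S, ψ ((t z.1 - t z.2) * (y x.1 - y x.2)) := Finset.sum_comm
      _ = _ := by simp only [Finset.sum_product]
  rw [h3, ← h2] at h1
  exact_mod_cast h1

theorem sum_sum_sub_le (T : ℕ) (F : ℤ → ℝ) (hF : ∀ s, 0 ≤ F s) :
    ∑ u ∈ Finset.Ioc 0 T, ∑ v ∈ Finset.Ioc 0 T, F ((u : ℤ) - v) ≤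
      T * ∑ s ∈ Finset.Icc (-(T : ℤ)) T, F s := by
  calc _ ≤ ∑ u ∈ Finset.Ioc 0 T, ∑ s ∈ Finset.Icc (-(T : ℤ)) T, F s := by
        refine Finset.sum_le_sum fun u hu => ?_
        have hinj : Set.InjOn (fun v : ℕ => (u : ℤ) - v) (Finset.Ioc 0 T) := by
          intro v _ v' _ h
          dsimp only at h
          omega
        rw [← Finset.sum_image (f := F) hinj]
        refine Finset.sum_le_sum_of_subset_of_nonneg ?_ fun s _ _ => hF s
        intro s hs
        obtain ⟨v, hv, rfl⟩ := Finset.mem_image.mp hs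
        rw [Finset.mem_Ioc] at hu hv
        rw [Finset.mem_Icc]
        omega
    _ = _ := by simp

theorem card_Ioc_modEq_le (n₀ L v : ℕ) {a : ℕ} (ha : 0 < a) :
    (((Finset.Ioc n₀ (n₀ + L)).filter fun n => n ≡ v [MOD a]).card : ℝ) ≤ L / a + 1 := by
  have h1 := Nat.Ioc_filter_modEq_card n₀ (n₀ + L) ha v
  have h2 : (((Finset.Ioc n₀ (n₀ + L)).filter fun n => n ≡ v [MOD a]).card : ℚ) ≤ L / a + 1 := by
    have h3 : ((((Finset.Ioc n₀ (n₀ + L)).filter fun n => n ≡ v [MOD a]).card : ℤ) : ℚ) ≤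
        L / a + 1 := by
      rw [h1]
      push_cast
      refine max_le ?_ (by positivity)
      have h4 := Int.floor_le (((n₀ : ℚ) + L - v) / a)
      have h5 := Int.lt_floor_add_one (((n₀ : ℚ) - v) / a)
      have h6 : ((n₀ : ℚ) + L - v) / a = (n₀ - v) / a + L / a := by ring
      linarith
    exact_mod_cast h3
  have h7 := (Rat.cast_le (K := ℝ)).mpr h2
  rwa [Rat.cast_natCast, Rat.cast_add, Rat.cast_div, Rat.cast_natCast, Rat.cast_natCast,
    Rat.cast_one] at h7

open Classical in
theorem IntervalFamily.card_off_diagonal_le {ι : Type*} {q h : ℕ} {N L : ι → ℕ}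
    [NeZero q] (hF : IntervalFamily q h N L) {A : ℕ}
    (hA : 4 * (A * h) < q) {a a' : ℕ} (ha0 : 0 < a) (ha : a ≤ A) (ha' : a' ≤ A)
    (haa : a.Coprime a') {R : ℝ} (hR : 2 * (h : ℝ) / a + 1 ≤ R) (i j : ι) :
    (((Finset.Ioc (N i) (N i + L i) ×ˢ Finset.Ioc (N j) (N j + L j)).filter
      fun x => ((a' * x.1 : ℕ) : ZMod q) = ((a * x.2 : ℕ) : ZMod q)).card : ℝ) ≤
      R * if ∃ w : ℤ, |w| ≤ 2 * (A * h) ∧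
        ((a' * N i : ℤ) - (a * N j : ℤ) : ZMod q) = w then 1 else 0 := by
  set S := (Finset.Ioc (N i) (N i + L i) ×ˢ Finset.Ioc (N j) (N j + L j)).filter
      fun x => ((a' * x.1 : ℕ) : ZMod q) = ((a * x.2 : ℕ) : ZMod q) with hS
  have hR0 : 0 ≤ R := le_trans (by positivity) hR
  rcases S.eq_empty_or_nonempty with hemp | ⟨⟨n₀, n₀'⟩, hn₀⟩
  · rw [hemp]
    simp only [Finset.card_empty, Nat.cast_zero]
    positivity
  have hLi := hF.length_le i
  have hLj := hF.length_le j
  have hmem : ∀ x ∈ S, (N i < x.1 ∧ x.1 ≤ N i + L i) ∧ (N j < x.2 ∧ x.2 ≤ N j + L j) ∧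
      ((a' * x.1 : ℕ) : ZMod q) = ((a * x.2 : ℕ) : ZMod q) := by
    intro x hx
    rw [hS, Finset.mem_filter, Finset.mem_product, Finset.mem_Ioc, Finset.mem_Ioc] at hx
    exact ⟨hx.1.1, hx.1.2, hx.2⟩
  have haA : (a : ℤ) ≤ A := by exact_mod_cast ha
  have haA' : (a' : ℤ) ≤ A := by exact_mod_cast ha'
  have hprod : ∀ (c : ℕ) (u : ℤ), c ≤ A → |u| ≤ 2 * h → |c * u| ≤ 2 * (A * h) := by
    intro c u hc hu
    have hc' : (c : ℤ) ≤ A := by exact_mod_cast hc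
    rw [abs_mul, Nat.abs_cast]
    calc (c : ℤ) * |u| ≤ A * (2 * h) := by gcongr
      _ = _ := by ring
  have hprod' : ∀ (c : ℕ) (u : ℤ), c ≤ A → 0 ≤ u → u ≤ 2 * h → 0 ≤ c * u ∧ c * u ≤ 2 * (A * h) := by
    intro c u hc hu0 hu
    have := hprod c u hc (by rwa [abs_of_nonneg hu0])
    exact ⟨by positivity, (le_abs_self _).trans this⟩
  rw [if_pos, mul_one]
  · refine le_trans ?_ hR
    have hlin : ∀ x ∈ S, (a' : ℤ) * ((x.1 : ℤ) - n₀) = a * ((x.2 : ℤ) - n₀') := by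
      intro x hx
      obtain ⟨h1, h2, h3⟩ := hmem x hx
      obtain ⟨h4, h5, h6⟩ := hmem _ hn₀
      dsimp only at h4 h5 h6
      have h7 : ((a' * ((x.1 : ℤ) - n₀) - a * ((x.2 : ℤ) - n₀') : ℤ) : ZMod q) = 0 := by
        push_cast at h3 h6 ⊢
        linear_combination h3 - h6
      rw [ZMod.intCast_zmod_eq_zero_iff_dvd] at h7
      have h8 := hprod a' ((x.1 : ℤ) - n₀) ha' (by rw [abs_le]; omega)
      have h9 := hprod a ((x.2 : ℤ) - n₀') ha (by rw [abs_le]; omega)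
      have h10 := abs_sub (a' * ((x.1 : ℤ) - n₀)) (a * ((x.2 : ℤ) - n₀'))
      have h11 : (4 * (A * h) : ℤ) < q := by exact_mod_cast hA
      have := Int.eq_zero_of_abs_lt_dvd h7 (by linarith)
      linarith
    have hinj : Set.InjOn (fun x : ℕ × ℕ => x.1) S := by
      intro x hx y hy hxy
      have h1 := hlin x hx
      have h2 := hlin y hy
      dsimp only at hxy
      rw [hxy, h2] at h1
      have h3 := mul_left_cancel₀ (by exact_mod_cast ha0.ne') h1
      refine Prod.ext hxy ?_
      omega
    have hsub : S.image (fun x : ℕ × ℕ => x.1) ⊆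
        (Finset.Ioc (N i) (N i + L i)).filter fun n => n ≡ n₀ [MOD a] := by
      intro n hn
      obtain ⟨x, hx, rfl⟩ := Finset.mem_image.mp hn
      rw [Finset.mem_filter, Finset.mem_Ioc]
      refine ⟨(hmem x hx).1, ?_⟩
      rw [← Int.natCast_modEq_iff]
      refine Int.ModEq.symm ((Int.modEq_iff_dvd).mpr ?_)
      have h1 : (a : ℤ) ∣ a' * ((x.1 : ℤ) - n₀) := ⟨_, hlin x hx⟩
      exact (Int.isCoprime_iff_gcd_eq_one.mpr (by simpa using haa)).dvd_of_dvd_mul_left h1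
    rw [← Finset.card_image_of_injOn hinj]
    calc _ ≤ (((Finset.Ioc (N i) (N i + L i)).filter fun n => n ≡ n₀ [MOD a]).card : ℝ) := by
          exact_mod_cast Finset.card_le_card hsub
      _ ≤ (L i : ℝ) / a + 1 := card_Ioc_modEq_le _ _ _ ha0
      _ ≤ _ := by
          gcongr
          exact_mod_cast hLi
  · obtain ⟨h4, h5, h6⟩ := hmem _ hn₀
    dsimp only at h4 h5 h6
    refine ⟨a * ((n₀' : ℤ) - N j) - a' * ((n₀ : ℤ) - N i), ?_, ?_⟩
    · obtain ⟨h7, h8⟩ := hprod' a' ((n₀ : ℤ) - N i) ha' (by omega) (by omega)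
      obtain ⟨h9, h10⟩ := hprod' a ((n₀' : ℤ) - N j) ha (by omega) (by omega)
      rw [abs_le]
      constructor <;> linarith
    · push_cast at h6 ⊢
      linear_combination h6

section Energy

variable {ι : Type*} [Fintype ι] {q h : ℕ} {N L : ι → ℕ}

theorem IntervalFamily.sum_diagonal_le [NeZero q] (hF : IntervalFamily q h N L) {a : ℕ}
    (ha : a.Coprime q) :
    ∑ i, ∑ j, ((Finset.Ioc (N i) (N i + L i) ×ˢ Finset.Ioc (N j) (N j + L j)).filter
      fun x => ((a * x.1 : ℕ) : ZMod q) = ((a * x.2 : ℕ) : ZMod q)).card ≤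
      6 * (Fintype.card ι * h) := by
  have hu : IsUnit (a : ZMod q) := (ZMod.isUnit_iff_coprime a q).mpr ha
  calc _ = ∑ p ∈ points N L, ((points N L).filter fun p' => (p'.2 : ZMod q) = p.2).card := by
        rw [sum_points fun _ n => ((points N L).filter fun p' => (p'.2 : ZMod q) = n).card]
        refine Finset.sum_congr rfl fun i _ => ?_
        simp only [Finset.card_filter, Finset.sum_product]
        rw [Finset.sum_comm]
        refine Finset.sum_congr rfl fun n _ => ?_
        rw [sum_points fun _ n' => if (n' : ZMod q) = (n : ZMod q) then 1 else 0]
        refine Finset.sum_congr rfl fun j _ => Finset.sum_congr rfl fun n' _ => ?_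
        refine if_congr ?_ rfl rfl
        push_cast
        rw [hu.mul_right_inj, eq_comm]
    _ ≤ ∑ p ∈ points N L, 3 := Finset.sum_le_sum fun p _ => hF.card_fiber_le _
    _ ≤ _ := by
        have := hF.card_points_le
        simp only [Finset.sum_const, smul_eq_mul]
        omega

end Energy

section Energy

variable {ι : Type*} [Fintype ι] {q h : ℕ} {N L : ι → ℕ}

theorem IntervalFamily.sum_norm_sq_mul_le [NeZero q] (hF : IntervalFamily q h N L) (hh : 0 < h)
    {A T : ℕ} (hT : 12 * (T * (A * h)) ≤ q) {𝒜 : Finset ℕ}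
    (h𝒜 : ∀ a ∈ 𝒜, a.Prime ∧ a ≤ A) :
    ∑ s ∈ Finset.Icc (-(T : ℤ)) T,
      ‖∑ a ∈ 𝒜, ∑ i, ZMod.stdAddChar ((s * (a * N i) : ℤ) : ZMod q)‖ ^ 2 ≤
      (𝒜.card : ℝ) ^ 2 * (Fintype.card ι : ℝ) ^ 2 +
        𝒜.card * (Nat.log 2 q * (12 * (q * Fintype.card ι / h))) := by
  set g : ℤ → ℝ := fun m => ‖∑ i, ZMod.stdAddChar ((m * (N i : ℤ) : ℤ) : ZMod q)‖ ^ 2 with hg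
  have hg0 : ∀ m, 0 ≤ g m := fun m => by positivity
  set I := (Finset.Icc (-(T : ℤ)) T).erase 0 with hI
  set M := Finset.Icc (-((T * A : ℕ) : ℤ)) (T * A : ℕ) with hM
  have h0mem : (0 : ℤ) ∈ Finset.Icc (-(T : ℤ)) T := by simp
  rw [← Finset.add_sum_erase _ _ h0mem]
  refine add_le_add ?_ ?_
  · simp only [zero_mul, Int.cast_zero, AddChar.map_zero_eq_one]
    simp [mul_pow]
  · have hCS : ∀ s ∈ I, ‖∑ a ∈ 𝒜, ∑ i, ZMod.stdAddChar ((s * (a * N i) : ℤ) : ZMod q)‖ ^ 2 ≤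
        𝒜.card * ∑ a ∈ 𝒜, g (s * a) := by
      intro s _
      calc _ ≤ (∑ a ∈ 𝒜, ‖∑ i, ZMod.stdAddChar ((s * (a * N i) : ℤ) : ZMod q)‖) ^ 2 := by
            gcongr
            exact norm_sum_le _ _
        _ ≤ 𝒜.card * ∑ a ∈ 𝒜, ‖∑ i, ZMod.stdAddChar ((s * (a * N i) : ℤ) : ZMod q)‖ ^ 2 :=
            sq_sum_le_card_mul_sum_sq
        _ = _ := by simp only [hg, mul_assoc]
    refine (Finset.sum_le_sum hCS).trans ?_
    rw [← Finset.mul_sum]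
    gcongr
    rw [← Finset.sum_product' (f := fun s (a : ℕ) => g (s * a))]
    have hmaps : ∀ x ∈ I ×ˢ 𝒜, x.1 * (x.2 : ℤ) ∈ M := by
      rintro ⟨s, a⟩ hx
      rw [Finset.mem_product, hI, Finset.mem_erase, Finset.mem_Icc] at hx
      rw [hM, Finset.mem_Icc, ← abs_le, abs_mul, Nat.abs_cast]
      have h1 : |s| ≤ T := abs_le.mpr hx.1.2
      have h2 : (a : ℤ) ≤ A := by exact_mod_cast (h𝒜 a hx.2).2
      push_cast
      gcongr
    have hbound : ∀ m ∈ M, 6 * (h * |m|) ≤ q := by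
      intro m hm
      rw [hM, Finset.mem_Icc, ← abs_le] at hm
      have h1 : (12 * (T * (A * h)) : ℤ) ≤ q := by exact_mod_cast hT
      calc (6 * (h * |m|) : ℤ) ≤ 6 * (h * (T * A : ℕ)) := by gcongr
        _ ≤ 12 * (T * (A * h)) := by
          push_cast
          have : (0 : ℤ) ≤ T * (A * h) := by positivity
          nlinarith
        _ ≤ q := h1
    rw [← Finset.sum_fiberwise_of_maps_to hmaps]
    calc _ ≤ ∑ m ∈ M, Nat.log 2 q * g m := by
          refine Finset.sum_le_sum fun m hm => ?_
          rw [Finset.sum_congr rfl (g := fun _ => g m) fun x hx => by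
            rw [(Finset.mem_filter.mp hx).2], Finset.sum_const, nsmul_eq_mul]
          refine mul_le_mul_of_nonneg_right ?_ (hg0 m)
          rcases eq_or_ne m 0 with rfl | hm0
          · rw [Finset.card_eq_zero.mpr]
            · simp
            · refine Finset.filter_eq_empty_iff.mpr ?_
              rintro ⟨s, a⟩ hx
              rw [Finset.mem_product, hI, Finset.mem_erase] at hx
              have := (h𝒜 a hx.2).1.ne_zero
              simp [hx.1.1, this]
          · have h1 : m.natAbs ≤ q := by
              have h2 := hbound m hm
              have h3 : (1 : ℤ) ≤ h := by exact_mod_cast hh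
              have : |m| ≤ q := by nlinarith [abs_nonneg m]
              rw [Int.abs_eq_natAbs] at this
              exact_mod_cast this
            refine le_trans ?_ (Nat.cast_le.mpr (card_primeFactors_le_log (by omega) h1))
            refine Nat.cast_le.mpr (Finset.card_le_card_of_injOn (fun x => x.2) ?_ ?_)
            · rintro ⟨s, a⟩ hx
              rw [Finset.mem_coe, Finset.mem_filter, Finset.mem_product] at hx
              rw [Finset.mem_coe, Nat.mem_primeFactors]
              refine ⟨(h𝒜 a hx.1.2).1, ?_, by omega⟩
              rw [← Int.natCast_dvd]
              exact ⟨s, by rw [← hx.2]; ring⟩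
            · rintro ⟨s, a⟩ hx ⟨s', a'⟩ hx' (rfl : a = a')
              rw [Finset.mem_coe, Finset.mem_filter, Finset.mem_product] at hx hx'
              have := (h𝒜 a hx.1.2).1.ne_zero
              have h2 : s * (a : ℤ) = s' * a := hx.2.trans hx'.2.symm
              rw [mul_right_cancel₀ (by exact_mod_cast this) h2]
      _ = Nat.log 2 q * ∑ m ∈ M, g m := by rw [Finset.mul_sum]
      _ ≤ _ := by
          gcongr
          exact hF.sum_norm_sq_le hh M hbound

open Classical in
theorem IntervalFamily.sum_exists_le [NeZero q] (hF : IntervalFamily q h N L) (hh : 0 < h)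
    {A T : ℕ} (hT0 : 0 < T) (hT : 12 * (T * (A * h)) ≤ q) {𝒜 : Finset ℕ}
    (h𝒜 : ∀ a ∈ 𝒜, a.Prime ∧ a ≤ A) :
    ∑ a ∈ 𝒜, ∑ a' ∈ 𝒜, ∑ i, ∑ j, (if ∃ w : ℤ, |w| ≤ 2 * (A * h) ∧
        ((a' * N i : ℤ) - (a * N j : ℤ) : ZMod q) = w then 1 else 0 : ℝ) ≤
      4 / T * ((𝒜.card : ℝ) ^ 2 * (Fintype.card ι : ℝ) ^ 2 +
        𝒜.card * (Nat.log 2 q * (12 * (q * Fintype.card ι / h)))) := by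
  have hT0' : (0 : ℝ) < T := by exact_mod_cast hT0
  set y : ℕ × ι → ZMod q := fun k => ((k.1 * N k.2 : ℤ) : ZMod q) with hy
  set S := 𝒜 ×ˢ (Finset.univ : Finset ι) with hS
  set F : ℤ → ℝ := fun s => ‖∑ a ∈ 𝒜, ∑ i, ZMod.stdAddChar ((s * (a * N i) : ℤ) : ZMod q)‖ ^ 2
    with hFdef
  have h1 : ∑ a ∈ 𝒜, ∑ a' ∈ 𝒜, ∑ i, ∑ j, (if ∃ w : ℤ, |w| ≤ 2 * (A * h) ∧
        ((a' * N i : ℤ) - (a * N j : ℤ) : ZMod q) = w then 1 else 0 : ℝ) =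
      ∑ k ∈ S, ∑ l ∈ S, (if ∃ w : ℤ, |w| ≤ 2 * (A * h) ∧ y k - y l = w then 1 else 0 : ℝ) := by
    simp only [hS, Finset.sum_product, hy]
    push_cast
    rw [Finset.sum_comm]
    refine Finset.sum_congr rfl fun a _ => ?_
    rw [Finset.sum_comm]
  have h2 : ∀ k l, (T : ℝ) ^ 2 / 4 * (if ∃ w : ℤ, |w| ≤ 2 * (A * h) ∧ y k - y l = w then 1 else 0) ≤
      ‖∑ t ∈ Finset.Ioc 0 T, ZMod.stdAddChar (((t : ℕ) : ZMod q) * (y k - y l))‖ ^ 2 := by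
    intro k l
    split_ifs with hw
    · obtain ⟨w, hw, hkl⟩ := hw
      have h3 : 6 * (T * |w|) ≤ q := by
        have : (12 * (T * (A * h)) : ℤ) ≤ q := by exact_mod_cast hT
        calc (6 * (T * |w|) : ℤ) ≤ 6 * (T * (2 * (A * h))) := by gcongr
          _ = 12 * (T * (A * h)) := by ring
          _ ≤ q := this
      have h4 := half_le_norm_sum_stdAddChar h3
      rw [hkl]
      push_cast at h4
      calc (T : ℝ) ^ 2 / 4 * 1 = (T / 2 : ℝ) ^ 2 := by ring
        _ ≤ _ := by gcongr
    · rw [mul_zero]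
      positivity
  have h3 : (T : ℝ) ^ 2 / 4 *
      ∑ k ∈ S, ∑ l ∈ S, (if ∃ w : ℤ, |w| ≤ 2 * (A * h) ∧ y k - y l = w then 1 else 0 : ℝ) ≤
      T * ∑ s ∈ Finset.Icc (-(T : ℤ)) T, F s := by
    refine le_trans ?_ (sum_sum_sub_le T F fun s => by positivity)
    rw [Finset.mul_sum]
    calc _ ≤ ∑ k ∈ S, ∑ l ∈ S,
          ‖∑ t ∈ Finset.Ioc 0 T, ZMod.stdAddChar (((t : ℕ) : ZMod q) * (y k - y l))‖ ^ 2 := by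
          refine Finset.sum_le_sum fun k _ => ?_
          rw [Finset.mul_sum]
          exact Finset.sum_le_sum fun l _ => h2 k l
      _ = _ := by
          rw [sum_norm_sq_addChar_symm]
          refine Finset.sum_congr rfl fun u _ => Finset.sum_congr rfl fun v _ => ?_
          simp only [hFdef, hS, Finset.sum_product, hy]
          push_cast
          rfl
  rw [h1]
  have h4 := hF.sum_norm_sq_mul_le hh hT h𝒜
  calc _ = 4 / (T : ℝ) ^ 2 * ((T : ℝ) ^ 2 / 4 *
      ∑ k ∈ S, ∑ l ∈ S, (if ∃ w : ℤ, |w| ≤ 2 * (A * h) ∧ y k - y l = w then 1 else 0 : ℝ)) := by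
        field_simp
    _ ≤ 4 / (T : ℝ) ^ 2 * (T * ∑ s ∈ Finset.Icc (-(T : ℤ)) T, F s) := by gcongr
    _ = 4 / T * ∑ s ∈ Finset.Icc (-(T : ℤ)) T, F s := by field_simp
    _ ≤ _ := by gcongr

theorem IntervalFamily.energy_singleton_one_le [NeZero q] (hF : IntervalFamily q h N L) :
    energy q N L {1} ≤ 6 * (Fintype.card ι * h) := by
  rw [energy, Finset.sum_singleton, Finset.sum_singleton]
  exact hF.sum_diagonal_le (Nat.coprime_one_left q)

/-- The energy bound for sets of primes. -/
theorem IntervalFamily.energy_le [NeZero q] (hF : IntervalFamily q h N L) (hh : 0 < h)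
    {A : ℕ} (hA0 : 0 < A) (hA : 12 * (A * h) ≤ q) {𝒜 : Finset ℕ}
    (h𝒜 : ∀ a ∈ 𝒜, a.Prime ∧ a ≤ A ∧ a.Coprime q) {K : ℝ} (hK : 1 ≤ K)
    (hAK : ∀ a ∈ 𝒜, (A : ℝ) ≤ K * a) (hAh : A ≤ h) (hP : 𝒜.card * (Fintype.card ι * h) ≤ 2 * q) :
    (energy q N L 𝒜 : ℝ) ≤
      5000 * (K * (1 + Nat.log 2 q)) * (𝒜.card * (Fintype.card ι * h)) := by
  classical
  have hA0' : (0 : ℝ) < A := by exact_mod_cast hA0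
  have hh' : (0 : ℝ) < h := by exact_mod_cast hh
  have hq' : (0 : ℝ) < q := by exact_mod_cast NeZero.pos q
  have hAh' : (A : ℝ) ≤ h := by exact_mod_cast hAh
  set R : ℝ := 3 * h * K / A with hR
  have hR0 : 0 ≤ R := by positivity
  set T := q / (12 * (A * h)) with hT
  have hT0 : 0 < T := Nat.div_pos hA (by positivity)
  have hTle : 12 * (T * (A * h)) ≤ q := by
    rw [show 12 * (T * (A * h)) = T * (12 * (A * h)) by ring]
    exact Nat.div_mul_le_self _ _
  have hTge : (q : ℝ) ≤ 24 * (A * h) * T := by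
    have h1 : q < (T + 1) * (12 * (A * h)) := by
      rw [mul_comm]
      exact Nat.lt_mul_div_succ q (by positivity)
    have h2 : q ≤ 24 * (A * h) * T := by nlinarith
    exact_mod_cast h2
  set X : ℝ := 𝒜.card * (Fintype.card ι * h) with hX
  have hX0 : 0 ≤ X := by positivity
  have hXq : X ≤ 2 * q := by
    rw [hX]
    exact_mod_cast hP
  have hRa : ∀ a ∈ 𝒜, 2 * (h : ℝ) / a + 1 ≤ R := by
    intro a ha
    have ha0 : (0 : ℝ) < a := by exact_mod_cast (h𝒜 a ha).1.pos
    have h1 := hAK a ha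
    rw [hR, div_add_one ha0.ne', div_le_div_iff₀ ha0 hA0']
    have haA : (a : ℝ) ≤ A := by exact_mod_cast (h𝒜 a ha).2.1
    nlinarith [mul_le_mul_of_nonneg_left h1 hh'.le, mul_le_mul_of_nonneg_left h1 ha0.le,
      mul_le_mul_of_nonneg_left (haA.trans hAh') (mul_pos (zero_lt_one.trans_le hK) ha0).le]
  have hpair : ∀ a ∈ 𝒜, ∀ a' ∈ 𝒜,
      ((∑ i, ∑ j, ((Finset.Ioc (N i) (N i + L i) ×ˢ Finset.Ioc (N j) (N j + L j)).filter
      fun x => ((a' * x.1 : ℕ) : ZMod q) = ((a * x.2 : ℕ) : ZMod q)).card : ℕ) : ℝ) ≤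
      (if a = a' then 6 * (Fintype.card ι * h : ℝ) else 0) +
      R * ∑ i, ∑ j, (if ∃ w : ℤ, |w| ≤ 2 * (A * h) ∧
        ((a' * N i : ℤ) - (a * N j : ℤ) : ZMod q) = w then 1 else 0 : ℝ) := by
    intro a ha a' ha'
    obtain ⟨h1, h2, h3⟩ := h𝒜 a ha
    obtain ⟨h1', h2', h3'⟩ := h𝒜 a' ha'
    split_ifs with h
    · subst h
      refine le_trans ?_ (le_add_of_nonneg_right (by positivity))
      exact_mod_cast hF.sum_diagonal_le h3
    · rw [zero_add, Finset.mul_sum]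
      push_cast
      refine Finset.sum_le_sum fun i _ => ?_
      rw [Finset.mul_sum]
      refine Finset.sum_le_sum fun j _ => ?_
      have := hF.card_off_diagonal_le (A := A) (by nlinarith [Nat.mul_pos hA0 hh]) h1.pos h2 h2'
        ((Nat.coprime_primes h1 h1').mpr h) (hRa a ha) i j
      simpa using this
  have hQ := hF.sum_exists_le hh hT0 hTle (fun a ha => ⟨(h𝒜 a ha).1, (h𝒜 a ha).2.1⟩)
  have hsum : (energy q N L 𝒜 : ℝ) ≤ 6 * X + R * (4 / T * ((𝒜.card : ℝ) ^ 2 *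
      (Fintype.card ι : ℝ) ^ 2 + 𝒜.card * (Nat.log 2 q * (12 * (q * Fintype.card ι / h))))) := by
    calc (energy q N L 𝒜 : ℝ) = ∑ a ∈ 𝒜, ∑ a' ∈ 𝒜,
          ((∑ i, ∑ j, ((Finset.Ioc (N i) (N i + L i) ×ˢ Finset.Ioc (N j) (N j + L j)).filter
          fun x => ((a' * x.1 : ℕ) : ZMod q) = ((a * x.2 : ℕ) : ZMod q)).card : ℕ) : ℝ) := by
          rw [energy]
          push_cast
          rfl
      _ ≤ ∑ a ∈ 𝒜, ∑ a' ∈ 𝒜, ((if a = a' then 6 * (Fintype.card ι * h : ℝ) else 0) +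
          R * ∑ i, ∑ j, (if ∃ w : ℤ, |w| ≤ 2 * (A * h) ∧
          ((a' * N i : ℤ) - (a * N j : ℤ) : ZMod q) = w then 1 else 0 : ℝ)) :=
          Finset.sum_le_sum fun a ha => Finset.sum_le_sum fun a' ha' => hpair a ha a' ha'
      _ = 6 * X + R * ∑ a ∈ 𝒜, ∑ a' ∈ 𝒜, ∑ i, ∑ j, (if ∃ w : ℤ, |w| ≤ 2 * (A * h) ∧
          ((a' * N i : ℤ) - (a * N j : ℤ) : ZMod q) = w then 1 else 0 : ℝ) := by
          simp only [Finset.sum_add_distrib, Finset.mul_sum]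
          congr 1
          rw [Finset.sum_congr rfl fun a ha => by rw [Finset.sum_ite_eq, if_pos ha],
            Finset.sum_const, nsmul_eq_mul, hX]
          ring
      _ ≤ _ := by gcongr
  have hT0' : (0 : ℝ) < T := by exact_mod_cast hT0
  have hTinv : 4 / (T : ℝ) ≤ 96 * (A * h) / q := by
    rw [div_le_div_iff₀ hT0' hq']
    linarith
  set lam : ℝ := (Nat.log 2 q : ℝ) with hlam
  have hlam0 : 0 ≤ lam := by positivity
  refine hsum.trans ?_
  calc _ ≤ 6 * X + R * (96 * (A * h) / q * ((𝒜.card : ℝ) ^ 2 *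
      (Fintype.card ι : ℝ) ^ 2 + 𝒜.card * (lam * (12 * (q * Fintype.card ι / h))))) := by gcongr
    _ = 6 * X + 288 * K * (X * (X / q)) + 3456 * K * lam * X := by
        rw [hR, hX]
        field_simp
        ring
    _ ≤ 6 * (X * K) + 288 * K * (X * 2) + 3456 * K * lam * X := by
        have h1 : X ≤ X * K := le_mul_of_one_le_right (by positivity) hK
        have h2 : X / q ≤ 2 := by
          rw [div_le_iff₀ hq']
          exact hXq
        gcongr
    _ ≤ _ := by
        have h1 : 0 ≤ K * X := by positivity
        have h2 : 0 ≤ K * X * lam := by positivity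
        nlinarith

end Energy

/-- Hölder's inequality for a sum pulled back along a map, in terms of the number of collisions. -/
theorem pow_sum_comp_le {α β : Type*} [Fintype β] [DecidableEq β] (X : Finset α) (φ : α → β)
    {G : β → ℝ} (hG : ∀ y, 0 ≤ G y) (s : ℕ) :
    (∑ x ∈ X, G (φ x)) ^ (2 * (s + 1)) ≤
      (X.card : ℝ) ^ (2 * s) * (∑ x ∈ X, (X.filter fun y => φ y = φ x).card : ℕ) *
        ∑ y, G y ^ (2 * (s + 1)) := by
  set ν : β → ℝ := fun y => (X.filter fun x => φ x = y).card with hν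
  have h1 : (∑ x ∈ X, G (φ x)) ^ (s + 1) ≤ (X.card : ℝ) ^ s * ∑ x ∈ X, G (φ x) ^ (s + 1) :=
    pow_sum_le_card_mul_sum_pow (fun x _ => hG _) s
  have h2 : ∑ x ∈ X, G (φ x) ^ (s + 1) = ∑ y, ν y * G y ^ (s + 1) := by
    rw [← Finset.sum_fiberwise X φ]
    refine Finset.sum_congr rfl fun y _ => ?_
    rw [Finset.sum_congr rfl (g := fun _ => G y ^ (s + 1)) fun x hx => by
      rw [(Finset.mem_filter.mp hx).2], Finset.sum_const, nsmul_eq_mul]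
  have h3 : ((∑ x ∈ X, (X.filter fun y => φ y = φ x).card : ℕ) : ℝ) = ∑ y, ν y ^ 2 := by
    rw [Nat.cast_sum, ← Finset.sum_fiberwise X φ]
    refine Finset.sum_congr rfl fun y _ => ?_
    rw [Finset.sum_congr rfl (g := fun _ => ν y) fun x hx => by
      rw [(Finset.mem_filter.mp hx).2], Finset.sum_const, nsmul_eq_mul, sq]
  calc (∑ x ∈ X, G (φ x)) ^ (2 * (s + 1)) = ((∑ x ∈ X, G (φ x)) ^ (s + 1)) ^ 2 := by ring
    _ ≤ ((X.card : ℝ) ^ s * ∑ y, ν y * G y ^ (s + 1)) ^ 2 := by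
        rw [← h2]
        have : 0 ≤ ∑ x ∈ X, G (φ x) := Finset.sum_nonneg fun x _ => hG _
        gcongr
    _ = (X.card : ℝ) ^ (2 * s) * (∑ y, ν y * G y ^ (s + 1)) ^ 2 := by ring
    _ ≤ (X.card : ℝ) ^ (2 * s) * ((∑ y, ν y ^ 2) * ∑ y, (G y ^ (s + 1)) ^ 2) := by
        gcongr
        exact Finset.sum_mul_sq_le_sq_mul_sq _ _ _
    _ = _ := by
        rw [h3, mul_assoc]
        simp only [← pow_mul']

theorem sum_Ioc_eq_shift {M : Type*} [AddCommGroup M] (f : ℕ → M) (N L m : ℕ) :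
    ∑ n ∈ Finset.Ioc N (N + L), f n = ∑ n ∈ Finset.Ioc N (N + L), f (n + m) +
      ∑ n ∈ Finset.Ioc N (N + m), f n - ∑ n ∈ Finset.Ioc (N + L) (N + L + m), f n := by
  have h1 : ∑ n ∈ Finset.Ioc N (N + L), f (n + m) =
      ∑ n ∈ Finset.Ioc (N + m) (N + L + m), f n := by
    rw [← Finset.map_add_right_Ioc, Finset.sum_map]
    rfl
  rw [h1, eq_sub_iff_add_eq, add_comm (∑ n ∈ Finset.Ioc (N + m) (N + L + m), f n),
    Finset.sum_Ioc_consecutive f (by omega) (by omega),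
    Finset.sum_Ioc_consecutive f (by omega) (by omega)]

section Family

variable {ι : Type*} [Fintype ι] {q : ℕ} {N L : ι → ℕ}

/-- The number of collisions of the quotients `n / a` is the energy. -/
theorem sum_card_collisions [NeZero q] {A : Finset ℕ} (hA : ∀ a ∈ A, a.Coprime q) :
    ∑ x ∈ A ×ˢ points N L, ((A ×ˢ points N L).filter fun y =>
      (y.2.2 : ZMod q) * (y.1 : ZMod q)⁻¹ = (x.2.2 : ZMod q) * (x.1 : ZMod q)⁻¹).card =
      energy q N L A := by
  classical
  have h1 : ∀ x ∈ A ×ˢ points N L, ((A ×ˢ points N L).filter fun y =>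
      (y.2.2 : ZMod q) * (y.1 : ZMod q)⁻¹ = (x.2.2 : ZMod q) * (x.1 : ZMod q)⁻¹).card =
      ∑ y ∈ A ×ˢ points N L,
        if ((y.1 * x.2.2 : ℕ) : ZMod q) = ((x.1 * y.2.2 : ℕ) : ZMod q) then 1 else 0 := by
    intro x hx
    rw [Finset.card_filter]
    refine Finset.sum_congr rfl fun y hy => if_congr ?_ rfl rfl
    have hu := ZMod.coe_mul_inv_eq_one x.1 (hA _ (Finset.mem_product.mp hx).1)
    have hv := ZMod.coe_mul_inv_eq_one y.1 (hA _ (Finset.mem_product.mp hy).1)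
    push_cast
    constructor
    · intro h
      linear_combination (-(x.1 : ZMod q) * y.1) * h + (y.2.2 : ZMod q) * x.1 * hv -
        (x.2.2 : ZMod q) * y.1 * hu
    · intro h
      linear_combination (-(x.1 : ZMod q)⁻¹ * (y.1 : ZMod q)⁻¹) * h +
        (x.2.2 : ZMod q) * (x.1 : ZMod q)⁻¹ * hv - (y.2.2 : ZMod q) * (y.1 : ZMod q)⁻¹ * hu
  rw [Finset.sum_congr rfl h1, energy, Finset.sum_product]
  simp only [Finset.sum_product]
  refine Finset.sum_congr rfl fun a ha => ?_
  rw [Finset.sum_comm]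
  refine Finset.sum_congr rfl fun a' ha' => ?_
  rw [sum_points (f := fun _ n => ∑ y ∈ points N L,
    if ((a' * n : ℕ) : ZMod q) = ((a * y.2 : ℕ) : ZMod q) then 1 else 0)]
  refine Finset.sum_congr rfl fun i _ => ?_
  rw [Finset.sum_congr rfl fun n _ => sum_points (f := fun _ m =>
    if ((a' * n : ℕ) : ZMod q) = ((a * m : ℕ) : ZMod q) then 1 else 0), Finset.sum_comm]
  refine Finset.sum_congr rfl fun j _ => ?_
  rw [Finset.card_filter, Finset.sum_product]

/-- The sum of a character over a family of intervals. -/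
noncomputable def familySum (χ : DirichletCharacter ℂ q) (N L : ι → ℕ) : ℂ :=
  ∑ i, ∑ n ∈ Finset.Ioc (N i) (N i + L i), χ (n : ZMod q)

theorem familySum_eq_shift (χ : DirichletCharacter ℂ q) (m : ℕ) :
    familySum χ N L = ∑ p ∈ points N L, χ ((p.2 + m : ℕ) : ZMod q) +
      familySum χ N (fun _ => m) - familySum χ (fun i => N i + L i) (fun _ => m) := by
  rw [sum_points (f := fun _ n => χ ((n + m : ℕ) : ZMod q)), familySum, familySum, familySum,
    ← Finset.sum_add_distrib, ← Finset.sum_sub_distrib]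
  exact Finset.sum_congr rfl fun i _ => sum_Ioc_eq_shift (fun n => χ (n : ZMod q)) _ _ _

theorem norm_familySum_mul_le [NeZero q] (χ : DirichletCharacter ℂ q) {A : Finset ℕ}
    (hA : ∀ a ∈ A, a.Coprime q) {B : ℕ} {D : ℝ}
    (hD : ∀ a ∈ A, ∀ b ∈ Finset.Icc 1 B, ‖familySum χ N (fun _ => a * b)‖ ≤ D ∧
      ‖familySum χ (fun i => N i + L i) (fun _ => a * b)‖ ≤ D) :
    A.card * B * ‖familySum χ N L‖ ≤ A.card * B * (2 * D) + ∑ x ∈ A ×ˢ points N L,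
      ‖∑ b ∈ Finset.Icc (1 : ℤ) B, χ ((x.2.2 : ZMod q) * (x.1 : ZMod q)⁻¹ + (b : ZMod q))‖ := by
  have hZ : ∀ y : ZMod q, ∑ b ∈ Finset.Icc (1 : ℤ) B, χ (y + (b : ZMod q)) =
      ∑ b ∈ Finset.Icc 1 B, χ (y + (b : ZMod q)) := by
    intro y
    refine (Finset.sum_nbij' (fun b : ℕ => (b : ℤ)) (fun b : ℤ => b.toNat) ?_ ?_ ?_ ?_ ?_).symm
    · intro b hb
      simp at hb ⊢
      omega
    · intro b hb
      simp at hb ⊢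
      omega
    · intro b _
      simp
    · intro b hb
      simp at hb ⊢
      omega
    · intro b _
      simp
  have h1 : (A.card : ℂ) * B * familySum χ N L = ∑ a ∈ A, ∑ b ∈ Finset.Icc 1 B,
      (familySum χ N (fun _ => a * b) - familySum χ (fun i => N i + L i) (fun _ => a * b)) +
      ∑ x ∈ A ×ˢ points N L, χ (x.1 : ZMod q) *
        ∑ b ∈ Finset.Icc (1 : ℤ) B, χ ((x.2.2 : ZMod q) * (x.1 : ZMod q)⁻¹ + (b : ZMod q)) := by
    rw [Finset.sum_product, ← Finset.sum_add_distrib]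
    have : (A.card : ℂ) * B * familySum χ N L =
        ∑ a ∈ A, ∑ b ∈ Finset.Icc 1 B, familySum χ N L := by
      simp [mul_assoc]
    rw [this]
    refine Finset.sum_congr rfl fun a ha => ?_
    have hu := ZMod.coe_mul_inv_eq_one a (hA a ha)
    simp only [hZ]
    rw [Finset.sum_congr rfl fun p _ => Finset.mul_sum .., Finset.sum_comm,
      ← Finset.sum_add_distrib]
    refine Finset.sum_congr rfl fun b _ => ?_
    rw [familySum_eq_shift χ (a * b), add_sub_assoc, add_comm]
    congr 1
    refine Finset.sum_congr rfl fun p _ => ?_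
    rw [← map_mul]
    congr 1
    push_cast
    linear_combination (-(p.2 : ZMod q)) * hu
  have h2 : (A.card : ℝ) * B * ‖familySum χ N L‖ = ‖(A.card : ℂ) * B * familySum χ N L‖ := by
    simp
  rw [h2, h1]
  refine (norm_add_le _ _).trans (add_le_add ?_ ?_)
  · refine (norm_sum_le _ _).trans ?_
    have h3 : ∀ a ∈ A, ‖∑ b ∈ Finset.Icc 1 B, (familySum χ N (fun _ => a * b) -
        familySum χ (fun i => N i + L i) (fun _ => a * b))‖ ≤ B * (2 * D) := by
      intro a ha
      refine (norm_sum_le_of_le _ (n := fun _ => 2 * D) fun b hb => ?_).trans_eq (by simp)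
      refine (norm_sub_le _ _).trans ?_
      have := hD a ha b hb
      linarith [this.1, this.2]
    refine (Finset.sum_le_sum h3).trans ?_
    simp [mul_assoc]
  · refine norm_sum_le_of_le _ fun x _ => ?_
    rw [norm_mul]
    exact mul_le_of_le_one_left (norm_nonneg _) (norm_mulChar_le_one χ _)

/-- One step of Burgess's method. -/
theorem norm_familySum_le_of_moment [NeZero q] (χ : DirichletCharacter ℂ q) {A : Finset ℕ}
    (hA0 : A.Nonempty) (hA : ∀ a ∈ A, a.Coprime q) {B : ℕ} (hB : 0 < B) {D D' E M Y : ℝ}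
    (hD : ∀ a ∈ A, ∀ b ∈ Finset.Icc 1 B, ‖familySum χ N (fun _ => a * b)‖ ≤ D ∧
      ‖familySum χ (fun i => N i + L i) (fun _ => a * b)‖ ≤ D) (s : ℕ)
    (hE : energy q N L A ≤ E) (hY : (points N L).card ≤ Y)
    (hM : ∑ x : ZMod q, ‖∑ b ∈ Finset.Icc (1 : ℤ) B, χ (x + (b : ZMod q))‖ ^ (2 * (s + 1)) ≤ M)
    (hD0 : 0 ≤ D')
    (hD' : (A.card * Y) ^ (2 * s) * E * M ≤ (A.card * B * D') ^ (2 * (s + 1))) :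
    ‖familySum χ N L‖ ≤ 2 * D + D' := by
  have hA0' : (0 : ℝ) < A.card := by exact_mod_cast hA0.card_pos
  have hB' : (0 : ℝ) < B := by exact_mod_cast hB
  have hE0 : 0 ≤ E := le_trans (by positivity) hE
  have hY0 : 0 ≤ Y := le_trans (by positivity) hY
  have h1 := norm_familySum_mul_le χ hA hD
  set G : ZMod q → ℝ := fun x => ‖∑ b ∈ Finset.Icc (1 : ℤ) B, χ (x + (b : ZMod q))‖ with hG
  have h2 := pow_sum_comp_le (A ×ˢ points N L)
    (fun x => (x.2.2 : ZMod q) * (x.1 : ZMod q)⁻¹) (G := G) (fun y => norm_nonneg _) s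
  rw [sum_card_collisions hA, Finset.card_product, Nat.cast_mul] at h2
  have h3 : ∑ x ∈ A ×ˢ points N L, G ((x.2.2 : ZMod q) * (x.1 : ZMod q)⁻¹) ≤
      A.card * B * D' := by
    refine le_of_pow_le_pow_left₀ (by omega) (by positivity) (h2.trans (le_trans ?_ hD'))
    gcongr
  have h4 : A.card * B * ‖familySum χ N L‖ ≤ A.card * B * (2 * D + D') := by linarith
  exact le_of_mul_le_mul_left h4 (by positivity)

end Family

/-- There are many primes up to `A` which are not too small and do not divide `q`. -/
theorem exists_primes {q A K : ℕ} (hq : 0 < q) (hAq : A ≤ q) (hK : 100 * (1 + Nat.log 2 q) ≤ K)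
    (hKA : K * K ≤ A) :
    ∃ 𝒜 : Finset ℕ, (∀ a ∈ 𝒜, a.Prime ∧ a ≤ A ∧ a.Coprime q ∧ A ≤ K * a) ∧ A ≤ K * 𝒜.card := by
  set 𝒜 : Finset ℕ := (Nat.primesLE A).filter fun p => p.Coprime q ∧ A ≤ K * p with h𝒜
  have hK0 : 0 < K := by omega
  have hA0 : 0 < A := lt_of_lt_of_le (by positivity) hKA
  refine ⟨𝒜, fun a ha => ?_, ?_⟩
  · rw [h𝒜, Finset.mem_filter] at ha
    exact ⟨Nat.prime_of_mem_primesLE ha.1, Nat.le_of_mem_primesLE ha.1, ha.2⟩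
  have h1 : Nat.primesLE A ⊆ 𝒜 ∪ (q.primeFactors ∪ Finset.Icc 1 (A / K)) := by
    intro p hp
    have hpp := Nat.prime_of_mem_primesLE hp
    by_cases h2 : p ∣ q
    · exact Finset.mem_union_right _ (Finset.mem_union_left _
        (Nat.mem_primeFactors.mpr ⟨hpp, h2, hq.ne'⟩))
    by_cases h3 : A ≤ K * p
    · exact Finset.mem_union_left _
        (Finset.mem_filter.mpr ⟨hp, (Nat.Prime.coprime_iff_not_dvd hpp).mpr h2, h3⟩)
    · refine Finset.mem_union_right _ (Finset.mem_union_right _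
        (Finset.mem_Icc.mpr ⟨hpp.pos, ?_⟩))
      rw [Nat.le_div_iff_mul_le hK0, mul_comm]
      omega
  have h2 : (Nat.primesLE A).card ≤ 𝒜.card + (Nat.log 2 q + A / K) := by
    refine (Finset.card_le_card h1).trans ((Finset.card_union_le _ _).trans ?_)
    refine Nat.add_le_add_left ((Finset.card_union_le _ _).trans ?_) _
    have := card_primeFactors_le_log hq.ne' le_rfl
    simpa using this
  have h3 : (A : ℝ) ≤ 2 * ((Nat.primesLE A).card * (1 + Nat.log 2 q : ℕ)) := by
    have hlog : Real.log q ≤ (1 + Nat.log 2 q : ℕ) * Real.log 2 := by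
      rw [← Real.log_pow]
      refine Real.log_le_log (by exact_mod_cast hq) ?_
      have := Nat.lt_pow_succ_log_self one_lt_two q
      rw [add_comm]
      exact_mod_cast this.le
    have hlogA : Real.log A ≤ Real.log q :=
      Real.log_le_log (by exact_mod_cast hA0) (by exact_mod_cast hAq)
    have hlogA' : Real.log (A + 1) ≤ Real.log 2 + Real.log q := by
      rw [← Real.log_mul (by norm_num) (by positivity)]
      refine Real.log_le_log (by positivity) ?_
      have : A + 1 ≤ 2 * q := by omega
      exact_mod_cast this
    have h5 := (Chebyshev.psi_ge A).trans (Chebyshev.psi_le_primeCounting_mul_log A)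
    rw [← Nat.primesLE_card_eq_primeCounting] at h5
    have h6 : (2 * (1 + (1 + Nat.log 2 q : ℕ)) : ℝ) ≤ A := by
      have : 2 * (1 + (1 + Nat.log 2 q)) ≤ A := by nlinarith
      exact_mod_cast this
    have hl2 : 0 < Real.log 2 := Real.log_pos one_lt_two
    have h7 : ((Nat.primesLE A).card : ℝ) * Real.log A ≤
        (Nat.primesLE A).card * ((1 + Nat.log 2 q : ℕ) * Real.log 2) := by
      gcongr
      exact hlogA.trans hlog
    refine le_of_mul_le_mul_right ?_ hl2
    nlinarith
  have h4 : A ≤ 2 * ((Nat.primesLE A).card * (1 + Nat.log 2 q)) := by exact_mod_cast h3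
  have h5 : K * (A / K) ≤ A := Nat.mul_div_le A K
  have h6 : 50 * A ≤ K * (Nat.primesLE A).card := by nlinarith
  nlinarith

/-- A real `2(s+1)`-th root of the main term of Burgess's bound: here `θ` is the `2(s+1)`-th root
of the modulus. -/
structure IsTarget (s : ℕ) (θ J l T : ℝ) : Prop where
  nonneg : 0 ≤ T
  pow_eq : T ^ (2 * (s + 1)) = J ^ (2 * s + 1) * l ^ (2 * s) * θ ^ (s + 2)

theorem IsTarget.le_pow {s : ℕ} {θ J l T M K c : ℝ} (hT : IsTarget s θ J l T) (hM : 1 ≤ M)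
    (hθ : 0 ≤ θ) (hJ : 0 ≤ J) (hl : 0 ≤ l) (hK : 1 ≤ K)
    (hc : c ≤ (200 * K ^ 5) ^ (2 * (s + 1))) :
    c * (M * (J ^ (2 * s + 1) * l ^ (2 * s) * θ ^ (s + 2))) ≤
      (200 * M * K ^ 5 * T) ^ (2 * (s + 1)) := by
  have h1 : M ≤ M ^ (2 * (s + 1)) := le_self_pow₀ hM (by omega)
  calc _ ≤ (200 * K ^ 5) ^ (2 * (s + 1)) *
      (M ^ (2 * (s + 1)) * (J ^ (2 * s + 1) * l ^ (2 * s) * θ ^ (s + 2))) := by gcongr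
    _ = _ := by
        rw [← hT.pow_eq]
        ring

theorem const_le_pow {s n k : ℕ} {K c b : ℝ} (hK : 1 ≤ K) (hc : c ≤ 40000) (hb0 : 0 ≤ b)
    (hb : b ≤ 40000) (hk : k + n * s ≤ 10 * (s + 1)) :
    c * b ^ s * K ^ (k + n * s) ≤ (200 * K ^ 5) ^ (2 * (s + 1)) := by
  calc c * b ^ s * K ^ (k + n * s) ≤ 40000 * 40000 ^ s * K ^ (10 * (s + 1)) := by gcongr
    _ = (200 * K ^ 5) ^ (2 * (s + 1)) := by
        have : (40000 : ℝ) ^ s = 200 ^ (2 * s) := by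
          rw [pow_mul]
          norm_num
        rw [this]
        ring

theorem short_inequality {s : ℕ} {θ J l T M K h B q : ℝ} (hT : IsTarget s θ J l T) (hM : 1 ≤ M)
    (hθ : 0 ≤ θ) (hJ : 0 ≤ J) (hK : 1 ≤ K) (hB : 0 ≤ B) (hh : 0 ≤ h) (hhl : h ≤ l) (hθl : θ ≤ l)
    (hhB : h ≤ 2 * K * B) (hBh : B ≤ K ^ 2 * θ) (hq : q = θ ^ (2 * (s + 1))) :
    (1 * (2 * (J * h))) ^ (2 * s) * (6 * (J * h)) *
      (M * (q * B ^ (s + 1) + θ ^ (s + 1) * B ^ (2 * (s + 1)))) ≤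
      (1 * B * (200 * M * K ^ 5 * T)) ^ (2 * (s + 1)) := by
  have hl : 0 ≤ l := hθ.trans hθl
  have h1 : θ ^ (s + 1) * B ^ (2 * (s + 1)) ≤ K ^ (2 * (s + 1)) * (q * B ^ (s + 1)) := by
    calc θ ^ (s + 1) * B ^ (2 * (s + 1)) = θ ^ (s + 1) * B ^ (s + 1) * B ^ (s + 1) := by ring
      _ ≤ θ ^ (s + 1) * (K ^ 2 * θ) ^ (s + 1) * B ^ (s + 1) := by gcongr
      _ = _ := by
          rw [hq]
          ring
  have hK1 : 1 ≤ K ^ (2 * (s + 1)) := one_le_pow₀ hK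
  have hqB : 0 ≤ q * B ^ (s + 1) := by
    rw [hq]
    positivity
  have h2 : q * B ^ (s + 1) + θ ^ (s + 1) * B ^ (2 * (s + 1)) ≤
      2 * K ^ (2 * (s + 1)) * (q * B ^ (s + 1)) := by nlinarith
  calc _ ≤ (1 * (2 * (J * h))) ^ (2 * s) * (6 * (J * h)) *
      (M * (2 * K ^ (2 * (s + 1)) * (q * B ^ (s + 1)))) := by gcongr
    _ = 12 * 4 ^ s * K ^ (2 * (s + 1)) * M * J ^ (2 * s + 1) * θ ^ (s + 2) * B ^ (s + 1) *
        (h ^ (s + 1) * (h ^ s * θ ^ s)) := by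
        have : (4 : ℝ) ^ s = 2 ^ (2 * s) := by
          rw [pow_mul]
          norm_num
        rw [hq, this]
        ring
    _ ≤ 12 * 4 ^ s * K ^ (2 * (s + 1)) * M * J ^ (2 * s + 1) * θ ^ (s + 2) * B ^ (s + 1) *
        ((2 * K * B) ^ (s + 1) * (l ^ s * l ^ s)) := by gcongr
    _ = B ^ (2 * (s + 1)) * (24 * 8 ^ s * K ^ (3 + 3 * s) *
        (M * (J ^ (2 * s + 1) * l ^ (2 * s) * θ ^ (s + 2)))) := by
        have : (8 : ℝ) ^ s = 4 ^ s * 2 ^ s := by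
          rw [← mul_pow]
          norm_num
        rw [this]
        ring
    _ ≤ B ^ (2 * (s + 1)) * (200 * M * K ^ 5 * T) ^ (2 * (s + 1)) := by
        refine mul_le_mul_of_nonneg_left (hT.le_pow hM hθ hJ hl hK ?_) (by positivity)
        exact const_le_pow hK (by norm_num) (by norm_num) (by norm_num) (by omega)
    _ = _ := by ring

theorem dense_inequality {s : ℕ} {θ J l T M K h B q : ℝ} (hT : IsTarget s θ J l T) (hM : 1 ≤ M)
    (hθ : 0 ≤ θ) (hJ : 0 ≤ J) (hK : 1 ≤ K) (hB : 0 ≤ B) (hl : 0 ≤ l)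
    (hhB : h ≤ 2 * K * B) (hJl : θ ^ (2 * s + 3) ≤ J * l ^ 2) (hq : q = θ ^ (2 * (s + 1))) :
    (1 * (2 * (J * h))) ^ (2 * 0) * (6 * (J * h)) * (q * B) ≤
      (1 * B * (200 * M * K ^ 5 * T)) ^ (2 * (0 + 1)) := by
  have hq0 : 0 ≤ q := by
    rw [hq]
    positivity
  have h1 : 12 * K * J * q ≤ (200 * M * K ^ 5 * T) ^ 2 := by
    refine le_of_pow_le_pow_left₀ s.succ_ne_zero (by positivity) ?_
    calc (12 * K * J * q) ^ (s + 1) =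
        12 * 12 ^ s * K ^ (1 + 1 * s) * (J ^ (s + 1) * (θ ^ (2 * s + 3)) ^ s * θ ^ (s + 2)) := by
          rw [hq]
          ring
      _ ≤ 12 * 12 ^ s * K ^ (1 + 1 * s) * (J ^ (s + 1) * (J * l ^ 2) ^ s * θ ^ (s + 2)) := by
          gcongr
      _ = 12 * 12 ^ s * K ^ (1 + 1 * s) *
          (1 * (J ^ (2 * s + 1) * l ^ (2 * s) * θ ^ (s + 2))) := by ring
      _ ≤ 12 * 12 ^ s * K ^ (1 + 1 * s) *
          (M * (J ^ (2 * s + 1) * l ^ (2 * s) * θ ^ (s + 2))) := by gcongr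
      _ ≤ (200 * M * K ^ 5 * T) ^ (2 * (s + 1)) := by
          refine hT.le_pow hM hθ hJ hl hK ?_
          exact const_le_pow hK (by norm_num) (by norm_num) (by norm_num) (by omega)
      _ = _ := by rw [pow_mul]
  calc _ = 6 * (J * h) * (q * B) := by ring
    _ ≤ 6 * (J * (2 * K * B)) * (q * B) := by gcongr
    _ = B ^ 2 * (12 * K * J * q) := by ring
    _ ≤ B ^ 2 * (200 * M * K ^ 5 * T) ^ 2 := by gcongr
    _ = _ := by ring

theorem long_inequality {s : ℕ} {θ J l T M K h B q P E : ℝ} (hT : IsTarget s θ J l T) (hM : 1 ≤ M)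
    (hθ : 0 ≤ θ) (hJ : 0 ≤ J) (hK : 1 ≤ K) (hB : 0 ≤ B) (hh : 0 ≤ h) (hhl : h ≤ l) (hP : 0 ≤ P)
    (hθB : θ ≤ 2 * B) (hhP : h ≤ 2 * K ^ 2 * P * θ) (hq : q = θ ^ (2 * (s + 1)))
    (hE : E ≤ 5000 * K ^ 2 * (P * (J * h))) :
    (P * (2 * (J * h))) ^ (2 * s) * E *
      (M * (q * B ^ (s + 1) + θ ^ (s + 1) * B ^ (2 * (s + 1)))) ≤
      (P * B * (200 * M * K ^ 5 * T)) ^ (2 * (s + 1)) := by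
  have hl : 0 ≤ l := hh.trans hhl
  have h1 : q * B ^ (s + 1) ≤ 2 ^ (s + 1) * (θ ^ (s + 1) * B ^ (2 * (s + 1))) := by
    calc q * B ^ (s + 1) = θ ^ (s + 1) * θ ^ (s + 1) * B ^ (s + 1) := by
          rw [hq]
          ring
      _ ≤ θ ^ (s + 1) * (2 * B) ^ (s + 1) * B ^ (s + 1) := by gcongr
      _ = _ := by ring
  have h4 : (2 : ℝ) ^ (s + 1) + 1 ≤ 4 ^ (s + 1) := by
    have : (1 : ℝ) ≤ 2 ^ s := one_le_pow₀ one_le_two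
    rw [show (4 : ℝ) = 2 * 2 by norm_num, mul_pow, pow_succ]
    nlinarith
  have hθB0 : 0 ≤ θ ^ (s + 1) * B ^ (2 * (s + 1)) := by positivity
  have h2 : q * B ^ (s + 1) + θ ^ (s + 1) * B ^ (2 * (s + 1)) ≤
      4 ^ (s + 1) * (θ ^ (s + 1) * B ^ (2 * (s + 1))) := by nlinarith
  have hq0 : 0 ≤ q := by
    rw [hq]
    positivity
  calc _ ≤ (P * (2 * (J * h))) ^ (2 * s) * (5000 * K ^ 2 * (P * (J * h))) *
      (M * (4 ^ (s + 1) * (θ ^ (s + 1) * B ^ (2 * (s + 1))))) := by gcongr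
    _ = 20000 * 16 ^ s * K ^ 2 * M * P ^ (2 * s + 1) * J ^ (2 * s + 1) * θ ^ (s + 1) *
        B ^ (2 * (s + 1)) * (h ^ (2 * s) * h) := by
        have : (16 : ℝ) ^ s = 4 ^ s * 2 ^ (2 * s) := by
          rw [pow_mul, ← mul_pow]
          norm_num
        rw [this]
        ring
    _ ≤ 20000 * 16 ^ s * K ^ 2 * M * P ^ (2 * s + 1) * J ^ (2 * s + 1) * θ ^ (s + 1) *
        B ^ (2 * (s + 1)) * (l ^ (2 * s) * (2 * K ^ 2 * P * θ)) := by gcongr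
    _ = (P * B) ^ (2 * (s + 1)) * (40000 * 16 ^ s * K ^ (4 + 0 * s) *
        (M * (J ^ (2 * s + 1) * l ^ (2 * s) * θ ^ (s + 2)))) := by ring
    _ ≤ (P * B) ^ (2 * (s + 1)) * (200 * M * K ^ 5 * T) ^ (2 * (s + 1)) := by
        refine mul_le_mul_of_nonneg_left (hT.le_pow hM hθ hJ hl hK ?_) (by positivity)
        exact const_le_pow hK (by norm_num) (by norm_num) (by norm_num) (by omega)
    _ = _ := by ring

section Family

variable {ι : Type*} {q h : ℕ} {N L : ι → ℕ}

theorem IntervalFamily.left_boundary (hF : IntervalFamily q h N L) {m : ℕ} (hm : 2 * m ≤ h) :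
    IntervalFamily q m N (fun _ => m) where
  le_length _ := le_rfl
  length_le _ := by omega
  disjoint i j hij := by
    have h1 := hF.le_length i
    have h2 := hF.le_length j
    have := hF.disjoint i j hij
    omega
  bound i := by
    have := hF.bound i
    omega

theorem IntervalFamily.right_boundary (hF : IntervalFamily q h N L) {m : ℕ} (hm : 2 * m ≤ h) :
    IntervalFamily q m (fun i => N i + L i) (fun _ => m) where
  le_length _ := le_rfl
  length_le _ := by omega
  disjoint i j hij := by
    have h1 := hF.le_length i
    have h2 := hF.le_length j
    have := hF.disjoint i j hij
    omega
  bound i := by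
    have h1 := hF.bound i
    have h2 := hF.length_le i
    omega

variable [Fintype ι]

theorem IntervalFamily.norm_familySum_le_card (hF : IntervalFamily q h N L)
    (χ : DirichletCharacter ℂ q) : ‖familySum χ N L‖ ≤ 2 * (Fintype.card ι * h) := by
  rw [familySum, ← sum_points (f := fun _ n => χ (n : ZMod q))]
  refine (norm_sum_le_of_le _ fun p _ => norm_mulChar_le_one χ _).trans ?_
  rw [Finset.sum_const, nsmul_eq_mul, mul_one]
  exact_mod_cast hF.card_points_le

/-- The recursive step: a bound for sums over families of short intervals implies one for families
of longer intervals. -/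
theorem IntervalFamily.norm_familySum_step [NeZero q] {s K l : ℕ} {θ T M D : ℝ}
    {χ : DirichletCharacter ℂ q} (hχ : χ.IsPrimitive)
    (hmom : ∀ B : ℕ, ∑ x : ZMod q, ‖∑ b ∈ Finset.Icc (1 : ℤ) B, χ (x + (b : ZMod q))‖ ^ (2 * (s + 1)) ≤
      M * (q * (B : ℝ) ^ (s + 1) + √q * (B : ℝ) ^ (2 * (s + 1))))
    (hM : 1 ≤ M) (hθ : 1 ≤ θ) (hq : (q : ℝ) = θ ^ (2 * (s + 1)))
    (hK : 100 * (1 + Nat.log 2 q) ≤ K) (hθl : θ ≤ l) (hlq : 2 * l ≤ q)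
    (hJ : 0 < Fintype.card ι) (hT : IsTarget s θ (Fintype.card ι) l T)
    (hF : IntervalFamily q h N L) (hKh : K ≤ h) (hhl : h ≤ l)
    (hD : ∀ m : ℕ, K * m ≤ h → ∀ N' L' : ι → ℕ, IntervalFamily q m N' L' →
      ‖familySum χ N' L'‖ ≤ D) :
    ‖familySum χ N L‖ ≤ 2 * D + 200 * M * K ^ 5 * T := by
  have hK100 : 100 ≤ K := by omega
  have hK1 : (1 : ℝ) ≤ K := by exact_mod_cast (by omega : 1 ≤ K)
  have hK0 : 0 < K := by omega
  have hh0 : 0 < h := by omega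
  have hD' : ∀ m : ℕ, K * m ≤ h → ‖familySum χ N (fun _ => m)‖ ≤ D ∧
      ‖familySum χ (fun i => N i + L i) (fun _ => m)‖ ≤ D := by
    intro m hm
    have h2 : 2 * m ≤ h := by nlinarith
    exact ⟨hD m hm _ _ (hF.left_boundary h2), hD m hm _ _ (hF.right_boundary h2)⟩
  have hT0 := hT.nonneg
  have hR0 : 0 ≤ 200 * M * K ^ 5 * T := by positivity
  have hJ0 : (0 : ℝ) ≤ Fintype.card ι := by positivity
  have hsqrt : √(q : ℝ) = θ ^ (s + 1) := by
    rw [hq, pow_mul', Real.sqrt_sq (by positivity)]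
  have hY : ((points N L).card : ℝ) ≤ 2 * (Fintype.card ι * h) := by
    exact_mod_cast hF.card_points_le
  have hhl' : (h : ℝ) ≤ l := by exact_mod_cast hhl
  have hE1 : (energy q N L {1} : ℝ) ≤ 6 * (Fintype.card ι * h) := by
    exact_mod_cast hF.energy_singleton_one_le
  have hB0 : 0 < h / K := Nat.div_pos hKh hK0
  have hKB : K * (h / K) ≤ h := Nat.mul_div_le h K
  have hhB : (h : ℝ) ≤ 2 * K * (h / K : ℕ) := by
    have h1 := Nat.lt_mul_div_succ h hK0
    have : h ≤ 2 * K * (h / K) := by nlinarith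
    exact_mod_cast this
  have hD1 : ∀ a ∈ ({1} : Finset ℕ), ∀ b ∈ Finset.Icc 1 (h / K),
      ‖familySum χ N (fun _ => a * b)‖ ≤ D ∧
      ‖familySum χ (fun i => N i + L i) (fun _ => a * b)‖ ≤ D := by
    intro a ha b hb
    rw [Finset.mem_singleton] at ha
    subst ha
    refine hD' _ (le_trans ?_ hKB)
    rw [one_mul]
    exact Nat.mul_le_mul_left _ (Finset.mem_Icc.mp hb).2
  by_cases hdense : θ ^ (2 * s + 3) ≤ Fintype.card ι * (l : ℝ) ^ 2
  · refine norm_familySum_le_of_moment χ (Finset.singleton_nonempty 1) (by simp) hB0 hD1 0 hE1 hY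
      (M := q * (h / K : ℕ)) ?_ hR0 ?_
    · refine sum_norm_sq_short_sum_le hχ ((Nat.div_le_self h K).trans (by omega))
    · rw [Finset.card_singleton, Nat.cast_one]
      exact dense_inequality hT hM (by positivity) hJ0 hK1 (by positivity) (by positivity) hhB
        hdense hq
  rw [not_le] at hdense
  by_cases hshort : (h : ℝ) ≤ K ^ 3 * θ
  · refine norm_familySum_le_of_moment χ (Finset.singleton_nonempty 1) (by simp) hB0 hD1 s hE1 hY
      (hmom _) hR0 ?_
    rw [Finset.card_singleton, Nat.cast_one, hsqrt]
    refine short_inequality hT hM (by positivity) hJ0 hK1 (by positivity) (by positivity) hhl' hθl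
      hhB ?_ hq
    have h1 : (K : ℝ) * (h / K : ℕ) ≤ h := by exact_mod_cast hKB
    refine le_of_mul_le_mul_left ?_ (zero_lt_one.trans_le hK1)
    linarith [show (K : ℝ) ^ 3 * θ = K * (K ^ 2 * θ) by ring]
  rw [not_le] at hshort
  set B := ⌊θ⌋₊ with hB
  have hB0' : 0 < B := Nat.floor_pos.mpr hθ
  have hBθ : (B : ℝ) ≤ θ := Nat.floor_le (by positivity)
  have hθB : θ ≤ 2 * B := by
    have h1 := Nat.lt_floor_add_one θ
    have h2 : (1 : ℝ) ≤ B := by exact_mod_cast hB0'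
    linarith
  have hB1 : (1 : ℝ) ≤ B := by exact_mod_cast hB0'
  set A := h / (K * B) with hA
  have hKB0 : 0 < K * B := by positivity
  have hAKB : K * B * A ≤ h := Nat.mul_div_le h (K * B)
  have hKA : K * K ≤ A := by
    rw [hA, Nat.le_div_iff_mul_le hKB0]
    have : (K * K * (K * B) : ℝ) ≤ h := by
      calc (K * K * (K * B) : ℝ) = K ^ 3 * B := by ring
        _ ≤ K ^ 3 * θ := by gcongr
        _ ≤ h := hshort.le
    exact_mod_cast this
  have hA0 : 0 < A := lt_of_lt_of_le (by positivity) hKA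
  have hAh : A ≤ h := Nat.div_le_self _ _
  have hJ1 : (1 : ℝ) ≤ Fintype.card ι := by exact_mod_cast hJ
  have hJAh' : (Fintype.card ι * (A * h) * K : ℝ) ≤ 2 * q := by
    have h1 : (K * B * A : ℝ) ≤ h := by exact_mod_cast hAKB
    refine le_of_mul_le_mul_right ?_ (zero_lt_one.trans_le hB1)
    calc (Fintype.card ι * (A * h) * K * B : ℝ) = Fintype.card ι * ((K * B * A) * h) := by ring
      _ ≤ Fintype.card ι * (l * l) := by
          have := h1.trans hhl'
          gcongr
      _ = Fintype.card ι * (l : ℝ) ^ 2 := by ring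
      _ ≤ θ ^ (2 * s + 3) := hdense.le
      _ = q * θ := by
          rw [hq]
          ring
      _ ≤ q * (2 * B) := by gcongr
      _ = 2 * q * B := by ring
  have hJAh : Fintype.card ι * (A * h) * K ≤ 2 * q := by exact_mod_cast hJAh'
  have hJAh1 : Fintype.card ι * (A * h) * 100 ≤ 2 * q :=
    (Nat.mul_le_mul_left _ hK100).trans hJAh
  obtain ⟨𝒜, h𝒜, hcard⟩ := exists_primes (NeZero.pos q) (A := A) (by omega) hK hKA
  have hP0 : 0 < 𝒜.card := by
    rcases Nat.eq_zero_or_pos 𝒜.card with h0 | h0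
    · rw [h0] at hcard
      omega
    · exact h0
  have hPA : 𝒜.card ≤ A := by
    refine (Finset.card_le_card (t := Finset.Icc 1 A) fun a ha => ?_).trans (by simp)
    exact Finset.mem_Icc.mpr ⟨(h𝒜 a ha).1.pos, (h𝒜 a ha).2.1⟩
  have hE := hF.energy_le hh0 hA0 (by nlinarith [Nat.mul_pos hA0 hh0]) (𝒜 := 𝒜)
    (fun a ha => ⟨(h𝒜 a ha).1, (h𝒜 a ha).2.1, (h𝒜 a ha).2.2.1⟩) hK1
    (fun a ha => by exact_mod_cast (h𝒜 a ha).2.2.2) hAh (by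
      calc 𝒜.card * (Fintype.card ι * h) ≤ A * (Fintype.card ι * h) := by gcongr
        _ = Fintype.card ι * (A * h) := by ring
        _ ≤ 2 * q := by omega)
  refine norm_familySum_le_of_moment χ (Finset.card_pos.mp hP0) (fun a ha => (h𝒜 a ha).2.2.1) hB0'
    (fun a ha b hb => hD' _ ?_) s hE hY (hmom _) hR0 ?_
  · refine le_trans ?_ hAKB
    calc K * (a * b) ≤ K * (A * B) := by
          gcongr
          · exact (h𝒜 a ha).2.1
          · exact (Finset.mem_Icc.mp hb).2
      _ = _ := by ring
  · rw [hsqrt]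
    refine long_inequality hT hM (by positivity) hJ0 hK1 (by positivity) (by positivity) hhl'
      (by positivity) hθB ?_ hq ?_
    · have h1 : h ≤ 2 * (K * B * A) := by
        have := Nat.lt_mul_div_succ h hKB0
        rw [← hA] at this
        nlinarith
      have h1' : (h : ℝ) ≤ 2 * (K * B * A) := by exact_mod_cast h1
      have h2 : (A : ℝ) ≤ K * 𝒜.card := by exact_mod_cast hcard
      calc (h : ℝ) ≤ 2 * (K * B * A) := h1'
        _ ≤ 2 * (K * θ * (K * 𝒜.card)) := by gcongr
        _ = _ := by ring
    · have h1 : (1 + Nat.log 2 q : ℝ) ≤ K := by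
        have : 1 + Nat.log 2 q ≤ K := by omega
        exact_mod_cast this
      refine mul_le_mul_of_nonneg_right ?_ (by positivity)
      nlinarith

/-- The recursive step, iterated. -/
theorem IntervalFamily.norm_familySum_le [NeZero q] {s K l : ℕ} {θ T M : ℝ}
    {χ : DirichletCharacter ℂ q} (hχ : χ.IsPrimitive)
    (hmom : ∀ B : ℕ, ∑ x : ZMod q, ‖∑ b ∈ Finset.Icc (1 : ℤ) B, χ (x + (b : ZMod q))‖ ^ (2 * (s + 1)) ≤
      M * (q * (B : ℝ) ^ (s + 1) + √q * (B : ℝ) ^ (2 * (s + 1))))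
    (hM : 1 ≤ M) (hθ : 1 ≤ θ) (hq : (q : ℝ) = θ ^ (2 * (s + 1)))
    (hK : 100 * (1 + Nat.log 2 q) ≤ K) (hθl : θ ≤ l) (hlq : 2 * l ≤ q)
    (hJ : 0 < Fintype.card ι) (hJl : (Fintype.card ι * l : ℝ) ≤ 3 * q)
    (hT : IsTarget s θ (Fintype.card ι) l T) (n : ℕ) :
    ∀ (h : ℕ) (N L : ι → ℕ), IntervalFamily q h N L → h ≤ l → h < K ^ n →
      ‖familySum χ N L‖ ≤ (2 ^ n - 1) * (200 * M * K ^ 5 * T) := by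
  have hK1 : (1 : ℝ) ≤ K := by exact_mod_cast (by omega : 1 ≤ K)
  have hT0 := hT.nonneg
  induction n with
  | zero =>
    intro h N L hF _ hn
    have h0 : h = 0 := by simpa using hn
    subst h0
    have := hF.norm_familySum_le_card χ
    simpa using this
  | succ n ih =>
    intro h N L hF hhl hn
    by_cases hKh : K ≤ h
    · refine (hF.norm_familySum_step hχ hmom hM hθ hq hK hθl hlq hJ hT hKh hhl
        (D := (2 ^ n - 1) * (200 * M * K ^ 5 * T)) fun m hm N' L' hF' => ?_).trans_eq (by ring)
      refine ih m N' L' hF' ?_ ?_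
      · nlinarith
      · rw [pow_succ'] at hn
        exact Nat.lt_of_mul_lt_mul_left (hm.trans_lt hn)
    · have h1 := hF.norm_familySum_le_card χ
      have h2 : (Fintype.card ι : ℝ) ≤ 3 * T := by
        set J : ℝ := ((Fintype.card ι : ℕ) : ℝ) with hJdef
        have hJ1 : 1 ≤ J := by
          rw [hJdef]
          exact_mod_cast hJ
        have hl0 : (0 : ℝ) < l := by linarith
        refine le_of_pow_le_pow_left₀ (n := 2 * (s + 1)) (by omega) (by positivity) ?_
        rw [mul_pow, hT.pow_eq]
        have h3 : J ≤ 3 * (l ^ (2 * s) * θ ^ (s + 2)) := by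
          refine le_of_mul_le_mul_right ?_ hl0
          calc J * l ≤ 3 * q := hJl
            _ = 3 * (θ ^ (2 * s) * θ ^ 1 * θ) := by
                rw [hq]
                ring
            _ ≤ 3 * (l ^ (2 * s) * θ ^ (s + 2) * l) := by
                gcongr
                omega
            _ = _ := by ring
        calc J ^ (2 * (s + 1)) = J ^ (2 * s + 1) * J := by ring
          _ ≤ J ^ (2 * s + 1) * (3 * (l ^ (2 * s) * θ ^ (s + 2))) := by gcongr
          _ = 3 ^ 1 * (J ^ (2 * s + 1) * l ^ (2 * s) * θ ^ (s + 2)) := by ring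
          _ ≤ 3 ^ (2 * (s + 1)) * (J ^ (2 * s + 1) * l ^ (2 * s) * θ ^ (s + 2)) := by
              gcongr
              · norm_num
              · omega
      have h3 : (h : ℝ) ≤ K := by exact_mod_cast (by omega : h ≤ K)
      have h4 : (1 : ℝ) ≤ 2 ^ n := one_le_pow₀ one_le_two
      calc ‖familySum χ N L‖ ≤ 2 * (Fintype.card ι * h) := h1
        _ ≤ 2 * (3 * T * K) := by gcongr
        _ ≤ 200 * 1 * K ^ 1 * T := by nlinarith [mul_nonneg hT0 (zero_le_one.trans hK1)]
        _ ≤ 200 * M * K ^ 5 * T := by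
            gcongr
            norm_num
        _ ≤ _ := by
            refine le_mul_of_one_le_left (by positivity) ?_
            rw [pow_succ]
            linarith

end Family

theorem IntervalFamily.card_mul_le {ι : Type*} [Fintype ι] {q h : ℕ} {N L : ι → ℕ}
    (hF : IntervalFamily q h N L) : Fintype.card ι * h ≤ 3 * q := by
  have h1 : Fintype.card ι * h ≤ (points N L).card := by
    rw [points, Finset.card_sigma]
    calc Fintype.card ι * h = ∑ _i : ι, h := by simp
      _ ≤ _ := Finset.sum_le_sum fun i _ => by simpa using hF.le_length i
  refine h1.trans ?_
  rw [← Finset.card_image_of_injOn hF.snd_injOn]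
  refine (Finset.card_le_card (t := Finset.Ioc 0 (3 * q)) fun n hn => ?_).trans (by simp)
  obtain ⟨p, hp, rfl⟩ := Finset.mem_image.mp hn
  rw [mem_points] at hp
  have h2 := hF.bound p.1
  have h3 := hF.length_le p.1
  rw [Finset.mem_Ioc]
  omega

theorem isTarget_rpow {s : ℕ} {q J l : ℝ} (hq : 0 < q) (hJ : 0 < J) (hl : 0 < l) {r : ℝ}
    (hr : r = s + 1) :
    IsTarget s (q ^ (1 / (2 * r))) J l
      (J ^ (1 - 1 / (2 * r)) * q ^ (1 / (4 * r) + 1 / (4 * r ^ 2)) * l ^ (1 - 1 / r)) where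
  nonneg := by positivity
  pow_eq := by
    have hr0 : r ≠ 0 := by
      rw [hr]
      positivity
    have hs : (s : ℝ) = r - 1 := by linarith
    rw [mul_pow, mul_pow, ← Real.rpow_mul_natCast hJ.le, ← Real.rpow_mul_natCast hq.le,
      ← Real.rpow_mul_natCast hl.le, ← Real.rpow_mul_natCast hq.le, ← Real.rpow_natCast J,
      ← Real.rpow_natCast l]
    push_cast
    rw [hs, show (1 - 1 / (2 * r)) * (2 * (r - 1 + 1)) = 2 * (r - 1) + 1 by
        field_simp
        ring,
      show (1 / (4 * r) + 1 / (4 * r ^ 2)) * (2 * (r - 1 + 1)) =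
        1 / (2 * r) * (r - 1 + 2) by
        field_simp
        ring,
      show (1 - 1 / r) * (2 * (r - 1 + 1)) = 2 * (r - 1) by
        field_simp
        ring]
    ring

theorem exists_le_log_le_rpow {η : ℝ} (hη : 0 < η) :
    ∃ c : ℝ, 1 ≤ c ∧ ∀ q : ℕ, 0 < q → ((100 * (1 + Nat.log 2 q) : ℕ) : ℝ) ≤ c * (q : ℝ) ^ η := by
  have hl2 : 0 < Real.log 2 := Real.log_pos one_lt_two
  have h0 : 0 < 1 / (η * Real.log 2) := by positivity
  refine ⟨100 * (1 + 1 / (η * Real.log 2)), by linarith, fun q hq => ?_⟩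
  have hq1 : (1 : ℝ) ≤ q := by exact_mod_cast hq
  have h1 : (1 : ℝ) ≤ (q : ℝ) ^ η := Real.one_le_rpow hq1 hη.le
  have h2 : (Nat.log 2 q : ℝ) * Real.log 2 ≤ Real.log q := by
    rw [← Real.log_pow]
    refine Real.log_le_log (by positivity) ?_
    exact_mod_cast Nat.pow_log_le_self 2 hq.ne'
  have h3 : Real.log q ≤ (q : ℝ) ^ η / η := Real.log_le_rpow_div (by positivity) hη
  have h4 : (Nat.log 2 q : ℝ) ≤ 1 / (η * Real.log 2) * (q : ℝ) ^ η := by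
    calc (Nat.log 2 q : ℝ) ≤ ((q : ℝ) ^ η / η) / Real.log 2 := by
          rw [le_div_iff₀ hl2]
          exact h2.trans h3
      _ = _ := by field_simp
  push_cast
  linarith

/-- Burgess's bound for families of disjoint intervals. -/
theorem exists_norm_familySum_le {s : ℕ} {ε : ℝ} (hε : 0 < ε) {r : ℝ} (hr : r = s + 1) :
    ∃ C : ℝ, 0 ≤ C ∧ ∀ (q : ℕ) [NeZero q], (∀ p : ℕ, p.Prime → ¬ p ^ 3 ∣ q) →
      ∀ χ : DirichletCharacter ℂ q, χ.IsPrimitive → ∀ l : ℕ, 0 < l →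
      (q : ℝ) ^ (1 / (2 * r)) ≤ l → 2 * l ≤ q →
      ∀ {ι : Type} [Fintype ι] (N L : ι → ℕ), 0 < Fintype.card ι → IntervalFamily q l N L →
      ‖familySum χ N L‖ ≤ C * (Fintype.card ι : ℝ) ^ (1 - 1 / (2 * r)) *
        (q : ℝ) ^ (1 / (4 * r) + 1 / (4 * r ^ 2) + ε) * (l : ℝ) ^ (1 - 1 / r) := by
  obtain ⟨η, hη, hηε⟩ : ∃ η : ℝ, 0 < η ∧ 6 * η = ε := ⟨ε / 6, by positivity, by ring⟩
  obtain ⟨C₀, -, hmom⟩ := exists_moment_le (r := s + 1) s.succ_pos hη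
  obtain ⟨c, hc1, hc⟩ := exists_le_log_le_rpow hη
  set n := ⌈1 / η⌉₊ with hn
  set C₁ := max C₀ 1 with hC₁
  have hC1 : 1 ≤ C₁ := le_max_right _ _
  refine ⟨2 ^ n * (200 * C₁ * (2 * c) ^ 5), by positivity, ?_⟩
  intro q _ hq3 χ hχ l hl0 hθl hlq ι _ N L hJ hF
  have hq0 : 0 < q := NeZero.pos q
  have hq1 : (1 : ℝ) ≤ q := by exact_mod_cast hq0
  have hqη : (1 : ℝ) ≤ (q : ℝ) ^ η := Real.one_le_rpow hq1 hη.le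
  set K := ⌈c * (q : ℝ) ^ η⌉₊ with hK
  have hKlog : 100 * (1 + Nat.log 2 q) ≤ K := by
    have := (hc q hq0).trans (Nat.le_ceil _)
    exact_mod_cast this
  have hcq : 1 ≤ c * (q : ℝ) ^ η := one_le_mul_of_one_le_of_one_le hc1 hqη
  have hK2 : (K : ℝ) ≤ 2 * c * (q : ℝ) ^ η := by
    have := (Nat.ceil_lt_add_one (zero_le_one.trans hcq)).le
    linarith
  have hqK : (q : ℝ) ≤ (K : ℝ) ^ n := by
    have h1 : (q : ℝ) ^ η ≤ K :=
      (le_mul_of_one_le_left (by positivity) hc1).trans (Nat.le_ceil _)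
    calc (q : ℝ) = (q : ℝ) ^ (η * (1 / η)) := by
          rw [mul_one_div_cancel hη.ne', Real.rpow_one]
      _ ≤ (q : ℝ) ^ (η * n) := by
          refine Real.rpow_le_rpow_of_exponent_le hq1 ?_
          exact mul_le_mul_of_nonneg_left (Nat.le_ceil _) hη.le
      _ = ((q : ℝ) ^ η) ^ n := Real.rpow_mul_natCast (by positivity) _ _
      _ ≤ (K : ℝ) ^ n := by gcongr
  have hqK' : q ≤ K ^ n := by exact_mod_cast hqK
  have hr0 : 0 < r := by
    rw [hr]
    positivity
  have hl0' : (0 : ℝ) < l := by exact_mod_cast hl0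
  have hJ0 : (0 : ℝ) < Fintype.card ι := by exact_mod_cast hJ
  have hM : 1 ≤ C₁ * (q : ℝ) ^ η := one_le_mul_of_one_le_of_one_le hC1 hqη
  have hT := isTarget_rpow (J := Fintype.card ι) (zero_lt_one.trans_le hq1) hJ0 hl0' hr
  have key := IntervalFamily.norm_familySum_le (K := K) hχ (M := C₁ * (q : ℝ) ^ η) (fun B => by
      refine (hmom q hq3 χ (LocallyPrimitive.of_isPrimitive hχ) B).trans ?_
      have : C₀ ≤ C₁ := le_max_left _ _
      gcongr) hM (Real.one_le_rpow hq1 (by positivity)) (by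
      rw [← Real.rpow_mul_natCast (by positivity)]
      push_cast
      rw [← hr, one_div_mul_cancel (by positivity), Real.rpow_one]) hKlog hθl hlq hJ
    (by exact_mod_cast hF.card_mul_le) hT n l N L hF le_rfl (by omega)
  refine key.trans ?_
  have hT0 := hT.nonneg
  set T := (Fintype.card ι : ℝ) ^ (1 - 1 / (2 * r)) * (q : ℝ) ^ (1 / (4 * r) + 1 / (4 * r ^ 2)) *
    (l : ℝ) ^ (1 - 1 / r) with hTdef
  have hη6 : ((q : ℝ) ^ η) ^ 6 = (q : ℝ) ^ ε := by
    rw [← Real.rpow_mul_natCast (by positivity), ← hηε]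
    congr 1
    push_cast
    ring
  calc _ ≤ 2 ^ n * (200 * (C₁ * (q : ℝ) ^ η) * (2 * c * (q : ℝ) ^ η) ^ 5 * T) := by
        gcongr
        linarith
    _ = 2 ^ n * (200 * C₁ * (2 * c) ^ 5) * ((q : ℝ) ^ η) ^ 6 * T := by ring
    _ = _ := by
        rw [hη6, hTdef, Real.rpow_add (zero_lt_one.trans_le hq1) _ ε]
        ring

end Burgess

/-- Hölder-step bound: for `q` cube-free, `χ` primitive mod `q`, a positive integer `ℓ` with
`q^{1/(2r)} ≤ ℓ` and `2ℓ ≤ q`, and pairwise disjoint intervals `(N_j, N_j + L_j] ⊆ [0, q)`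
with `ℓ ≤ L_j ≤ 2ℓ` and `0 ≤ N_1 < ⋯ < N_J < q`,
`|∑_j S(N_j; L_j)| ≤ C(ε,r) J^{1-1/(2r)} q^{1/(4r)+1/(4r²)+ε} ℓ^{1-1/r}`. -/
theorem stmt_12 (r : ℕ) (hr : 0 < r) (ε : ℝ) (hε : 0 < ε) :
    ∃ C : ℝ, ∀ (q : ℕ), 0 < q → (∀ p : ℕ, p.Prime → ¬ p ^ 3 ∣ q) →
      ∀ (χ : DirichletCharacter ℂ q), DirichletCharacter.IsPrimitive χ →
      ∀ (ℓ : ℕ), 0 < ℓ → (q : ℝ) ^ ((1 : ℝ) / (2 * r)) ≤ (ℓ : ℝ) → 2 * ℓ ≤ q →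
      ∀ (J : ℕ) (N L : ℕ → ℕ),
        (∀ j, 1 ≤ j → j ≤ J → ℓ ≤ L j ∧ L j ≤ 2 * ℓ) →
        (∀ j, 1 ≤ j → j ≤ J → N j + L j < q) →
        (∀ i j, 1 ≤ i → i < j → j ≤ J → N i < N j) →
        (∀ i j, 1 ≤ i → i < j → j ≤ J →
          Disjoint (Finset.Ioc (N i) (N i + L i)) (Finset.Ioc (N j) (N j + L j))) →
        ‖∑ j ∈ Finset.Icc 1 J, ∑ n ∈ Finset.Ioc (N j) (N j + L j), χ (n : ZMod q)‖
          ≤ C * (J : ℝ) ^ ((1 : ℝ) - 1 / (2 * r)) *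
              (q : ℝ) ^ ((1 : ℝ) / (4 * r) + 1 / (4 * r ^ 2) + ε) *
              (ℓ : ℝ) ^ ((1 : ℝ) - 1 / r) := by
  obtain ⟨s, rfl⟩ := Nat.exists_eq_succ_of_ne_zero hr.ne'
  obtain ⟨C, hC0, hC⟩ := Burgess.exists_norm_familySum_le (s := s) hε (Nat.cast_succ s)
  refine ⟨C, fun q hq hq3 χ hχ l hl hθ hlq J N L hL hN hlt hdisj => ?_⟩
  have : NeZero q := ⟨hq.ne'⟩
  rcases Nat.eq_zero_or_pos J with rfl | hJ
  · rw [Finset.Icc_eq_empty (by norm_num), Finset.sum_empty, norm_zero]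
    positivity
  have hsep : ∀ i j, 1 ≤ i → i < j → j ≤ J → N i + L i ≤ N j := by
    intro i j hi hij hj
    by_contra! h
    have h1 := hlt i j hi hij hj
    have h2 := (hL j (by omega) hj).1
    have h3 : N j + 1 ∈ Finset.Ioc (N i) (N i + L i) := by
      rw [Finset.mem_Ioc]
      omega
    have h4 : N j + 1 ∈ Finset.Ioc (N j) (N j + L j) := by
      rw [Finset.mem_Ioc]
      omega
    exact Finset.disjoint_left.mp (hdisj i j hi hij hj) h3 h4
  have hF : Burgess.IntervalFamily q l (fun j : Finset.Icc 1 J => N j)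
      (fun j => L j) := by
    have hmem : ∀ j : Finset.Icc 1 J, 1 ≤ j.1 ∧ j.1 ≤ J := fun j =>
      Finset.mem_Icc.mp j.2
    refine ⟨fun j => (hL j (hmem j).1 (hmem j).2).1, fun j => (hL j (hmem j).1 (hmem j).2).2,
      fun i j hij => ?_, fun j => ?_⟩
    · rcases lt_or_gt_of_ne (Subtype.coe_ne_coe.mpr hij) with h | h
      · exact Or.inl (hsep i j (hmem i).1 h (hmem j).2)
      · exact Or.inr (hsep j i (hmem j).1 h (hmem i).2)
    · have h1 := hN j (hmem j).1 (hmem j).2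
      omega
  have hcard : Fintype.card (Finset.Icc 1 J) = J := by
    rw [Fintype.card_coe, Nat.card_Icc]
    omega
  have key := hC q hq3 χ hχ l hl hθ hlq _ _ (by rwa [hcard]) hF
  rw [hcard, Burgess.familySum, Finset.sum_coe_sort (Finset.Icc 1 J)
    (fun j => ∑ n ∈ Finset.Ioc (N j) (N j + L j), χ (n : ZMod q))] at key
  exact key
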